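/- arXiv:1708.01211 — 7 statements merged into one kernel-verified Lean document; each statement's English description precedes it below -/
import Mathlib

section
/- Fix an integer r ≥ 2. There is a constant K > 0 such that the following holds with high probability as n → ∞. Let f₁,…,f_r : [n] → [n] be independent uniformly random functions subject to f_i(v) ≠ v for all v. Then there is a coloring c : {1,…,r} × [n] → {1,…,r} (where c(i,v) is the color of the edge {v, f_i(v)}) such that for every color j ∈ {1,…,r}, every connected component of the graph on [n] whose edges are the pairs {v, f_i(v)} with c(i,v) = j has at most K·n^{0.9} vertices. -/
section Aux6
open Finset Classical

/-- the edge out of `u` is not inside `W` -/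
def Unc {V : Type*} (W : Finset V) (f : V → V) (u : V) : Prop := ¬ (u ∈ W ∧ f u ∈ W)

/-- forward paths of uncut edges merge -/
def Rl {V : Type*} (W : Finset V) (f : V → V) (u v : V) : Prop :=
  ∃ a b, f^[a] u = f^[b] v ∧ (∀ i < a, Unc W f (f^[i] u)) ∧ (∀ i < b, Unc W f (f^[i] v))

theorem Rl.refl {V : Type*} (W : Finset V) (f : V → V) (u : V) : Rl W f u u :=
  ⟨0, 0, rfl, by simp, by simp⟩

theorem Rl.symm {V : Type*} {W : Finset V} {f : V → V} {u v : V} (h : Rl W f u v) :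
    Rl W f v u := by
  obtain ⟨a, b, h1, h2, h3⟩ := h
  exact ⟨b, a, h1.symm, h3, h2⟩

theorem Rl.step {V : Type*} {W : Finset V} {f : V → V} {u : V} (h : Unc W f u) :
    Rl W f u (f u) :=
  ⟨1, 0, rfl, by intro i hi; obtain rfl : i = 0 := by omega
                 simpa using h, by simp⟩

theorem Rl.aux {V : Type*} {W : Finset V} {f : V → V} {u v w : V} {a b c d : ℕ}
    (h1 : f^[a] u = f^[b] v) (h2 : ∀ i < a, Unc W f (f^[i] u))
    (h4 : f^[c] v = f^[d] w) (h5 : ∀ i < c, Unc W f (f^[i] v))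
    (h6 : ∀ i < d, Unc W f (f^[i] w)) (hbc : b ≤ c) : Rl W f u w := by
  have key : ∀ k, f^[k + a] u = f^[k + b] v := by
    intro k; rw [Function.iterate_add_apply, h1, ← Function.iterate_add_apply]
  refine ⟨(c - b) + a, d, ?_, ?_, h6⟩
  · rw [key, Nat.sub_add_cancel hbc, h4]
  · intro i hi
    by_cases hia : i < a
    · exact h2 i hia
    · have := key (i - a)
      rw [Nat.sub_add_cancel (by omega)] at this
      rw [this]
      exact h5 _ (by omega)

theorem Rl.trans {V : Type*} {W : Finset V} {f : V → V} {u v w : V} (h : Rl W f u v)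
    (h' : Rl W f v w) : Rl W f u w := by
  obtain ⟨a, b, h1, h2, h3⟩ := h
  obtain ⟨c, d, h4, h5, h6⟩ := h'
  rcases le_total b c with hbc | hbc
  · exact Rl.aux h1 h2 h4 h5 h6 hbc
  · exact (Rl.aux h4.symm h6 h1.symm h3 h2 hbc).symm

/-- fixed point free functions -/
noncomputable def Fpf (V : Type*) [Fintype V] : Finset (V → V) :=
  Finset.univ.filter fun f => ∀ v, f v ≠ v

theorem mem_Fpf {V : Type*} [Fintype V] (f : V → V) : f ∈ Fpf V ↔ ∀ v, f v ≠ v := by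
  simp [Fpf]

theorem card_spec {V : Type*} [Fintype V] (Z : Finset V) (g : V → V) :
    ((Fpf V).filter fun f => ∀ v ∈ Z, f v = g v).card
      ≤ (Fintype.card V - 1) ^ (Fintype.card V - Z.card) := by
  calc _ ≤ (Fintype.piFinset fun v => if v ∈ Z then {g v} else univ.erase v).card := by
        apply card_le_card
        intro f hf
        simp only [mem_filter, mem_Fpf] at hf
        rw [Fintype.mem_piFinset]
        intro v
        by_cases h : v ∈ Z
        · simp [h, hf.2 v h]
        · simp [h, hf.1 v]
    _ = _ := by
        rw [Fintype.card_piFinset]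
        have : ∀ v, (if v ∈ Z then ({g v} : Finset V) else univ.erase v).card
            = if v ∈ Z then 1 else (Fintype.card V - 1) := by
          intro v; split_ifs <;> simp [card_erase_of_mem]
        simp_rw [this]
        rw [prod_ite]
        simp only [prod_const_one, prod_const, one_mul]
        congr 1
        rw [filter_not, filter_mem_eq_inter, univ_inter, card_sdiff_of_subset (subset_univ _), card_univ]

theorem card_Fpf {V : Type*} [Fintype V] :
    (Fpf V).card = (Fintype.card V - 1) ^ (Fintype.card V) := by
  have : Fpf V = Fintype.piFinset fun v => univ.erase v := by
    ext f; simp [mem_Fpf, Fintype.mem_piFinset]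
  rw [this, Fintype.card_piFinset]
  simp [card_erase_of_mem]

/-- cut-free sequences -/
noncomputable def Zs {V : Type*} [Fintype V] (W : Finset V) (l : ℕ) : Finset (Fin (l + 1) → V) :=
  univ.filter fun z => Function.Injective z ∧ ∀ i : Fin l, ¬ (z i.castSucc ∈ W ∧ z i.succ ∈ W)

theorem card_Zs_two {V : Type*} [Fintype V] (W : Finset V) (l : ℕ) :
    (Zs W (l + 2)).card ≤ (Fintype.card V ^ 2 - W.card ^ 2) * (Zs W l).card := by
  have : (univ \ (W ×ˢ W)).card = Fintype.card V ^ 2 - W.card ^ 2 := by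
    rw [card_sdiff_of_subset (subset_univ _)]; simp [sq]
  rw [← this, ← card_product]
  apply card_le_card_of_injOn (fun z => ((z 0, z 1), fun i => z i.succ.succ))
  · intro z hz
    simp only [Zs, mem_coe, mem_filter, mem_univ, true_and] at hz
    simp only [Zs, coe_product, Set.mem_prod, mem_coe, mem_filter, mem_univ, true_and, mem_sdiff,
      mem_product]
    refine ⟨hz.2 0, ?_, ?_⟩
    · intro i j hij
      simpa using hz.1 hij
    · intro i
      exact hz.2 i.succ.succ
  · intro z _ z' _ h
    simp only [Prod.mk.injEq] at h
    funext i
    refine Fin.cases h.1.1 (fun i => Fin.cases h.1.2 (fun i => congrFun h.2 i) i) i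

theorem card_Zs_zero {V : Type*} [Fintype V] (W : Finset V) :
    (Zs W 0).card ≤ Fintype.card V := by
  calc _ ≤ (univ : Finset (Fin 1 → V)).card := card_le_card (subset_univ _)
    _ = _ := by simp

theorem card_Zs_one {V : Type*} [Fintype V] (W : Finset V) :
    (Zs W 1).card ≤ Fintype.card V * (Fintype.card V - 1) := by
  calc _ ≤ ((univ : Finset V).offDiag).card := by
        apply card_le_card_of_injOn (fun z => (z 0, z 1))
        · intro z hz
          simp only [Zs, mem_coe, mem_filter, mem_univ, true_and] at hz
          simp only [mem_coe, mem_offDiag, mem_univ, true_and]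
          intro h; simpa using hz.1 h
        · intro z _ z' _ h
          simp only [Prod.mk.injEq] at h
          funext i
          fin_cases i
          · exact h.1
          · exact h.2
    _ = _ := by rw [offDiag_card, card_univ, Nat.mul_sub_one]

theorem card_Zs_bound {V : Type*} [Fintype V] (W : Finset V) (θ : ℝ) (hθ : 0 ≤ θ)
    (h : ((Fintype.card V ^ 2 - W.card ^ 2 : ℕ) : ℝ) ≤ θ * ((Fintype.card V - 1 : ℕ) : ℝ) ^ 2) (k : ℕ) :
    ((Zs W (2 * k)).card : ℝ) ≤ Fintype.card V * ((Fintype.card V - 1 : ℕ) : ℝ) ^ (2 * k) * θ ^ k ∧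
    ((Zs W (2 * k + 1)).card : ℝ) ≤
      Fintype.card V * ((Fintype.card V - 1 : ℕ) : ℝ) ^ (2 * k + 1) * θ ^ k := by
  set m := ((Fintype.card V - 1 : ℕ) : ℝ)
  have hm : 0 ≤ m := Nat.cast_nonneg _
  have step : ∀ l, ((Zs W (l + 2)).card : ℝ) ≤ (θ * m ^ 2) * (Zs W l).card := by
    intro l
    calc ((Zs W (l + 2)).card : ℝ) ≤ ((Fintype.card V ^ 2 - W.card ^ 2 : ℕ) : ℝ) * (Zs W l).card := by
          exact_mod_cast card_Zs_two W l
      _ ≤ _ := by gcongr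
  induction k with
  | zero =>
    constructor
    · simpa using card_Zs_zero W
    · have := card_Zs_one W
      have h2 : ((Zs W 1).card : ℝ) ≤ Fintype.card V * m := by
        simp only [m]; exact_mod_cast this
      simpa using h2
  | succ k ih =>
    constructor
    · calc _ ≤ (θ * m ^ 2) * (Zs W (2 * k)).card := step (2 * k)
        _ ≤ (θ * m ^ 2) * (Fintype.card V * m ^ (2 * k) * θ ^ k) := by gcongr; exact ih.1
        _ = _ := by ring
    · calc _ ≤ (θ * m ^ 2) * (Zs W (2 * k + 1)).card := step (2 * k + 1)
        _ ≤ (θ * m ^ 2) * (Fintype.card V * m ^ (2 * k + 1) * θ ^ k) := by gcongr; exact ih.2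
        _ = _ := by ring

/-- next index -/
def nx {l : ℕ} (a : Fin (l + 1)) (i : Fin (l + 1)) : Fin (l + 1) :=
  if i < a then ⟨min (i + 1) l, by omega⟩ else ⟨i - 1, by omega⟩

theorem card_path {V : Type*} [Fintype V] (l : ℕ) (a : Fin (l + 1)) (z : Fin (l + 1) → V)
    (hz : Function.Injective z) :
    ((Fpf V).filter fun f => ∀ i, i ≠ a → f (z i) = z (nx a i)).card
      ≤ (Fintype.card V - 1) ^ (Fintype.card V - l) := by
  have h := card_spec ((univ.erase a).image z) (fun v => z (nx a (Function.invFun z v)))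
  rw [card_image_of_injective _ hz, card_erase_of_mem (mem_univ _)] at h
  simp only [card_univ, Fintype.card_fin, Nat.add_sub_cancel] at h
  refine le_trans (card_le_card ?_) h
  intro f hf
  simp only [mem_filter] at hf ⊢
  refine ⟨hf.1, ?_⟩
  intro v hv
  simp only [mem_image, mem_erase, mem_univ, and_true] at hv
  obtain ⟨i, hi, rfl⟩ := hv
  rw [Function.leftInverse_invFun hz]
  exact hf.2 i hi

theorem exists_path {V : Type*} [Fintype V] (W : Finset V) (f : V → V) (u v : V)
    (h : Rl W f u v) : ∃ l < Fintype.card V, ∃ a : Fin (l + 1), ∃ z ∈ Zs W l,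
      (∀ i, i ≠ a → f (z i) = z (nx a i)) ∧ z 0 = u ∧ z (Fin.last l) = v := by
  have hex : ∃ l, ∃ a b, a + b = l ∧ f^[a] u = f^[b] v ∧ (∀ i < a, Unc W f (f^[i] u)) ∧
      (∀ i < b, Unc W f (f^[i] v)) := by
    obtain ⟨a, b, h⟩ := h
    exact ⟨a + b, a, b, rfl, h⟩
  obtain ⟨a, b, hab, h1, h2, h3⟩ := Nat.find_spec hex
  have hmin : ∀ a' b', f^[a'] u = f^[b'] v → (∀ i < a', Unc W f (f^[i] u)) →
      (∀ i < b', Unc W f (f^[i] v)) → a + b ≤ a' + b' := by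
    intro a' b' g1 g2 g3
    rw [hab]
    exact Nat.find_min' hex ⟨a', b', rfl, g1, g2, g3⟩
  clear hab
  have hu : ∀ i j, i < j → j ≤ a → f^[i] u ≠ f^[j] u := by
    intro i j hij hj he
    have := hmin ((a - j) + i) b (by
      rw [Function.iterate_add_apply, he, ← Function.iterate_add_apply, Nat.sub_add_cancel hj, h1])
      (fun k hk => h2 k (by omega)) h3
    omega
  have hv : ∀ i j, i < j → j ≤ b → f^[i] v ≠ f^[j] v := by
    intro i j hij hj he
    have := hmin a ((b - j) + i) (by
      rw [Function.iterate_add_apply, he, ← Function.iterate_add_apply, Nat.sub_add_cancel hj, h1])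
      h2 (fun k hk => h3 k (by omega))
    omega
  have huv : ∀ i j, i ≤ a → j < b → f^[i] u ≠ f^[j] v := by
    intro i j hi hj he
    have := hmin i j he (fun k hk => h2 k (by omega)) (fun k hk => h3 k (by omega))
    omega
  let z : Fin (a + b + 1) → V := fun i => if (i : ℕ) ≤ a then f^[i] u else f^[a + b - i] v
  have hzinj : Function.Injective z := by
    have : ∀ i j : Fin (a + b + 1), i < j → z i ≠ z j := by
      intro i j hij
      have hij' : (i : ℕ) < j := hij
      simp only [z]
      by_cases hj : (j : ℕ) ≤ a
      · rw [if_pos hj, if_pos (by omega)]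
        exact hu _ _ hij' hj
      · rw [if_neg hj]
        by_cases hi : (i : ℕ) ≤ a
        · rw [if_pos hi]
          exact huv _ _ hi (by omega)
        · rw [if_neg hi]
          exact (hv _ _ (by omega) (by omega)).symm
    intro i j hij
    by_contra hne
    rcases lt_or_gt_of_ne hne with h | h
    · exact this _ _ h hij
    · exact this _ _ h hij.symm
  have hfz1 : ∀ i j : Fin (a + b + 1), (i : ℕ) < a → (j : ℕ) = i + 1 → z j = f (z i) := by
    intro i j hi hj
    simp only [z]
    rw [if_pos (by omega), if_pos (by omega), hj, Function.iterate_succ_apply']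
  have hfz2 : ∀ i j : Fin (a + b + 1), a < (i : ℕ) → (i : ℕ) = j + 1 → z j = f (z i) := by
    intro i j hi hj
    simp only [z]
    rw [if_neg (show ¬ (i : ℕ) ≤ a by omega), ← Function.iterate_succ_apply' f]
    by_cases hja : (j : ℕ) ≤ a
    · rw [if_pos hja]
      have e1 : (j : ℕ) = a := by omega
      rw [e1, h1]; congr 1; congr 1; omega
    · rw [if_neg hja]; congr 1; congr 1; omega
  refine ⟨a + b, ?_, ⟨a, by omega⟩, z, ?_, ?_, ?_, ?_⟩
  · have := Fintype.card_le_of_injective z hzinj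
    simpa using this
  · simp only [Zs, mem_filter, mem_univ, true_and]
    refine ⟨hzinj, ?_⟩
    intro i
    by_cases hi : (i : ℕ) < a
    · rw [hfz1 i.castSucc i.succ hi (by simp)]
      have := h2 i hi
      have e : z i.castSucc = f^[i] u := by simp only [z]; rw [if_pos]; · rfl
                                            · simp; omega
      rw [e]; exact this
    · rw [hfz2 i.succ i.castSucc (by simp; omega) (by simp)]
      have := h3 (a + b - (i + 1)) (by omega)
      have e : z i.succ = f^[a + b - (i + 1)] v := by
        simp only [z]; rw [if_neg]; · rfl
        · simp; omega
      rw [e]; rw [and_comm]; exact this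
  · intro i hi
    have hi' : (i : ℕ) ≠ a := fun h => hi (Fin.ext h)
    unfold nx
    by_cases hia : (i : ℕ) < a
    · rw [if_pos (by exact hia)]
      exact (hfz1 _ _ hia (by simp; omega)).symm
    · rw [if_neg (by exact hia)]
      exact (hfz2 _ _ (by omega) (by simp; omega)).symm
  · simp [z]
  · simp only [z, Fin.val_last]
    split_ifs with h
    · obtain rfl : b = 0 := by omega
      simpa using h1
    · simp

/-- number of related pairs -/
noncomputable def Pr {V : Type*} [Fintype V] (W : Finset V) (f : V → V) : ℕ :=
  ((univ : Finset (V × V)).filter fun p => Rl W f p.1 p.2).card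

theorem Pr_le {V : Type*} [Fintype V] (W : Finset V) (f : V → V) :
    Pr W f ≤ ∑ l ∈ range (Fintype.card V), ∑ a : Fin (l + 1),
      ((Zs W l).filter fun z => ∀ i, i ≠ a → f (z i) = z (nx a i)).card := by
  calc Pr W f ≤ ((range (Fintype.card V)).biUnion fun l => (univ : Finset (Fin (l + 1))).biUnion
        fun a => ((Zs W l).filter fun z => ∀ i, i ≠ a → f (z i) = z (nx a i)).image
          fun z => (z 0, z (Fin.last l))).card := by
        apply card_le_card
        rintro ⟨u, v⟩ hp
        simp only [mem_filter, mem_univ, true_and] at hp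
        obtain ⟨l, hl, a, z, hz, h1, h2, h3⟩ := exists_path W f u v hp
        simp only [mem_biUnion, mem_image, mem_filter, mem_range, mem_univ, true_and]
        exact ⟨l, hl, a, z, ⟨hz, h1⟩, by rw [h2, h3]⟩
    _ ≤ _ := by
        refine card_biUnion_le.trans (sum_le_sum fun l _ => ?_)
        refine card_biUnion_le.trans (sum_le_sum fun a _ => ?_)
        exact card_image_le

theorem sum_Pr_le {V : Type*} [Fintype V] (W : Finset V) :
    ∑ f ∈ Fpf V, Pr W f ≤ ∑ l ∈ range (Fintype.card V),
      (l + 1) * ((Zs W l).card * (Fintype.card V - 1) ^ (Fintype.card V - l)) := by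
  calc _ ≤ ∑ f ∈ Fpf V, ∑ l ∈ range (Fintype.card V), ∑ a : Fin (l + 1),
      ((Zs W l).filter fun z => ∀ i, i ≠ a → f (z i) = z (nx a i)).card :=
        sum_le_sum fun f _ => Pr_le W f
    _ = ∑ l ∈ range (Fintype.card V), ∑ a : Fin (l + 1), ∑ f ∈ Fpf V,
      ((Zs W l).filter fun z => ∀ i, i ≠ a → f (z i) = z (nx a i)).card := by
        rw [sum_comm]
        refine sum_congr rfl fun l _ => ?_
        rw [sum_comm]
    _ ≤ ∑ l ∈ range (Fintype.card V), ∑ a : Fin (l + 1),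
        (Zs W l).card * (Fintype.card V - 1) ^ (Fintype.card V - l) := by
        refine sum_le_sum fun l _ => sum_le_sum fun a _ => ?_
        calc _ = ∑ z ∈ Zs W l, ((Fpf V).filter fun f => ∀ i, i ≠ a → f (z i) = z (nx a i)).card := by
              simp_rw [card_filter]
              rw [sum_comm]
          _ ≤ ∑ z ∈ Zs W l, (Fintype.card V - 1) ^ (Fintype.card V - l) := by
              refine sum_le_sum fun z hz => card_path l a z ?_
              simp only [Zs, mem_filter] at hz
              exact hz.2.1
          _ = _ := by simp
    _ = _ := by simp

theorem sum_geo (θ : ℝ) (h0 : 0 ≤ θ) (h1 : θ < 1) (K : ℕ) :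
    ∑ k ∈ range K, ((k : ℝ) + 1) * θ ^ k ≤ 1 / (1 - θ) ^ 2 := by
  have e : (∑ k ∈ range K, ((k : ℝ) + 1) * θ ^ k) * (1 - θ) ^ 2
      = 1 - θ ^ K * (1 + K * (1 - θ)) := by
    induction K with
    | zero => simp
    | succ K ih => rw [sum_range_succ, add_mul, ih]; push_cast; ring
  have hp : 0 < (1 - θ) ^ 2 := by have : 0 < 1 - θ := by linarith
                                  positivity
  rw [le_div_iff₀ hp, e]
  have : 0 ≤ θ ^ K * (1 + K * (1 - θ)) := by
    have : 0 ≤ 1 - θ := by linarith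
    positivity
  linarith

theorem sum_pairs (h : ℕ → ℝ) (N : ℕ) :
    ∑ l ∈ range (2 * N), h l = ∑ k ∈ range N, (h (2 * k) + h (2 * k + 1)) := by
  induction N with
  | zero => simp
  | succ N ih => rw [Nat.mul_succ, sum_range_succ, sum_range_succ, ih, sum_range_succ, add_assoc]

theorem sum_Pr_real {V : Type*} [Fintype V] (W : Finset V) (hW : 4 * Fintype.card V ≤ W.card ^ 2)
    (hV : 2 ≤ Fintype.card V) :
    ((∑ f ∈ Fpf V, Pr W f : ℕ) : ℝ) ≤
      (Fpf V).card * (16 * (Fintype.card V : ℝ) ^ 5 / (W.card : ℝ) ^ 4) := by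
  have hwn : W.card ≤ Fintype.card V := card_le_univ W
  rw [card_Fpf]
  have hS := sum_Pr_le W
  have hB := card_Zs_bound W
  generalize hN : Fintype.card V = N at *
  generalize hw : W.card = w at *
  set m : ℝ := ((N - 1 : ℕ) : ℝ) with hm
  have hm' : m = N - 1 := by rw [hm]; push_cast [show 1 ≤ N by omega]; ring
  have hN2 : (2 : ℝ) ≤ N := by exact_mod_cast hV
  have hW' : 4 * (N : ℝ) ≤ (w : ℝ) ^ 2 := by exact_mod_cast hW
  have hwn' : (w : ℝ) ≤ N := by exact_mod_cast hwn
  have hm0 : 0 < m := by rw [hm']; linarith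
  have hw2 : (w : ℝ) ^ 2 ≤ (N : ℝ) ^ 2 := by gcongr
  set q : ℝ := (w : ℝ) ^ 2 / (N : ℝ) ^ 2 with hq
  have hqN : q * (N : ℝ) ^ 2 = (w : ℝ) ^ 2 := by rw [hq]; field_simp
  have hq0 : 0 < q := by
    rw [hq]; apply div_pos <;> nlinarith
  have hq1 : q ≤ 1 := by rw [hq, div_le_one (by positivity)]; exact hw2
  have hθ0 : 0 ≤ 1 - q / 2 := by linarith
  have hmain := hB (1 - q / 2) hθ0 (by
    rw [Nat.cast_sub (by gcongr)]
    push_cast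
    rw [hm']
    nlinarith)
  have hZ : ∀ l, ((Zs W l).card : ℝ) ≤ N * m ^ l * (1 - q / 2) ^ (l / 2) := by
    intro l
    rcases Nat.even_or_odd' l with ⟨k, rfl | rfl⟩
    · have := (hmain k).1
      rwa [show 2 * k / 2 = k by omega]
    · have := (hmain k).2
      rwa [show (2 * k + 1) / 2 = k by omega]
  calc ((∑ f ∈ Fpf V, Pr W f : ℕ) : ℝ)
      ≤ ((∑ l ∈ range N, (l + 1) * ((Zs W l).card * (N - 1) ^ (N - l)) : ℕ) : ℝ) := by
        exact_mod_cast hS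
    _ = ∑ l ∈ range N, ((l : ℝ) + 1) * ((Zs W l).card * m ^ (N - l)) := by
        push_cast; rfl
    _ ≤ ∑ l ∈ range N, (N * m ^ N) * (((l : ℝ) + 1) * (1 - q / 2) ^ (l / 2)) := by
        refine sum_le_sum fun l hl => ?_
        have hl' : l < N := mem_range.1 hl
        calc _ ≤ ((l : ℝ) + 1) * ((N * m ^ l * (1 - q / 2) ^ (l / 2)) * m ^ (N - l)) := by
              gcongr; exact hZ l
          _ = ((l : ℝ) + 1) * (N * (m ^ l * m ^ (N - l)) * (1 - q / 2) ^ (l / 2)) := by ring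
          _ = _ := by rw [← pow_add, Nat.add_sub_cancel' hl'.le]; ring
    _ = (N * m ^ N) * ∑ l ∈ range N, ((l : ℝ) + 1) * (1 - q / 2) ^ (l / 2) := by rw [mul_sum]
    _ ≤ (N * m ^ N) * ∑ l ∈ range (2 * N), ((l : ℝ) + 1) * (1 - q / 2) ^ (l / 2) := by
        gcongr
        omega
    _ ≤ (N * m ^ N) * (4 * (1 / (1 - (1 - q / 2)) ^ 2)) := by
        gcongr
        rw [sum_pairs]
        refine le_trans ?_ (mul_le_mul_of_nonneg_left
          (sum_geo (1 - q / 2) hθ0 (by linarith) N) (by norm_num))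
        rw [mul_sum]
        refine sum_le_sum fun k _ => ?_
        rw [show 2 * k / 2 = k by omega, show (2 * k + 1) / 2 = k by omega]
        have : 0 ≤ (1 - q / 2) ^ k := by positivity
        push_cast
        nlinarith
    _ = _ := by
        have hw0 : (w : ℝ) ≠ 0 := by
          intro h; rw [h] at hW'; nlinarith
        push_cast
        rw [← hm, hq]
        field_simp
        ring

/-- some class is large -/
def Bad {V : Type*} [Fintype V] (W : Finset V) (M : ℝ) (f : V → V) : Prop :=
  ∃ u, M < ((univ.filter fun v => Rl W f u v).card : ℝ)

theorem Bad.le {V : Type*} [Fintype V] {W : Finset V} {M : ℝ} {f : V → V} (hM : 0 ≤ M)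
    (h : Bad W M f) : M ^ 2 ≤ (Pr W f : ℝ) := by
  obtain ⟨u, hu⟩ := h
  have : ((univ.filter fun v => Rl W f u v) ×ˢ (univ.filter fun v => Rl W f u v)).card ≤ Pr W f := by
    apply card_le_card
    rintro ⟨x, y⟩ h
    simp only [mem_product, mem_filter, mem_univ, true_and] at h ⊢
    exact h.1.symm.trans h.2
  rw [card_product] at this
  have h2 : (((univ.filter fun v => Rl W f u v).card : ℝ)) *
     ((univ.filter fun v => Rl W f u v).card : ℝ) ≤ Pr W f := by exact_mod_cast this
  nlinarith

theorem card_Bad {V : Type*} [Fintype V] (W : Finset V) (hW : 4 * Fintype.card V ≤ W.card ^ 2)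
    (hV : 2 ≤ Fintype.card V) (M : ℝ) (hM : 0 ≤ M) :
    (((Fpf V).filter fun f => Bad W M f).card : ℝ) * M ^ 2 ≤
      (Fpf V).card * (16 * (Fintype.card V : ℝ) ^ 5 / (W.card : ℝ) ^ 4) := by
  refine le_trans ?_ (sum_Pr_real W hW hV)
  rw [← nsmul_eq_mul, ← sum_const]
  push_cast
  calc _ ≤ ∑ f ∈ (Fpf V).filter fun f => Bad W M f, (Pr W f : ℝ) :=
        sum_le_sum fun f hf => Bad.le hM (mem_filter.1 hf).2
    _ ≤ _ := sum_le_sum_of_subset_of_nonneg (filter_subset _ _) (by intros; positivity)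

/-- sets with few boundary points -/
def GG {V : Type*} (f : V → V) (S : Finset V) : Prop :=
  ∃ x ∈ Function.periodicPts f, ∃ a, (∀ u ∈ S, f u ∈ S ∨ f u = a ∨ f u = x) ∧
    (∀ u, u ∉ S → f u ∈ S → u = x)

theorem exists_periodic {V : Type*} [Fintype V] (f : V → V) (u : V) :
    ∃ k, f^[k] u ∈ Function.periodicPts f := by
  obtain ⟨i, j, hij, h⟩ := Finite.exists_ne_map_eq_of_infinite (fun k : ℕ => f^[k] u)
  wlog hlt : i < j generalizing i j
  · exact this j i hij.symm h.symm (by omega)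
  refine ⟨i, Function.mk_mem_periodicPts (n := j - i) (by omega) ?_⟩
  simp only [Function.IsPeriodicPt, Function.IsFixedPt]
  rw [← Function.iterate_add_apply, Nat.sub_add_cancel hlt.le]
  exact h.symm

theorem exists_GG {V : Type*} [Fintype V] (f : V → V) (s : ℕ) (h1 : 1 ≤ s)
    (hs : s ≤ Fintype.card V) : ∃ S, GG f S ∧ s ≤ S.card ∧ S.card ≤ 2 * s := by
  have hne : ((univ : Finset (Finset V)).filter fun S => GG f S ∧ s ≤ S.card).Nonempty := by
    refine ⟨univ, ?_⟩
    have hpos : 0 < Fintype.card V := by omega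
    obtain ⟨v⟩ := Fintype.card_pos_iff.1 hpos
    obtain ⟨k, hk⟩ := exists_periodic f v
    simp only [mem_filter, mem_univ, true_and, card_univ]
    exact ⟨⟨_, hk, v, by simp, by simp⟩, hs⟩
  obtain ⟨S, hS, hmin⟩ := exists_min_image _ (fun S => S.card) hne
  simp only [mem_filter, mem_univ, true_and] at hS hmin
  obtain ⟨hG, hsS⟩ := hS
  refine ⟨S, hG, hsS, ?_⟩
  by_contra hbig
  push Not at hbig
  have hsmall : ∀ T : Finset V, GG f T → T.card < S.card → T.card < s := by
    intro T hT hlt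
    by_contra h
    have := hmin T ⟨hT, by omega⟩
    omega
  -- splitting and removal principles
  have hsplit : ∀ T ⊆ S, T.Nonempty → GG f T → GG f (S \ T) → T = S := by
    intro T hTS hTn h2 h3
    by_contra hne
    have hlt : T.card < S.card := card_lt_card (hTS.ssubset_of_ne hne)
    have e := card_sdiff_add_card_eq_card hTS
    have := hTn.card_pos
    have a1 := hsmall T h2 hlt
    have a2 := hsmall _ h3 (by omega)
    omega
  have hrem : ∀ x ∈ S, ¬ GG f (S.erase x) := by
    intro x hx h
    have e := card_erase_add_one hx
    have := hsmall _ h (by omega)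
    omega
  obtain ⟨x, hx, a, hout, hin⟩ := hG
  by_cases hex : ∃ y ∈ S, f y ∉ S
  · obtain ⟨y, hyS, hfy⟩ := hex
    set T := S.filter fun u => ∃ k, f^[k] u = y ∧ ∀ j ≤ k, f^[j] u ∈ S with hT
    have hyT : y ∈ T := by
      rw [hT, mem_filter]
      exact ⟨hyS, 0, rfl, by intro j hj; obtain rfl : j = 0 := by omega
                             simpa using hyS⟩
    have hback : ∀ u ∈ S, f u ∈ T → u ∈ T := by
      intro u hu hfu
      rw [hT, mem_filter] at hfu ⊢
      obtain ⟨_, k, hk, hj⟩ := hfu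
      refine ⟨hu, k + 1, by simpa using hk, ?_⟩
      intro j hjk
      rcases j with _ | j
      · simpa using hu
      · simpa using hj j (by omega)
    have hfwd : ∀ u ∈ T, u ≠ y → f u ∈ T := by
      intro u hu huy
      rw [hT, mem_filter] at hu ⊢
      obtain ⟨_, k, hk, hj⟩ := hu
      rcases k with _ | k
      · exact absurd hk huy
      · refine ⟨by simpa using hj 1 (by omega), k, by simpa using hk, ?_⟩
        intro j hjk
        simpa using hj (j + 1) (by omega)
    have hTS : T ⊆ S := filter_subset _ _
    have e := hsplit T hTS ⟨y, hyT⟩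
      ⟨x, hx, a, by
        intro u hu
        by_cases huy : u = y
        · subst huy; right; exact (hout u hyS).resolve_left hfy
        · exact Or.inl (hfwd u hu huy), by
        intro u hu hfu
        by_cases huS : u ∈ S
        · exact absurd (hback u huS hfu) hu
        · exact hin u huS (hTS hfu)⟩
      ⟨x, hx, a, by
        intro u hu
        rw [mem_sdiff] at hu
        rcases hout u hu.1 with h | h
        · left; rw [mem_sdiff]; exact ⟨h, fun h' => hu.2 (hback u hu.1 h')⟩
        · exact Or.inr h, by
        intro u hu hfu
        rw [mem_sdiff] at hu hfu
        by_cases huS : u ∈ S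
        · have huT : u ∈ T := by by_contra h; exact hu ⟨huS, h⟩
          by_cases huy : u = y
          · subst huy; exact absurd hfu.1 hfy
          · exact absurd (hfwd u huT huy) hfu.2
        · exact hin u huS hfu.1⟩
    refine hrem y hyS ⟨x, hx, y, ?_, ?_⟩
    · intro u hu
      rw [mem_erase] at hu
      have := hfwd u (e ▸ hu.2) hu.1
      by_cases h : f u = y
      · exact Or.inr (Or.inl h)
      · left; rw [mem_erase]; exact ⟨h, hTS this⟩
    · intro u hu hfu
      rw [mem_erase] at hu hfu
      by_cases huS : u ∈ S
      · have : u = y := by by_contra h; exact hu ⟨h, huS⟩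
        subst this; exact absurd hfu.2 hfy
      · exact hin u huS hfu.2
  · push Not at hex
    have hit : ∀ k, ∀ u ∈ S, f^[k] u ∈ S := by
      intro k
      induction k with
      | zero => intro u hu; simpa using hu
      | succ k ih => intro u hu; simpa using ih _ (hex u hu)
    have hin' : ∀ u, f u ∈ S → u ∈ S := by
      intro u hfu
      by_contra huS
      have hux := hin u huS hfu
      subst hux
      obtain ⟨k, hk, hp⟩ := hx
      obtain ⟨k, rfl⟩ : ∃ k', k = k' + 1 := ⟨k - 1, by omega⟩
      have := hit k _ hfu
      rw [← Function.iterate_succ_apply, hp.eq] at this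
      exact huS this
    obtain ⟨v, hv⟩ : S.Nonempty := card_pos.1 (by omega)
    obtain ⟨k, hk⟩ := exists_periodic f v
    have hyS := hit k v hv
    generalize f^[k] v = y at hk hyS
    set T := S.filter fun u => ∃ k, f^[k] u = y with hT
    have hTS : T ⊆ S := filter_subset _ _
    have hyT : y ∈ T := by rw [hT, mem_filter]; exact ⟨hyS, 0, rfl⟩
    have hback : ∀ u, f u ∈ T → u ∈ T := by
      intro u hfu
      rw [hT, mem_filter] at hfu ⊢
      obtain ⟨h, k, hk⟩ := hfu
      exact ⟨hin' u h, k + 1, by simpa using hk⟩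
    have hfwd : ∀ u ∈ T, f u ∈ T := by
      intro u hu
      rw [hT, mem_filter] at hu ⊢
      obtain ⟨h, k, hk'⟩ := hu
      refine ⟨hex u h, ?_⟩
      rcases k with _ | k
      · obtain ⟨p, hp, hpp⟩ := hk
        obtain ⟨p, rfl⟩ : ∃ k', p = k' + 1 := ⟨p - 1, by omega⟩
        refine ⟨p, ?_⟩
        rw [← Function.iterate_succ_apply]
        have : u = y := by simpa using hk'
        rw [this]; exact hpp.eq
      · exact ⟨k, by simpa using hk'⟩
    have e := hsplit T hTS ⟨y, hyT⟩
      ⟨y, hk, y, fun u hu => Or.inl (hfwd u hu), fun u hu hfu => absurd (hback u hfu) hu⟩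
      ⟨y, hk, y, by
        intro u hu
        rw [mem_sdiff] at hu
        left; rw [mem_sdiff]; exact ⟨hex u hu.1, fun h => hu.2 (hback u h)⟩, by
        intro u hu hfu
        rw [mem_sdiff] at hu hfu
        exact absurd ⟨hin' u hfu.1, fun h => hfu.2 (hfwd u h)⟩ hu⟩
    refine hrem y hyS ⟨y, hk, y, ?_, ?_⟩
    · intro u hu
      rw [mem_erase] at hu
      by_cases h : f u = y
      · exact Or.inr (Or.inl h)
      · left; rw [mem_erase]; exact ⟨h, hex u hu.2⟩
    · intro u hu hfu
      rw [mem_erase] at hu hfu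
      by_contra h
      exact hu ⟨h, hin' u hfu.2⟩

theorem coloring {r n : ℕ} (t : Fin r → Fin r) (f : Fin r → Fin n → Fin n)
    (S : Fin r → Finset (Fin n)) (B M : ℝ) (hM : 0 ≤ M) (hG : ∀ i, GG (f i) (S i))
    (hB : ∀ i, ((S i).card : ℝ) ≤ B) (hbad : ∀ i, ¬ Bad (S (t i)) M (f i)) :
    ∃ c : Fin r × Fin n → Fin r, ∀ (j : Fin r) (v : Fin n),
      ((((SimpleGraph.fromRel
        (fun u w => ∃ i : Fin r, f i u = w ∧ c (i, u) = j)).connectedComponentMk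
          v).supp.ncard : ℝ)) ≤ B + 2 * M := by
  refine ⟨fun p => if p.2 ∈ S (t p.1) ∧ f p.1 p.2 ∈ S (t p.1) then t p.1 else p.1, ?_⟩
  intro j v
  set G := SimpleGraph.fromRel (fun u w => ∃ i : Fin r, f i u = w ∧
    (if u ∈ S (t i) ∧ f i u ∈ S (t i) then t i else i) = j) with hGdef
  let C : Fin n → Finset (Fin n) := fun u => univ.filter fun v => Rl (S (t j)) (f j) u v
  have hC : ∀ u, ((C u).card : ℝ) ≤ M := by
    intro u
    have := hbad j
    unfold Bad at this
    push Not at this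
    exact this u
  have hedge : ∀ x y, (∃ i : Fin r, f i x = y ∧
      (if x ∈ S (t i) ∧ f i x ∈ S (t i) then t i else i) = j) →
      (x ∈ S j ∧ y ∈ S j) ∨ (f j x = y ∧ Rl (S (t j)) (f j) x y) := by
    rintro x y ⟨i, rfl, hi⟩
    split_ifs at hi with h
    · subst hi; exact Or.inl h
    · subst hi; exact Or.inr ⟨rfl, Rl.step h⟩
  have hadj : ∀ x y, G.Adj x y → (x ∈ S j ∧ y ∈ S j) ∨
      ((f j x = y ∨ f j y = x) ∧ Rl (S (t j)) (f j) x y) := by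
    intro x y h
    rw [hGdef, SimpleGraph.fromRel_adj] at h
    rcases h.2 with h | h
    · rcases hedge _ _ h with h | h
      · exact Or.inl h
      · exact Or.inr ⟨Or.inl h.1, h.2⟩
    · rcases hedge _ _ h with h | h
      · exact Or.inl h.symm
      · exact Or.inr ⟨Or.inr h.1, h.2.symm⟩
  obtain ⟨x0, -, a, hout, hin⟩ := hG j
  let T : Finset (Fin n) := S j ∪ (C a ∪ C x0)
  have hself : ∀ u, u ∈ C u := fun u => by simp only [C, mem_filter, mem_univ, true_and]; exact Rl.refl _ _ _
  have hCstep : ∀ u x y, Rl (S (t j)) (f j) x y → x ∈ C u → y ∈ C u := by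
    intro u x y h hx
    simp only [C, mem_filter, mem_univ, true_and] at hx ⊢
    exact hx.trans h
  have hT : ∀ x y, G.Adj x y → x ∈ T → y ∈ T := by
    intro x y hxy hx
    simp only [T, mem_union] at hx ⊢
    rcases hadj x y hxy with h | ⟨h1, h2⟩
    · exact Or.inl h.2
    · rcases hx with hx | hx | hx
      · by_cases hy : y ∈ S j
        · exact Or.inl hy
        · rcases h1 with h1 | h1
          · have := hout x hx
            rw [h1] at this
            rcases this with h | rfl | rfl
            · exact Or.inl h
            · exact Or.inr (Or.inl (hself _))
            · exact Or.inr (Or.inr (hself _))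
          · have := hin y hy (h1 ▸ hx)
            subst this
            exact Or.inr (Or.inr (hself _))
      · exact Or.inr (Or.inl (hCstep _ _ _ h2 hx))
      · exact Or.inr (Or.inr (hCstep _ _ _ h2 hx))
  have hTcard : (T.card : ℝ) ≤ B + 2 * M := by
    have h1 : T.card ≤ (S j).card + ((C a).card + (C x0).card) :=
      (card_union_le _ _).trans (Nat.add_le_add_left (card_union_le _ _) _)
    have h2 : (T.card : ℝ) ≤ (S j).card + ((C a).card + (C x0).card) := by exact_mod_cast h1
    linarith [hB j, hC a, hC x0]
  have hreach : ∀ y, G.Reachable v y → (v ∈ T → y ∈ T) ∧ (v ∉ T → y ∈ C v ∧ y ∉ T) := by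
    intro y hy
    rw [SimpleGraph.reachable_iff_reflTransGen] at hy
    induction hy with
    | refl => exact ⟨id, fun h => ⟨hself _, h⟩⟩
    | tail _ hbc ih =>
      refine ⟨fun h => hT _ _ hbc (ih.1 h), fun h => ?_⟩
      obtain ⟨i1, i2⟩ := ih.2 h
      refine ⟨?_, fun h' => i2 (hT _ _ hbc.symm h')⟩
      rcases hadj _ _ hbc with h | ⟨_, h2⟩
      · exact absurd (by simp only [T, mem_union]; exact Or.inl h.1) i2
      · exact hCstep _ _ _ h2 i1
  have hsupp : ∀ y ∈ (G.connectedComponentMk v).supp, G.Reachable v y := by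
    intro y hy
    rw [SimpleGraph.ConnectedComponent.mem_supp_iff, SimpleGraph.ConnectedComponent.eq] at hy
    exact hy.symm
  have hBn : 0 ≤ B := le_trans (Nat.cast_nonneg _) (hB j)
  by_cases hv : v ∈ T
  · refine le_trans ?_ hTcard
    have : (G.connectedComponentMk v).supp.ncard ≤ (T : Set (Fin n)).ncard :=
      Set.ncard_le_ncard (fun y hy => (hreach y (hsupp y hy)).1 hv) (Finset.finite_toSet _)
    rw [Set.ncard_coe_finset] at this
    exact_mod_cast this
  · have : (G.connectedComponentMk v).supp.ncard ≤ (C v : Set (Fin n)).ncard :=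
      Set.ncard_le_ncard (fun y hy => ((hreach y (hsupp y hy)).2 hv).1) (Finset.finite_toSet _)
    rw [Set.ncard_coe_finset] at this
    have h2 : ((G.connectedComponentMk v).supp.ncard : ℝ) ≤ (C v).card := by exact_mod_cast this
    linarith [hC v]

theorem fiber_bound {r : ℕ} {X : Type*} (A : Finset X) (i k : Fin r) (hik : k ≠ i)
    (bad : X → X → Prop) (β : ℕ) (hβ : ∀ x, (A.filter fun g => bad x g).card ≤ β) :
    ((Fintype.piFinset fun _ : Fin r => A).filter fun f => bad (f k) (f i)).card
      ≤ β * A.card ^ (r - 1) := by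
  rcases A.eq_empty_or_nonempty with rfl | ⟨c, hc⟩
  · rw [show (Fintype.piFinset fun _ : Fin r => (∅ : Finset X)) = ∅ from ?_]
    · simp
    · rw [Fintype.piFinset_eq_empty]
      exact ⟨i, rfl⟩
  set Q := (Fintype.piFinset fun _ : Fin r => A).filter fun f => bad (f k) (f i)
  have h1 := card_le_mul_card_image (f := fun f : Fin r → X => Function.update f i c) Q β (by
    intro h hh
    refine le_trans ?_ (hβ (h k))
    apply card_le_card_of_injOn (fun f => f i)
    · intro f hf
      simp only [Q, mem_coe, mem_filter, Fintype.mem_piFinset] at hf ⊢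
      refine ⟨hf.1.1 i, ?_⟩
      rw [← hf.2, Function.update_of_ne hik]
      exact hf.1.2
    · intro f hf g hg hfg
      simp only [mem_coe, mem_filter] at hf hg
      have e : Function.update f i c = Function.update g i c := hf.2.trans hg.2.symm
      funext j
      by_cases hj : j = i
      · subst hj; exact hfg
      · have := congrFun e j
        rwa [Function.update_of_ne hj, Function.update_of_ne hj] at this)
  refine h1.trans (Nat.mul_le_mul_left _ ?_)
  calc _ ≤ (Fintype.piFinset fun j : Fin r => if j = i then {c} else A).card := by
        apply card_le_card
        intro h hh
        rw [mem_image] at hh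
        obtain ⟨f, hf, rfl⟩ := hh
        simp only [Q, mem_filter, Fintype.mem_piFinset] at hf ⊢
        intro j
        by_cases hj : j = i
        · subst hj; simp
        · simpa [hj] using hf.1 j
    _ = _ := by
        rw [Fintype.card_piFinset]
        have : ∀ j, (if j = i then ({c} : Finset X) else A).card = if j = i then 1 else A.card := by
          intro j; split_ifs <;> simp
        simp_rw [this]
        rw [prod_ite]
        simp only [prod_const_one, prod_const, one_mul]
        congr 1
        rw [filter_not, filter_eq', if_pos (mem_univ _), card_sdiff_of_subset (subset_univ _)]
        simp

theorem main_aux (r : ℕ) (hr : 2 ≤ r) (n : ℕ) (hn : 16 ≤ n) :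
    (1 - 16 * (r : ℝ) * (n : ℝ) ^ (-(0.4 : ℝ))) * (Nat.card {f : Fin r → Fin n → Fin n //
                ∀ (i : Fin r) (v : Fin n), f i v ≠ v} : ℝ) ≤
        (Nat.card {f : Fin r → Fin n → Fin n //
            (∀ (i : Fin r) (v : Fin n), f i v ≠ v) ∧
            ∃ c : Fin r × Fin n → Fin r, ∀ (j : Fin r) (v : Fin n),
              ((((SimpleGraph.fromRel
                  (fun u w => ∃ i : Fin r, f i u = w ∧ c (i, u) = j)).connectedComponentMk
                    v).supp.ncard : ℝ))
                ≤ 6 * (n : ℝ) ^ (0.9 : ℝ)} : ℝ) := by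
  have hn0 : (0 : ℝ) < n := by exact_mod_cast (show 0 < n by omega)
  have hn1 : (1 : ℝ) ≤ n := by exact_mod_cast (show 1 ≤ n by omega)
  set M : ℝ := (n : ℝ) ^ (0.9 : ℝ) with hM
  have hM1 : 1 ≤ M := Real.one_le_rpow hn1 (by norm_num)
  set s := ⌈M⌉₊ with hs
  have hMs : M ≤ s := Nat.le_ceil _
  have hs2 : (s : ℝ) ≤ 2 * M := by
    have := Nat.ceil_lt_add_one (show 0 ≤ M by linarith)
    linarith
  have hs1 : 1 ≤ s := by
    have : (1 : ℝ) ≤ s := by linarith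
    exact_mod_cast this
  have hsn : s ≤ n := by
    rw [hs, Nat.ceil_le]
    calc M ≤ (n : ℝ) ^ (1 : ℝ) := Real.rpow_le_rpow_of_exponent_le hn1 (by norm_num)
      _ = n := Real.rpow_one _
  have hM2 : 4 * (n : ℝ) ≤ M ^ 2 := by
    have e : M ^ 2 = n * (n : ℝ) ^ (0.8 : ℝ) := by
      rw [hM, ← Real.rpow_natCast, ← Real.rpow_mul hn0.le]
      nth_rewrite 2 [← Real.rpow_one (n : ℝ)]
      rw [← Real.rpow_add hn0]; norm_num
    have h4 : (4 : ℝ) ≤ (n : ℝ) ^ (0.8 : ℝ) := by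
      calc (4 : ℝ) = (16 : ℝ) ^ (0.5 : ℝ) := by
            rw [show (16 : ℝ) = 4 ^ (2 : ℝ) by norm_num, ← Real.rpow_mul (by norm_num)]; norm_num
        _ ≤ (n : ℝ) ^ (0.5 : ℝ) := by
            apply Real.rpow_le_rpow (by norm_num) _ (by norm_num)
            exact_mod_cast hn
        _ ≤ _ := Real.rpow_le_rpow_of_exponent_le hn1 (by norm_num)
    rw [e]; nlinarith
  choose S hG hSl hSu using fun f : Fin n → Fin n => exists_GG f s hs1 (by simpa using hsn)
  set A := Fpf (Fin n) with hA
  set ε : ℝ := 16 * (n : ℝ) ^ (-(0.4 : ℝ)) with hε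
  have hbadβ : ∀ x : Fin n → Fin n, ((A.filter fun g => Bad (S x) M g).card : ℝ) ≤ ε * A.card := by
    intro x
    have hw : M ≤ (S x).card := hMs.trans (by exact_mod_cast hSl x)
    have h := card_Bad (S x) (by
      have : 4 * (n : ℝ) ≤ ((S x).card : ℝ) ^ 2 := hM2.trans (by gcongr)
      rw [Fintype.card_fin]
      exact_mod_cast this) (by rw [Fintype.card_fin]; omega) M (by linarith)
    rw [Fintype.card_fin] at h
    have h2 : 16 * (n : ℝ) ^ 5 / ((S x).card : ℝ) ^ 4 ≤ 16 * (n : ℝ) ^ 5 / M ^ 4 := by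
      gcongr
    have e : 16 * (n : ℝ) ^ 5 / M ^ 4 = ε * M ^ 2 := by
      rw [div_eq_iff (by positivity), hε, mul_assoc, ← pow_add, hM, mul_assoc]
      congr 1
      rw [← Real.rpow_natCast, ← Real.rpow_natCast, ← Real.rpow_mul hn0.le, ← Real.rpow_add hn0]
      norm_num
    have h3 : ((A.filter fun g => Bad (S x) M g).card : ℝ) * M ^ 2 ≤ (ε * A.card) * M ^ 2 := by
      calc _ ≤ _ := h
        _ ≤ A.card * (ε * M ^ 2) := by rw [← e]; gcongr
        _ = _ := by ring
    exact le_of_mul_le_mul_right h3 (by positivity)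
  have hε0 : 0 ≤ ε := by positivity
  set β := ⌊ε * A.card⌋₊ with hβ
  have hβ' : ∀ x : Fin n → Fin n, (A.filter fun g => Bad (S x) M g).card ≤ β := by
    intro x; rw [hβ]; exact Nat.le_floor (hbadβ x)
  let i0 : Fin r := ⟨0, by omega⟩
  let i1 : Fin r := ⟨1, by omega⟩
  let t : Fin r → Fin r := fun i => if i = i0 then i1 else i0
  have ht : ∀ i, t i ≠ i := by
    intro i
    simp only [t]
    split_ifs with h
    · rw [h]; simp [i0, i1]
    · exact fun h' => h h'.symm
  set Tot := Fintype.piFinset fun _ : Fin r => A with hTot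
  let Q : Fin r → Finset (Fin r → Fin n → Fin n) := fun i =>
    Tot.filter fun f => Bad (S (f (t i))) M (f i)
  have hQ : ∀ i, ((Q i).card : ℝ) ≤ ε * Tot.card := by
    intro i
    have h := fiber_bound A i (t i) (ht i) (fun x g => Bad (S x) M g) β hβ'
    have h2 : ((Q i).card : ℝ) ≤ β * (A.card : ℝ) ^ (r - 1) := by exact_mod_cast h
    have h3 : (Tot.card : ℝ) = A.card * (A.card : ℝ) ^ (r - 1) := by
      rw [hTot, Fintype.card_piFinset, prod_const, card_univ, Fintype.card_fin, ← pow_succ',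
        Nat.sub_add_cancel (by omega)]
      push_cast; rfl
    calc _ ≤ _ := h2
      _ ≤ (ε * A.card) * (A.card : ℝ) ^ (r - 1) := by
          gcongr; exact Nat.floor_le (by positivity)
      _ = _ := by rw [h3]; ring
  have hU : ((univ.biUnion Q).card : ℝ) ≤ r * (ε * Tot.card) := by
    calc ((univ.biUnion Q).card : ℝ) ≤ ((∑ i, (Q i).card : ℕ) : ℝ) := by
          exact_mod_cast card_biUnion_le
      _ = ∑ i, ((Q i).card : ℝ) := by push_cast; rfl
      _ ≤ ∑ i : Fin r, ε * Tot.card := sum_le_sum fun i _ => hQ i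
      _ = _ := by simp
  have hcT : (Nat.card {f : Fin r → Fin n → Fin n //
                ∀ (i : Fin r) (v : Fin n), f i v ≠ v} : ℝ) = Tot.card := by
    rw [Nat.card_eq_fintype_card, Fintype.card_subtype]
    congr 2
    ext f
    simp [hTot, Fintype.mem_piFinset, hA, mem_Fpf]
  have hcG : (Tot \ univ.biUnion Q).card ≤ Nat.card {f : Fin r → Fin n → Fin n //
            (∀ (i : Fin r) (v : Fin n), f i v ≠ v) ∧
            ∃ c : Fin r × Fin n → Fin r, ∀ (j : Fin r) (v : Fin n),
              ((((SimpleGraph.fromRel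
                  (fun u w => ∃ i : Fin r, f i u = w ∧ c (i, u) = j)).connectedComponentMk
                    v).supp.ncard : ℝ))
                ≤ 6 * M} := by
    rw [Nat.card_eq_fintype_card, Fintype.card_subtype]
    apply card_le_card
    intro f hf
    simp only [mem_sdiff, mem_biUnion, mem_univ, true_and, not_exists, Q, mem_filter, not_and] at hf
    obtain ⟨hf1, hf2⟩ := hf
    simp only [mem_filter, mem_univ, true_and]
    refine ⟨?_, ?_⟩
    · intro i
      have := Fintype.mem_piFinset.1 hf1 i
      exact (mem_Fpf _).1 this
    · obtain ⟨c, hc⟩ := coloring t f (fun i => S (f i)) (4 * M) M (by linarith)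
        (fun i => hG (f i)) (fun i => by
          have : ((S (f i)).card : ℝ) ≤ 2 * s := by exact_mod_cast hSu (f i)
          linarith) (fun i => hf2 i hf1)
      refine ⟨c, fun j v => (hc j v).trans (by linarith)⟩
  rw [hcT]
  have h5 : Tot.card ≤ (Tot \ univ.biUnion Q).card + (univ.biUnion Q).card := by
    have := card_le_card_sdiff_add_card (s := Tot) (t := univ.biUnion Q)
    omega
  have h6 : (Tot.card : ℝ) ≤ (Tot \ univ.biUnion Q).card + (univ.biUnion Q).card := by
    exact_mod_cast h5
  have h7 : ((Tot \ univ.biUnion Q).card : ℝ) ≤ _ := Nat.cast_le.2 hcG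
  refine le_trans ?_ h7
  have h8 : 16 * (r : ℝ) * (n : ℝ) ^ (-(0.4 : ℝ)) = r * ε := by rw [hε]; ring
  rw [h8]
  nlinarith

end Aux6

/-- Fix an integer `r ≥ 2`. There is a constant `K > 0` such that the following
holds with high probability as `n → ∞`.  Let `f₁, …, f_r : [n] → [n]` be independent uniformly
random functions with no fixed point.  Then there is a coloring `c : Fin r × Fin n → Fin r`
(where `c (i, v)` colors the edge `{v, f_i v}`) such that for every color `j`, every connected
component of the graph on `[n]` whose edges are the pairs `{v, f_i v}` with `c (i, v) = j` has
at most `K · n^0.9` vertices.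

The uniform model is expressed by counting tuples `f : Fin r → (Fin n → Fin n)` of
fixed-point-free functions: for every `p < 1`, eventually the number of good tuples is at
least `p` times the total number of tuples. -/
theorem stmt_6 (r : ℕ) (hr : 2 ≤ r) :
    ∃ K : ℝ, 0 < K ∧
      ∀ p : ℝ, p < 1 → ∃ N : ℕ, ∀ n : ℕ, N ≤ n →
        p * (Nat.card {f : Fin r → Fin n → Fin n //
                ∀ (i : Fin r) (v : Fin n), f i v ≠ v} : ℝ) ≤
        (Nat.card {f : Fin r → Fin n → Fin n //
            (∀ (i : Fin r) (v : Fin n), f i v ≠ v) ∧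
            ∃ c : Fin r × Fin n → Fin r, ∀ (j : Fin r) (v : Fin n),
              ((((SimpleGraph.fromRel
                  (fun u w => ∃ i : Fin r, f i u = w ∧ c (i, u) = j)).connectedComponentMk
                    v).supp.ncard : ℝ))
                ≤ K * (n : ℝ) ^ (0.9 : ℝ)} : ℝ) := by
  refine ⟨6, by norm_num, fun p hp => ?_⟩
  have hlim : Filter.Tendsto (fun n : ℕ => 16 * (r : ℝ) * (n : ℝ) ^ (-(0.4 : ℝ))) Filter.atTop
      (nhds (16 * (r : ℝ) * 0)) :=
    ((tendsto_rpow_neg_atTop (by norm_num)).comp tendsto_natCast_atTop_atTop).const_mul _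
  rw [mul_zero] at hlim
  obtain ⟨N, hN⟩ := Filter.eventually_atTop.1
    (hlim.eventually (gt_mem_nhds (show (0 : ℝ) < 1 - p by linarith)))
  refine ⟨max N 16, fun n hn => ?_⟩
  have h1 := hN n (le_trans (le_max_left _ _) hn)
  refine le_trans ?_ (main_aux r hr n (le_trans (le_max_right _ _) hn))
  gcongr
  linarith
end

section
/- For each n let V_1,…,V_m be any partition of [n] in which every part has size at least 0.9·n^{0.9}, and let f : [n] → [n] be a uniformly random function with f(v) ≠ v for all v. Then with high probability as n → ∞, for every vertex v ∈ [n] there exists an integer t with 1 ≤ t ≤ n^{0.15} such that either f^{t}(v) lies in the same part V_j as f^{t−1}(v), or f^{t}(v) = f^{s}(v) for some 0 ≤ s < t. In other words, w.h.p. no vertex starts a path of length greater than n^{0.15} in the functional digraph of f all of whose arcs cross between distinct parts. -/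
open Classical in
noncomputable def badSet {n : ℕ} (P : Fin n → ℕ) (v : Fin n) (t : ℕ) : Finset (Fin n → Fin n) :=
  Finset.univ.filter (fun f => (∀ u, f u ≠ u) ∧
    ∀ i, 1 ≤ i → i ≤ t → P (f^[i] v) ≠ P (f^[i-1] v) ∧ ∀ s, s < i → f^[i] v ≠ f^[s] v)

theorem iter_update {n : ℕ} (f : Fin n → Fin n) (v w y : Fin n) (t : ℕ)
    (h : ∀ i, i < t → f^[i] v ≠ w) :
    ∀ i, i ≤ t → (Function.update f w y)^[i] v = f^[i] v := by
  intro i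
  induction i with
  | zero => intro _; rfl
  | succ k ih =>
    intro hk
    rw [Function.iterate_succ_apply', Function.iterate_succ_apply', ih (by omega),
      Function.update_of_ne (h k (by omega))]

theorem bad_step {n : ℕ} (P : Fin n → ℕ) (v : Fin n) (t : ℕ) (c : ℝ)
    (hc : ∀ v : Fin n, c ≤ (({u : Fin n | P u = P v}).ncard : ℝ)) :
    ((badSet P v (t+1)).card : ℝ) * ((n:ℝ) - 1) ≤ (badSet P v t).card * ((n:ℝ) - c) := by
  classical
  have hn : 1 ≤ n := by have := v.2; omega
  set A := (badSet P v (t+1)).sigma (fun f => Finset.univ.erase (f^[t] v)) with hA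
  set B := (badSet P v t).sigma
    (fun g => Finset.univ.filter (fun x => ¬ P x = P (g^[t] v))) with hB
  have hAc : (A.card : ℝ) = ((badSet P v (t+1)).card : ℝ) * ((n:ℝ) - 1) := by
    rw [hA, Finset.card_sigma]
    simp [Finset.card_erase_of_mem, Nat.cast_sub hn]
  have hBc : (B.card : ℝ) ≤ (badSet P v t).card * ((n:ℝ) - c) := by
    rw [hB, Finset.card_sigma]
    push_cast
    rw [← nsmul_eq_mul]
    apply Finset.sum_le_card_nsmul
    intro g _
    have h1 := hc (g^[t] v)
    have h2 := Finset.card_filter_add_card_filter_not (s := (Finset.univ : Finset (Fin n)))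
      (fun x => P x = P (g^[t] v))
    have h3 : ({u : Fin n | P u = P (g^[t] v)}).ncard =
        (Finset.univ.filter (fun x => P x = P (g^[t] v))).card := by
      rw [← Set.ncard_coe_finset]; congr 1; ext; simp
    rw [h3] at h1
    have h4 : ((Finset.univ.filter (fun x => P x = P (g^[t] v))).card : ℝ) +
      (Finset.univ.filter (fun x => ¬ P x = P (g^[t] v))).card = n := by
      rw [Finset.card_univ, Fintype.card_fin] at h2
      exact_mod_cast h2
    linarith
  have key : ∀ f ∈ badSet P v (t+1), ∀ i, i < t → f^[i] v ≠ f^[t] v := by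
    intro f hf i hi
    simp only [badSet, Finset.mem_filter] at hf
    exact ((hf.2.2 t (by omega) (by omega)).2 i hi).symm
  have hle : A.card ≤ B.card := by
    apply Finset.card_le_card_of_injOn
      (fun z => ⟨Function.update z.1 (z.1^[t] v) z.2, z.1 (z.1^[t] v)⟩)
    · rintro ⟨f, y⟩ hz
      simp only [hA, Finset.coe_sigma, Set.mem_sigma_iff, Finset.mem_coe, Finset.mem_erase] at hz
      obtain ⟨hf, hy, -⟩ := hz
      have hit := iter_update f v (f^[t] v) y t (key f hf)
      simp only [badSet, Finset.mem_filter] at hf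
      simp only [hB, Finset.coe_sigma, Set.mem_sigma_iff, Finset.mem_coe, badSet,
        Finset.mem_filter, Finset.mem_univ, true_and]
      refine ⟨⟨?_, ?_⟩, ?_⟩
      · intro u
        by_cases hu : u = f^[t] v
        · subst hu; simpa using hy
        · rw [Function.update_of_ne hu]; exact hf.2.1 u
      · intro i h1 h2
        rw [hit i h2, hit (i-1) (by omega)]
        refine ⟨(hf.2.2 i h1 (by omega)).1, fun s hs => ?_⟩
        rw [hit s (by omega)]
        exact (hf.2.2 i h1 (by omega)).2 s hs
      · rw [hit t le_rfl]
        have := (hf.2.2 (t+1) (by omega) le_rfl).1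
        rwa [Function.iterate_succ_apply'] at this
    · rintro ⟨f, y⟩ hz ⟨f', y'⟩ hz' heq
      simp only [hA, Finset.coe_sigma, Set.mem_sigma_iff, Finset.mem_coe] at hz hz'
      have hit := iter_update f v (f^[t] v) y t (key f hz.1) t le_rfl
      have hit' := iter_update f' v (f'^[t] v) y' t (key f' hz'.1) t le_rfl
      simp only [Sigma.mk.injEq, heq_eq_eq] at heq
      obtain ⟨h1, h2⟩ := heq
      have hw : f^[t] v = f'^[t] v := by rw [← hit, ← hit', h1]
      rw [← hw] at h1 h2
      have hy : y = y' := by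
        have := congrFun h1 (f^[t] v); simpa using this
      have hff : f = f' := by
        funext u
        by_cases hu : u = f^[t] v
        · rw [hu]; exact h2
        · have := congrFun h1 u
          rwa [Function.update_of_ne hu, Function.update_of_ne hu] at this
      subst hff; subst hy; rfl
  calc _ = (A.card : ℝ) := hAc.symm
    _ ≤ B.card := by exact_mod_cast hle
    _ ≤ _ := hBc

theorem bad_bound {n : ℕ} (P : Fin n → ℕ) (v : Fin n) (t : ℕ) (c q : ℝ) (hn : 2 ≤ n)
    (hc : ∀ v : Fin n, c ≤ (({u : Fin n | P u = P v}).ncard : ℝ)) (hq : 0 ≤ q)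
    (hcq : (n:ℝ) - c ≤ q * (n - 1)) :
    ((badSet P v t).card : ℝ) ≤ q ^ t * (badSet P v 0).card := by
  have hn' : (2:ℝ) ≤ n := by exact_mod_cast hn
  induction t with
  | zero => simp
  | succ t ih =>
    have h := bad_step P v t c hc
    have h2 : ((badSet P v (t+1)).card : ℝ) * ((n:ℝ) - 1) ≤
        ((badSet P v t).card * q) * ((n:ℝ) - 1) := by
      rw [mul_assoc]
      exact h.trans (by gcongr)
    have h3 := le_of_mul_le_mul_right h2 (by linarith)
    calc _ ≤ _ := h3
      _ ≤ (q ^ t * (badSet P v 0).card) * q := by gcongr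
      _ = _ := by ring

theorem asym (e : ℝ) (he : 0 < e) : ∃ N : ℕ, ∀ n : ℕ, N ≤ n → 2 ≤ n ∧
    ∃ q : ℝ, 0 ≤ q ∧ (n:ℝ) - 0.9 * (n:ℝ) ^ (0.9:ℝ) ≤ q * (n - 1) ∧
      n * q ^ ⌊(n:ℝ) ^ (0.15:ℝ)⌋₊ ≤ e := by
  have T := tendsto_natCast_atTop_atTop (R := ℝ)
  have h1 := ((tendsto_rpow_mul_exp_neg_mul_atTop_nhds_zero 20 (1/4) (by norm_num)).comp
    ((tendsto_rpow_atTop (y := 0.05) (by norm_num)).comp T)).eventually (ge_mem_nhds he)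
  have h2 := ((tendsto_rpow_atTop (y := 0.9) (by norm_num)).comp T).eventually
    (Filter.eventually_ge_atTop 10)
  have h3 := ((tendsto_rpow_atTop (y := 0.15) (by norm_num)).comp T).eventually
    (Filter.eventually_ge_atTop 2)
  obtain ⟨N, hN⟩ := Filter.eventually_atTop.1
    (h1.and (h2.and (h3.and (Filter.eventually_ge_atTop 2))))
  refine ⟨N, fun n hn => ?_⟩
  obtain ⟨h1, h2, h3, h4⟩ := hN n hn
  simp only [Function.comp] at h1 h2 h3
  have hn2 : (2:ℝ) ≤ n := by exact_mod_cast h4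
  have hn0 : (0:ℝ) < n := by linarith
  set x : ℝ := (n:ℝ) ^ (-0.1:ℝ) with hx
  have hx0 : 0 < x := Real.rpow_pos_of_pos hn0 _
  have hx1 : x ≤ 1 := Real.rpow_le_one_of_one_le_of_nonpos (by linarith) (by norm_num)
  have hxn : x * n = (n:ℝ) ^ (0.9:ℝ) := by
    rw [hx, ← Real.rpow_add_one hn0.ne']; norm_num
  have hxT : x * (n:ℝ) ^ (0.15:ℝ) = (n:ℝ) ^ (0.05:ℝ) := by
    rw [hx, ← Real.rpow_add hn0]; norm_num
  have h20 : ((n:ℝ) ^ (0.05:ℝ)) ^ (20:ℝ) = n := by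
    rw [← Real.rpow_mul hn0.le]; norm_num
  refine ⟨h4, 1 - x/2, by linarith, ?_, ?_⟩
  · rw [← hxn] at h2 ⊢
    nlinarith
  · rw [h20] at h1
    refine le_trans ?_ h1
    gcongr
    have hf : (n:ℝ) ^ (0.15:ℝ) / 2 ≤ (⌊(n:ℝ) ^ (0.15:ℝ)⌋₊ : ℝ) := by
      have := Nat.lt_floor_add_one ((n:ℝ) ^ (0.15:ℝ)); linarith
    calc (1 - x/2) ^ ⌊(n:ℝ) ^ (0.15:ℝ)⌋₊ ≤ (Real.exp (-(x/2))) ^ ⌊(n:ℝ) ^ (0.15:ℝ)⌋₊ := by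
          apply pow_le_pow_left₀ (by linarith)
          exact Real.one_sub_le_exp_neg _
      _ = Real.exp (⌊(n:ℝ) ^ (0.15:ℝ)⌋₊ * (-(x/2))) := by rw [← Real.exp_nat_mul]
      _ ≤ _ := by
          apply Real.exp_le_exp.2
          rw [← hxT]
          nlinarith [mul_le_mul_of_nonneg_left hf hx0.le]


/-- For each `n` let `V_1, …, V_m` be any partition of `[n]` in which every part
has size at least `0.9 · n^0.9` (represented by a labelling function `part n : Fin n → ℕ`
whose fibers are the parts), and let `f : [n] → [n]` be a uniformly random function with no
fixed point.  Then with high probability as `n → ∞`, for every vertex `v` there exists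
`1 ≤ t ≤ n^0.15` such that either `f^[t] v` lies in the same part as `f^[t-1] v`, or
`f^[t] v = f^[s] v` for some `0 ≤ s < t`.

The uniform model is expressed by counting fixed-point-free functions: for every `p < 1`,
eventually the number of good functions is at least `p` times the total. -/
theorem stmt_7 (part : (n : ℕ) → Fin n → ℕ)
    (hpart : ∀ (n : ℕ) (v : Fin n),
      (0.9 : ℝ) * (n : ℝ) ^ (0.9 : ℝ) ≤ (({u : Fin n | part n u = part n v}).ncard : ℝ)) :
    ∀ p : ℝ, p < 1 → ∃ N : ℕ, ∀ n : ℕ, N ≤ n →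
      p * (Nat.card {f : Fin n → Fin n // ∀ v : Fin n, f v ≠ v} : ℝ) ≤
      (Nat.card {f : Fin n → Fin n //
          (∀ v : Fin n, f v ≠ v) ∧
          ∀ v : Fin n, ∃ t : ℕ, 1 ≤ t ∧ (t : ℝ) ≤ (n : ℝ) ^ (0.15 : ℝ) ∧
            (part n (f^[t] v) = part n (f^[t - 1] v) ∨
              ∃ s : ℕ, s < t ∧ f^[t] v = f^[s] v)} : ℝ) := by
  intro p hp
  obtain ⟨N, hN⟩ := asym (1 - p) (by linarith)
  refine ⟨N, fun n hn => ?_⟩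
  obtain ⟨hn2, q, hq, hcq, hfin⟩ := hN n hn
  classical
  set T := ⌊(n:ℝ) ^ (0.15:ℝ)⌋₊ with hT
  rw [Nat.card_eq_fintype_card, Nat.card_eq_fintype_card, Fintype.card_subtype,
    Fintype.card_subtype]
  set D := Finset.univ.filter (fun f : Fin n → Fin n => ∀ v : Fin n, f v ≠ v) with hD
  set G := Finset.univ.filter (fun f : Fin n → Fin n => (∀ v : Fin n, f v ≠ v) ∧
          ∀ v : Fin n, ∃ t : ℕ, 1 ≤ t ∧ (t : ℝ) ≤ (n : ℝ) ^ (0.15 : ℝ) ∧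
            (part n (f^[t] v) = part n (f^[t - 1] v) ∨
              ∃ s : ℕ, s < t ∧ f^[t] v = f^[s] v)) with hG
  have hsub : D ⊆ G ∪ Finset.univ.biUnion (fun v => badSet (part n) v T) := by
    intro f hf
    by_cases hg : f ∈ G
    · exact Finset.mem_union_left _ hg
    · apply Finset.mem_union_right
      simp only [hD, hG, Finset.mem_filter, Finset.mem_univ, true_and] at hf hg
      simp only [hf, ne_eq, not_false_eq_true, implies_true, true_and] at hg
      push Not at hg
      obtain ⟨v, hv⟩ := hg
      simp only [Finset.mem_biUnion, Finset.mem_univ, true_and, badSet, Finset.mem_filter]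
      refine ⟨v, hf, fun i h1 h2 => ?_⟩
      exact hv i h1 ((Nat.le_floor_iff (by positivity)).1 h2)
  have h0 : ∀ v, (badSet (part n) v 0).card ≤ D.card := by
    intro v
    apply Finset.card_le_card
    intro f hf
    simp only [badSet, hD, Finset.mem_filter] at hf ⊢
    exact ⟨hf.1, hf.2.1⟩
  have h1 : (D.card : ℝ) ≤ G.card + ∑ v, ((badSet (part n) v T).card : ℝ) := by
    have := (Finset.card_le_card hsub).trans ((Finset.card_union_le _ _).trans
      (Nat.add_le_add_left Finset.card_biUnion_le _))
    exact_mod_cast this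
  have h2 : ∑ v, ((badSet (part n) v T).card : ℝ) ≤ n * (q ^ T * D.card) := by
    have : ∀ v ∈ (Finset.univ : Finset (Fin n)),
        ((badSet (part n) v T).card : ℝ) ≤ q ^ T * D.card := by
      intro v _
      refine (bad_bound (part n) v T _ q hn2 (hpart n) hq hcq).trans ?_
      have := h0 v
      gcongr
    simpa using Finset.sum_le_card_nsmul _ _ _ this
  have h3 : n * (q ^ T * D.card) ≤ (1 - p) * (D.card : ℝ) := by
    rw [← mul_assoc]; gcongr
  linarith
end

section
/- Let f : [n] → [n] be a uniformly random function with f(v) ≠ v for all v. Then with high probability as n → ∞, for every vertex v ∈ [n], the number of vertices u ∈ [n] for which f^{t}(u) = v for some integer 0 ≤ t ≤ n^{0.15} is at most n^{0.7}. Equivalently, w.h.p. the functional digraph of f contains no in-arborescence of height at most n^{0.15} with more than n^{0.7} vertices. -/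
open Finset Function in
theorem aux_iter {V : Type*} [DecidableEq V] (f : V → V) (x y u : V) (k : ℕ)
    (h : ∀ i < k, f^[i] u ≠ x) : ∀ i ≤ k, (Function.update f x y)^[i] u = f^[i] u := by
  intro i
  induction i with
  | zero => intro _; rfl
  | succ i ih =>
    intro hi
    rw [Function.iterate_succ_apply', Function.iterate_succ_apply', ih (by omega),
      Function.update_of_ne (h i (by omega))]

def EvE {V : Type*} (f : V → V) (u w : V) (a b : ℕ) : Prop :=
  (∀ i < a, f^[i] u ≠ f^[a] u) ∧ (∀ j < b, f^[j] w ≠ f^[a] u) ∧ f^[a+1] u = f^[b] w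

open Classical in
theorem aux_card (n : ℕ) (u w : Fin n) (a b : ℕ) :
    ((Finset.univ : Finset (Fin n → Fin n)).filter
      (fun f => (∀ v, f v ≠ v) ∧ EvE f u w a b)).card * (n - 1) ≤
    ((Finset.univ : Finset (Fin n → Fin n)).filter (fun f => ∀ v, f v ≠ v)).card := by
  set E := ((Finset.univ : Finset (Fin n → Fin n)).filter
      (fun f => (∀ v, f v ≠ v) ∧ EvE f u w a b)) with hE
  have h1 : (E.sigma (fun f => (Finset.univ : Finset (Fin n)).erase (f^[a] u))).card
      = E.card * (n - 1) := by
    rw [Finset.card_sigma]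
    simp [Finset.card_erase_of_mem]
  rw [← h1]
  refine Finset.card_le_card_of_injOn
    (fun p => Function.update p.1 (p.1^[a] u) p.2) ?_ ?_
  · rintro ⟨f, y⟩ hp
    simp only [hE, Finset.coe_sigma, Set.mem_sigma_iff, Finset.mem_coe, Finset.mem_filter,
      Finset.mem_univ, true_and, Finset.mem_erase, and_true] at hp ⊢
    intro v
    by_cases hv : v = f^[a] u
    · subst hv
      simpa using hp.2
    · rw [Function.update_of_ne hv]
      exact hp.1.1 v
  · rintro ⟨f, y⟩ hp ⟨f', y'⟩ hp' heq
    simp only [hE, Finset.coe_sigma, Set.mem_sigma_iff, Finset.mem_coe, Finset.mem_filter,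
      Finset.mem_univ, true_and, Finset.mem_erase, and_true] at hp hp' heq
    obtain ⟨⟨-, e1, e2, e3⟩, -⟩ := hp
    obtain ⟨⟨-, e1', e2', e3'⟩, -⟩ := hp'
    have A := aux_iter f _ y u a e1 a le_rfl
    have A' := aux_iter f' _ y' u a e1' a le_rfl
    have B := aux_iter f _ y w b e2 b le_rfl
    have B' := aux_iter f' _ y' w b e2' b le_rfl
    rw [heq, A'] at A
    rw [heq, B'] at B
    have hy : y = y' := by
      have := congrFun heq (f^[a] u)
      rw [Function.update_self, ← A, Function.update_self] at this
      exact this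
    have hf : f = f' := by
      funext z
      by_cases hz : z = f^[a] u
      · rw [hz, ← Function.iterate_succ_apply' f a u, e3, ← B, ← e3', 
          Function.iterate_succ_apply', A]
      · have := congrFun heq z
        rwa [Function.update_of_ne hz, Function.update_of_ne (by rwa [A])] at this
    subst hf; subst hy; rfl

theorem aux_meet {V : Type*} (f : V → V) (u w : V) (s t H : ℕ) (hs : s ≤ H) (ht : t ≤ H)
    (h : f^[s] u = f^[t] w) (hne : u ≠ w) :
    ∃ a < H + 1, ∃ b < H + 1, EvE f u w a b ∨ EvE f w u a b := by
  classical
  have hex : ∃ a, ∃ j ≤ t, f^[a] u = f^[j] w := ⟨s, t, le_rfl, h⟩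
  obtain ⟨j, hj, hja⟩ := Nat.find_spec hex
  have hmin : ∀ i < Nat.find hex, ∀ j ≤ t, f^[i] u ≠ f^[j] w := by
    intro i hi j hj hc
    exact Nat.find_min hex hi ⟨j, hj, hc⟩
  have hle : Nat.find hex ≤ s := Nat.find_min' hex ⟨t, le_rfl, h⟩
  generalize Nat.find hex = a at *
  rcases a with _ | a
  · have hex2 : ∃ b, f^[b] w = u := ⟨j, hja.symm⟩
    have hb := Nat.find_spec hex2
    have hbmin : ∀ i < Nat.find hex2, f^[i] w ≠ u := fun i hi => Nat.find_min hex2 hi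
    have hbj : Nat.find hex2 ≤ j := Nat.find_min' hex2 hja.symm
    generalize Nat.find hex2 = b at *
    rcases b with _ | b
    · exact absurd hb.symm hne
    · refine ⟨b, by omega, 0, by omega, Or.inr ⟨?_, by simp, by simpa using hb⟩⟩
      intro i hi hc
      apply hbmin (i+1) (by omega)
      rw [Function.iterate_succ_apply', hc, ← Function.iterate_succ_apply' f, hb]
  · refine ⟨a, by omega, j, by omega, Or.inl ⟨?_, ?_, hja⟩⟩
    · intro i hi hc
      apply hmin (i+1) (by omega) j hj
      rw [Function.iterate_succ_apply', hc, ← Function.iterate_succ_apply' f, hja]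
    · intro k hk hc
      exact hmin a (by omega) k (by omega) hc.symm

def Meets {V : Type*} (f : V → V) (H : ℕ) (u w : V) : Prop :=
  ∃ s ≤ H, ∃ t ≤ H, f^[s] u = f^[t] w

open Classical in
theorem aux_pair (n : ℕ) (H : ℕ) (u w : Fin n) (hne : u ≠ w) :
    ((Finset.univ : Finset (Fin n → Fin n)).filter
      (fun f => (∀ v, f v ≠ v) ∧ Meets f H u w)).card * (n - 1) ≤
    2 * (H+1)^2 * 
    ((Finset.univ : Finset (Fin n → Fin n)).filter (fun f => ∀ v, f v ≠ v)).card := by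
  set F := ((Finset.univ : Finset (Fin n → Fin n)).filter (fun f => ∀ v, f v ≠ v)) with hF
  have hsub : ((Finset.univ : Finset (Fin n → Fin n)).filter
      (fun f => (∀ v, f v ≠ v) ∧ Meets f H u w)) ⊆
      (Finset.range (H+1) ×ˢ Finset.range (H+1)).biUnion (fun p =>
        ((Finset.univ : Finset (Fin n → Fin n)).filter
          (fun f => (∀ v, f v ≠ v) ∧ EvE f u w p.1 p.2)) ∪
        ((Finset.univ : Finset (Fin n → Fin n)).filter
          (fun f => (∀ v, f v ≠ v) ∧ EvE f w u p.1 p.2))) := by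
    intro f hf
    simp only [Finset.mem_filter, Finset.mem_univ, true_and] at hf
    obtain ⟨hf, s, hs, t, ht, h⟩ := hf
    obtain ⟨a, ha, b, hb, hE⟩ := aux_meet f u w s t H hs ht h hne
    simp only [Finset.mem_biUnion, Finset.mem_product, Finset.mem_range, Finset.mem_union,
      Finset.mem_filter, Finset.mem_univ, true_and]
    exact ⟨(a, b), ⟨ha, hb⟩, hE.imp (fun h => ⟨hf, h⟩) (fun h => ⟨hf, h⟩)⟩
  calc _ ≤ (∑ p ∈ Finset.range (H+1) ×ˢ Finset.range (H+1),
        (((Finset.univ : Finset (Fin n → Fin n)).filter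
          (fun f => (∀ v, f v ≠ v) ∧ EvE f u w p.1 p.2)).card +
        ((Finset.univ : Finset (Fin n → Fin n)).filter
          (fun f => (∀ v, f v ≠ v) ∧ EvE f w u p.1 p.2)).card)) * (n - 1) := by
        gcongr
        refine (Finset.card_le_card hsub).trans (Finset.card_biUnion_le.trans ?_)
        exact Finset.sum_le_sum fun p _ => Finset.card_union_le _ _
    _ ≤ ∑ p ∈ Finset.range (H+1) ×ˢ Finset.range (H+1), (F.card + F.card) := by
        rw [Finset.sum_mul]
        refine Finset.sum_le_sum fun p _ => ?_
        rw [add_mul]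
        exact add_le_add (aux_card n u w _ _) (aux_card n w u _ _)
    _ = _ := by
        rw [Finset.sum_const, Finset.card_product, Finset.card_range, smul_eq_mul]
        ring

open Classical in
theorem aux_total (n : ℕ) (hn : 2 ≤ n) (H : ℕ) :
    ((∑ f ∈ (Finset.univ : Finset (Fin n → Fin n)).filter (fun f => ∀ v, f v ≠ v),
      ((Finset.univ : Finset (Fin n × Fin n)).filter (fun p => Meets f H p.1 p.2)).card : ℕ) : ℝ) ≤
    n * (1 + 4 * ((H:ℝ)+1)^2) * 
    (((Finset.univ : Finset (Fin n → Fin n)).filter (fun f => ∀ v, f v ≠ v)).card : ℝ) := by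
  set F := ((Finset.univ : Finset (Fin n → Fin n)).filter (fun f => ∀ v, f v ≠ v)) with hF
  have hswap : (∑ f ∈ F, ((Finset.univ : Finset (Fin n × Fin n)).filter
        (fun p => Meets f H p.1 p.2)).card) =
      ∑ p : Fin n × Fin n, ((Finset.univ : Finset (Fin n → Fin n)).filter
      (fun f => (∀ v, f v ≠ v) ∧ Meets f H p.1 p.2)).card := by
    simp_rw [Finset.card_filter]
    rw [Finset.sum_comm]
    refine Finset.sum_congr rfl fun p _ => ?_
    rw [hF, Finset.sum_filter]
    refine Finset.sum_congr rfl fun f _ => ?_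
    by_cases h1 : ∀ v, f v ≠ v <;> simp [h1]
  rw [hswap, Fintype.sum_prod_type]
  push_cast
  have hn1 : (2:ℝ) ≤ n := by exact_mod_cast hn
  set c : ℝ := 4 * ((H:ℝ)+1)^2 / n * F.card with hc
  have key : ∀ u w : Fin n, (((Finset.univ : Finset (Fin n → Fin n)).filter
      (fun f => (∀ v, f v ≠ v) ∧ Meets f H u w)).card : ℝ) ≤
      (if u = w then (F.card : ℝ) else 0) + c := by
    intro u w
    have hc0 : 0 ≤ c := by positivity
    by_cases h : u = w
    · rw [if_pos h]
      have : (((Finset.univ : Finset (Fin n → Fin n)).filter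
        (fun f => (∀ v, f v ≠ v) ∧ Meets f H u w)).card : ℝ) ≤ F.card := by
        norm_cast
        apply Finset.card_le_card
        intro f hf
        simp only [hF, Finset.mem_filter, Finset.mem_univ, true_and] at hf ⊢
        exact hf.1
      linarith
    · rw [if_neg h, zero_add]
      have h2 := aux_pair n H u w h
      rw [← hF] at h2
      have h3 : (((Finset.univ : Finset (Fin n → Fin n)).filter
        (fun f => (∀ v, f v ≠ v) ∧ Meets f H u w)).card : ℝ) * ((n:ℝ) - 1) ≤
         2 * ((H:ℝ)+1)^2 * F.card := by
        have := (Nat.cast_le (α := ℝ)).2 h2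
        push_cast [Nat.cast_sub (show 1 ≤ n by omega)] at this
        exact this
      rw [hc, div_mul_eq_mul_div, le_div_iff₀ (by linarith)]
      have : (0:ℝ) ≤ (((Finset.univ : Finset (Fin n → Fin n)).filter
        (fun f => (∀ v, f v ≠ v) ∧ Meets f H u w)).card : ℝ) := Nat.cast_nonneg _
      nlinarith
  calc _ ≤ ∑ u : Fin n, ∑ w : Fin n, ((if u = w then (F.card : ℝ) else 0) + c) :=
        Finset.sum_le_sum fun u _ => Finset.sum_le_sum fun w _ => key u w
    _ = n * F.card + n * (n * c) := by
        simp [Finset.sum_add_distrib]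
    _ = _ := by
        rw [hc]
        field_simp

theorem stmt_8 :
    ∀ p : ℝ, p < 1 → ∃ N : ℕ, ∀ n : ℕ, N ≤ n →
      p * (Nat.card {f : Fin n → Fin n // ∀ v : Fin n, f v ≠ v} : ℝ) ≤
      (Nat.card {f : Fin n → Fin n //
          (∀ v : Fin n, f v ≠ v) ∧
          ∀ v : Fin n,
            (({u : Fin n | ∃ t : ℕ, (t : ℝ) ≤ (n : ℝ) ^ (0.15 : ℝ) ∧ f^[t] u = v}).ncard : ℝ)
              ≤ (n : ℝ) ^ (0.7 : ℝ)} : ℝ) := by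
  classical
  intro p hp
  have hlim : Filter.Tendsto (fun n : ℕ => 17 * ((n:ℝ) ^ (-(0.1:ℝ)))) Filter.atTop (nhds 0) := by
    have := ((tendsto_rpow_neg_atTop (show (0:ℝ) < 0.1 by norm_num)).comp
      tendsto_natCast_atTop_atTop).const_mul 17
    simpa using this
  obtain ⟨N, hN⟩ := Filter.eventually_atTop.1
    (hlim.eventually (gt_mem_nhds (show (0:ℝ) < 1 - p by linarith)))
  refine ⟨max N 2, fun n hn => ?_⟩
  have hn2 : 2 ≤ n := le_trans (le_max_right _ _) hn
  have hsmall := hN n (le_trans (le_max_left _ _) hn)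
  have hn1 : (2:ℝ) ≤ n := by exact_mod_cast hn2
  set r : ℝ := (n : ℝ) ^ (0.15 : ℝ) with hr
  set m : ℝ := (n : ℝ) ^ (0.7 : ℝ) with hm
  have hr1 : 1 ≤ r := Real.one_le_rpow (by linarith) (by norm_num)
  have hm0 : 0 < m := by positivity
  set H : ℕ := ⌊r⌋₊ with hH
  have hHr : (H:ℝ) ≤ r := Nat.floor_le (by linarith)
  rw [Nat.card_eq_fintype_card, Nat.card_eq_fintype_card, Fintype.card_subtype,
    Fintype.card_subtype]
  have htot := aux_total n hn2 H
  set F := ((Finset.univ : Finset (Fin n → Fin n)).filter (fun f => ∀ v, f v ≠ v)) with hF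
  set Q : (Fin n → Fin n) → Prop := fun f => ∀ v : Fin n,
            (({u : Fin n | ∃ t : ℕ, (t : ℝ) ≤ r ∧ f^[t] u = v}).ncard : ℝ) ≤ m with hQ
  have hG : (Finset.univ : Finset (Fin n → Fin n)).filter (fun f => (∀ v, f v ≠ v) ∧ Q f)
      = F.filter Q := by
    rw [hF, Finset.filter_filter]
  change _ ≤ (((Finset.univ : Finset (Fin n → Fin n)).filter
    (fun f => (∀ v, f v ≠ v) ∧ Q f)).card : ℝ)
  rw [hG]
  have hsplit : ((F.filter Q).card : ℝ) + ((F.filter (fun f => ¬ Q f)).card : ℝ) = F.card := by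
    exact_mod_cast Finset.card_filter_add_card_filter_not (s := F) Q
  set B := F.filter (fun f => ¬ Q f) with hB
  have hbad : ∀ f ∈ B, m ^ 2 ≤
      (((Finset.univ : Finset (Fin n × Fin n)).filter
        (fun p => Meets f H p.1 p.2)).card : ℝ) := by
    intro f hf
    have hf2 := (Finset.mem_filter.1 hf).2
    simp only [hQ, not_forall, not_le] at hf2
    obtain ⟨v, hv⟩ := hf2
    rw [Set.ncard_eq_toFinset_card'] at hv
    set T := {u : Fin n | ∃ t : ℕ, (t : ℝ) ≤ r ∧ f^[t] u = v}.toFinset with hT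
    have hsub : T ×ˢ T ⊆ (Finset.univ : Finset (Fin n × Fin n)).filter
        (fun p => Meets f H p.1 p.2) := by
      rintro ⟨u, w⟩ h
      simp only [hT, Finset.mem_product, Set.mem_toFinset, Set.mem_ofPred_eq] at h
      obtain ⟨⟨s, hs, hsu⟩, t, ht, htw⟩ := h
      simp only [Finset.mem_filter, Finset.mem_univ, true_and]
      exact ⟨s, Nat.le_floor hs, t, Nat.le_floor ht, hsu.trans htw.symm⟩
    have h1 := Finset.card_le_card hsub
    rw [Finset.card_product] at h1
    have h2 := (Nat.cast_le (α := ℝ)).2 h1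
    push_cast at h2
    nlinarith
  have hmarkov : m ^ 2 * B.card ≤ n * (1 + 4 * ((H:ℝ)+1)^2) * F.card := by
    refine le_trans ?_ htot
    push_cast
    calc m ^ 2 * (B.card : ℝ) = ∑ f ∈ B, m ^ 2 := by simp [mul_comm]
      _ ≤ ∑ f ∈ B, (((Finset.univ : Finset (Fin n × Fin n)).filter
        (fun p => Meets f H p.1 p.2)).card : ℝ) := Finset.sum_le_sum hbad
      _ ≤ _ := Finset.sum_le_sum_of_subset_of_nonneg (Finset.filter_subset _ _)
        (fun _ _ _ => Nat.cast_nonneg _)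
  have hpoly : n * (1 + 4 * ((H:ℝ)+1)^2) ≤ 17 * (n * r^2) := by
    have hH0 : (0:ℝ) ≤ H := Nat.cast_nonneg _
    have : (1 + 4 * ((H:ℝ)+1)^2) ≤ 17 * r^2 := by nlinarith
    nlinarith
  have hexp : (n:ℝ) * r^2 = (n:ℝ) ^ (-(0.1:ℝ)) * m^2 := by
    have h0 : (0:ℝ) < n := by linarith
    rw [hr, hm, ← Real.rpow_natCast, ← Real.rpow_natCast, ← Real.rpow_mul h0.le,
      ← Real.rpow_mul h0.le, ← Real.rpow_add h0]
    nth_rewrite 1 [← Real.rpow_one (n:ℝ)]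
    rw [← Real.rpow_add h0]
    norm_num
  have hfin : (B.card : ℝ) ≤ (1 - p) * F.card := by
    have hF0 : (0:ℝ) ≤ F.card := Nat.cast_nonneg _
    have hm2 : 0 < m ^ 2 := by positivity
    have h1 : m ^ 2 * (B.card:ℝ) ≤ m^2 * ((1 - p) * F.card) := by
      calc m ^ 2 * (B.card:ℝ) ≤ 17 * (n * r^2) * F.card :=
            hmarkov.trans (mul_le_mul_of_nonneg_right hpoly hF0)
        _ = m^2 * ((17 * (n:ℝ) ^ (-(0.1:ℝ))) * F.card) := by rw [hexp]; ring
        _ ≤ _ := by gcongr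
    exact le_of_mul_le_mul_left h1 hm2
  linarith
end

section
/- Let d ≥ 2 be an integer, let c be a real number with 1 < c < d, and set δ = ( c^c / (3·e^{1+c}·d^c) )^{1/(c−1)}. Then with high probability as n → ∞ (through n with nd even), every subset S of the vertices of the random d-regular graph G(n,d) with |S| ≤ δn satisfies e(S) ≤ c|S|. -/
open Classical in
/-- regular -/
def RegX {n : ℕ} (d : ℕ) (G : SimpleGraph (Fin n)) : Prop :=
  ∀ v, (Finset.univ.filter (fun w => G.Adj v w)).card = d

/-- the four-cycle u v y x -/
def swX {n : ℕ} (u v x y : Fin n) : SimpleGraph (Fin n) :=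
  SimpleGraph.fromEdgeSet {s(u,v), s(x,y), s(u,x), s(v,y)}

open Classical in
lemma card_swapX {α : Type*} (A B : Finset α) (a b : α) (ha : a ∈ A) (hb : b ∉ A)
    (h : B = insert b (A.erase a)) : B.card = A.card := by
  subst h
  rw [Finset.card_insert_of_notMem (by simp [hb]), Finset.card_erase_of_mem ha]
  have := Finset.card_pos.2 ⟨a, ha⟩
  omega

lemma sw_adjX {n : ℕ} (G : SimpleGraph (Fin n)) (u v x y a b : Fin n) :
    (symmDiff G (swX u v x y)).Adj a b ↔ 
    (G.Adj a b ∧ ¬ (swX u v x y).Adj a b) ∨ ((swX u v x y).Adj a b ∧ ¬ G.Adj a b) := by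
  simp [symmDiff_def]

lemma sw_regX {n d : ℕ} (G : SimpleGraph (Fin n)) (hG : RegX d G) (u v x y : Fin n)
    (huv : G.Adj u v) (hxy : G.Adj x y) (hux : x ≠ u) (hvy : y ≠ v) (nux : ¬ G.Adj u x)
    (nvy : ¬ G.Adj v y) : RegX d (symmDiff G (swX u v x y)) := by
  classical
  have h1 := huv.ne
  have h2 := hxy.ne
  have hxv : x ≠ v := by rintro rfl; exact nux huv
  have hyu : y ≠ u := by rintro rfl; exact nvy huv.symm
  have huv' := huv.symm
  have hxy' := hxy.symm
  have nux' : ¬ G.Adj x u := fun h => nux h.symm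
  have nvy' : ¬ G.Adj y v := fun h => nvy h.symm
  intro w
  by_cases w1 : w = u
  · subst w1
    rw [← hG w]
    apply card_swapX _ _ v x (by simp [huv]) (by simp [nux])
    ext z
    simp only [Finset.mem_filter, Finset.mem_univ, true_and, Finset.mem_insert, Finset.mem_erase, sw_adjX]
    simp only [swX, SimpleGraph.fromEdgeSet_adj, Set.mem_insert_iff, Set.mem_singleton_iff, Sym2.eq_iff]
    grind
  by_cases w2 : w = v
  · subst w2
    rw [← hG w]
    apply card_swapX _ _ u y (by simp [huv']) (by simp [nvy])
    ext z
    simp only [Finset.mem_filter, Finset.mem_univ, true_and, Finset.mem_insert, Finset.mem_erase, sw_adjX]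
    simp only [swX, SimpleGraph.fromEdgeSet_adj, Set.mem_insert_iff, Set.mem_singleton_iff, Sym2.eq_iff]
    grind
  by_cases w3 : w = x
  · subst w3
    rw [← hG w]
    apply card_swapX _ _ y u (by simp [hxy]) (by simp [nux'])
    ext z
    simp only [Finset.mem_filter, Finset.mem_univ, true_and, Finset.mem_insert, Finset.mem_erase, sw_adjX]
    simp only [swX, SimpleGraph.fromEdgeSet_adj, Set.mem_insert_iff, Set.mem_singleton_iff, Sym2.eq_iff]
    grind
  by_cases w4 : w = y
  · subst w4
    rw [← hG w]
    apply card_swapX _ _ x v (by simp [hxy']) (by simp [nvy'])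
    ext z
    simp only [Finset.mem_filter, Finset.mem_univ, true_and, Finset.mem_insert, Finset.mem_erase, sw_adjX]
    simp only [swX, SimpleGraph.fromEdgeSet_adj, Set.mem_insert_iff, Set.mem_singleton_iff, Sym2.eq_iff]
    grind
  rw [← hG w]
  congr 1
  ext z
  simp only [Finset.mem_filter, Finset.mem_univ, true_and, sw_adjX]
  simp only [swX, SimpleGraph.fromEdgeSet_adj, Set.mem_insert_iff, Set.mem_singleton_iff, Sym2.eq_iff]
  grind

open Classical in
/-- regular graphs containing F -/
noncomputable def RX (n d : ℕ) (F : Finset (Sym2 (Fin n))) : Finset (SimpleGraph (Fin n)) :=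
  Finset.univ.filter (fun G => RegX d G ∧ ∀ e ∈ F, e ∈ G.edgeSet)

open Classical in
lemma pairs_leX {n : ℕ} (F : Finset (Sym2 (Fin n))) :
    (Finset.univ.filter (fun p : Fin n × Fin n => s(p.1,p.2) ∈ F)).card ≤ F.card * 2 := by
  have : (Finset.univ.filter (fun p : Fin n × Fin n => s(p.1,p.2) ∈ F)) ⊆
      F.biUnion (fun e => Finset.univ.filter (fun p : Fin n × Fin n => s(p.1,p.2) = e)) := by
    intro p hp
    simpa using hp
  refine (Finset.card_le_card this).trans (Finset.card_biUnion_le_card_mul _ _ _ ?_)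
  intro e he
  induction e with
  | h a b =>
    have : (Finset.univ.filter (fun p : Fin n × Fin n => s(p.1,p.2) = s(a,b))) ⊆ {(a,b),(b,a)} := by
      rintro ⟨p, q⟩ hp
      simp at hp ⊢
      tauto
    exact (Finset.card_le_card this).trans Finset.card_le_two

open Classical in
/-- good switching pairs -/
noncomputable def goodX {n : ℕ} (F : Finset (Sym2 (Fin n))) (u v : Fin n) (G : SimpleGraph (Fin n)) :
    Finset (Fin n × Fin n) :=
  Finset.univ.filter (fun p => G.Adj p.1 p.2 ∧ s(p.1,p.2) ∉ F ∧ p.1 ≠ u ∧ ¬ G.Adj u p.1 ∧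
    p.2 ≠ v ∧ ¬ G.Adj v p.2)

open Classical in
lemma pairsFromX {n d : ℕ} (G : SimpleGraph (Fin n)) (hG : RegX d G) (A : Finset (Fin n)) :
    (Finset.univ.filter (fun p : Fin n × Fin n => G.Adj p.1 p.2 ∧ p.1 ∈ A)).card = A.card * d := by
  have : (Finset.univ.filter (fun p : Fin n × Fin n => G.Adj p.1 p.2 ∧ p.1 ∈ A)) =
    (A.sigma (fun a => Finset.univ.filter (fun w => G.Adj a w))).map
      (Equiv.sigmaEquivProd (Fin n) (Fin n)).toEmbedding := by
    ext ⟨a, b⟩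
    simp [Finset.mem_map_equiv]
    tauto
  rw [this, Finset.card_map, Finset.card_sigma]
  rw [Finset.sum_congr rfl (fun a _ => hG a)]
  simp

open Classical in
lemma pairsToX {n d : ℕ} (G : SimpleGraph (Fin n)) (hG : RegX d G) (A : Finset (Fin n)) :
    (Finset.univ.filter (fun p : Fin n × Fin n => G.Adj p.1 p.2 ∧ p.2 ∈ A)).card = A.card * d := by
  rw [← pairsFromX G hG A]
  apply Finset.card_bij (fun p _ => (p.2, p.1))
  · intro p; simp; intro h; exact fun h2 => ⟨h.symm, h2⟩
  · rintro ⟨a,b⟩ _ ⟨a',b'⟩ _; simp; tauto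
  · rintro ⟨a,b⟩ h; simp at h; exact ⟨(b,a), by simp [h.2, h.1.symm], rfl⟩

open Classical in
lemma good_cardX {n d : ℕ} (F : Finset (Sym2 (Fin n))) (u v : Fin n) (G : SimpleGraph (Fin n))
    (hG : RegX d G) : n * d ≤ (goodX F u v G).card + F.card * 2 + (d+1)*d + (d+1)*d := by
  have h0 := pairsFromX G hG Finset.univ
  have h1 := pairsFromX G hG (insert u (Finset.univ.filter (fun w => G.Adj u w)))
  have h2 := pairsToX G hG (insert v (Finset.univ.filter (fun w => G.Adj v w)))
  rw [Finset.card_insert_of_notMem (by simp), hG] at h1 h2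
  have h3 := pairs_leX F
  rw [Finset.card_univ, Fintype.card_fin] at h0
  rw [← h0]
  nth_rewrite 2 [← h1]
  rw [← h2]
  refine le_trans ?_ (Nat.add_le_add_right (Nat.add_le_add_right (Nat.add_le_add_left h3 _) _) _)
  refine le_trans ?_ (Nat.add_le_add_right (Nat.add_le_add_right (Finset.card_union_le _ _) _) _)
  refine le_trans ?_ (Nat.add_le_add_right (Finset.card_union_le _ _) _)
  refine le_trans ?_ (Finset.card_union_le _ _)
  apply Finset.card_le_card
  intro p hp
  simp [goodX] at hp ⊢
  tauto

open Classical in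
lemma switchX {n d : ℕ} (F : Finset (Sym2 (Fin n))) (u v : Fin n) (he : s(u,v) ∉ F) (L : ℕ)
    (hL : L + F.card * 2 + 2 * ((d+1)*d) ≤ n * d) :
    (RX n d (insert s(u,v) F)).card * L ≤ (RX n d F).card * (d * d) := by
  have key : ((RX n d (insert s(u,v) F)).sigma (fun G => goodX F u v G)).card ≤
      ((RX n d F).sigma (fun G => (Finset.univ.filter (fun w => G.Adj u w)) ×ˢ
        (Finset.univ.filter (fun w => G.Adj v w)))).card := by
    apply Finset.card_le_card_of_injOn (fun q => ⟨symmDiff q.1 (swX u v q.2.1 q.2.2), q.2⟩)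
    · rintro ⟨G, x, y⟩ hq
      simp [RX, goodX] at hq ⊢
      obtain ⟨⟨hG, huv, hF⟩, hxy, hxF, hxu, nux, hyv, nvy⟩ := hq
      refine ⟨⟨sw_regX G hG u v x y huv hxy hxu hyv nux nvy, ?_⟩, ?_, ?_⟩
      · intro e heF
        have h1 := hF e heF
        induction e with
        | h a b =>
          simp only [SimpleGraph.mem_edgeSet] at h1 ⊢
          rw [sw_adjX]
          left
          refine ⟨h1, ?_⟩
          simp only [swX, SimpleGraph.fromEdgeSet_adj, Set.mem_insert_iff, Set.mem_singleton_iff]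
          rintro ⟨h | h | h | h, _⟩
          · exact he (h ▸ heF)
          · exact hxF (h ▸ heF)
          · rw [← SimpleGraph.mem_edgeSet, h] at h1; exact nux h1
          · rw [← SimpleGraph.mem_edgeSet, h] at h1; exact nvy h1
      · rw [sw_adjX]; right; refine ⟨?_, nux⟩
        simp [swX, Ne.symm hxu]
      · rw [sw_adjX]; right; refine ⟨?_, nvy⟩
        simp [swX, Ne.symm hyv]
    · rintro ⟨G, p⟩ _ ⟨G', p'⟩ _ h
      simp only [Sigma.mk.injEq, heq_eq_eq] at h
      obtain ⟨h1, rfl⟩ := h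
      simp only [Sigma.mk.injEq, heq_eq_eq, and_true]
      exact symmDiff_left_injective _ h1
  rw [Finset.card_sigma, Finset.card_sigma] at key
  calc (RX n d (insert s(u,v) F)).card * L = ∑ G ∈ RX n d (insert s(u,v) F), L := by simp
    _ ≤ ∑ G ∈ RX n d (insert s(u,v) F), (goodX F u v G).card := by
      apply Finset.sum_le_sum
      intro G hG
      simp only [RX, Finset.mem_filter] at hG
      have := good_cardX F u v G hG.2.1
      omega
    _ ≤ _ := key
    _ = ∑ G ∈ RX n d F, d * d := by
      apply Finset.sum_congr rfl
      intro G hG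
      simp only [RX, Finset.mem_filter] at hG
      rw [Finset.card_product, hG.2.1 u, hG.2.1 v]
    _ = _ := by simp

open Classical in
lemma RX_boundX {n d : ℕ} (hd : 0 < d) (hn : 8 * (d+1) ≤ n) (F : Finset (Sym2 (Fin n))) :
    F.card * 2 * 4 ≤ d * n → 
    ((RX n d F).card : ℝ) ≤ (2 * d / n) ^ F.card * (RX n d ∅).card := by
  induction F using Finset.induction_on with
  | empty => simp
  | insert e F he ih =>
    intro hc
    rw [Finset.card_insert_of_notMem he] at hc ⊢
    have ih := ih (by omega)
    have hn0 : (0:ℝ) < n := by exact_mod_cast (by omega : 0 < n)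
    have hd0 : (0:ℝ) < d := by exact_mod_cast hd
    induction e with
    | h u v =>
      have hnd : d * (8 * (d+1)) ≤ d * n := Nat.mul_le_mul_left _ hn
      have hnd' : n * d = d * n := Nat.mul_comm _ _
      have := switchX (d := d) F u v he (n * d - (F.card * 2 + 2 * ((d+1)*d))) (by nlinarith [Nat.sub_add_cancel (show F.card * 2 + 2 * ((d+1)*d) ≤ n * d by nlinarith)])
      have h2 : n * d ≤ 2 * (n * d - (F.card * 2 + 2 * ((d+1)*d))) := by
        have : 8 * (d * (d+1)) ≤ d * n := by nlinarith
        have e1 : (d+1)*d = d*(d+1) := Nat.mul_comm _ _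
        rw [e1]
        omega
      have h3 : (RX n d (insert s(u,v) F)).card * (n * d) ≤ 2 * ((RX n d F).card * (d * d)) := by
        calc _ ≤ (RX n d (insert s(u,v) F)).card * (2 * (n * d - (F.card * 2 + 2 * ((d+1)*d)))) := Nat.mul_le_mul_left _ h2
          _ = 2 * ((RX n d (insert s(u,v) F)).card * (n * d - (F.card * 2 + 2 * ((d+1)*d)))) := by ring
          _ ≤ _ := Nat.mul_le_mul_left _ this
      have h4 : ((RX n d (insert s(u,v) F)).card : ℝ) * (n * d) ≤ 2 * ((RX n d F).card * (d * d)) := by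
        exact_mod_cast h3
      have h5 : ((RX n d (insert s(u,v) F)).card : ℝ) ≤ (2 * d / n) * (RX n d F).card := by
        rw [div_mul_eq_mul_div, le_div_iff₀ hn0]
        nlinarith
      refine h5.trans ?_
      rw [pow_succ, mul_comm (_ ^ _), mul_assoc]
      gcongr

lemma chernX (l θ a : ℝ) (m : ℕ) (hl : 0 ≤ l) (hθ : 1 ≤ θ) (ha : a ≤ m) :
    l ^ m / m.factorial ≤ θ ^ (-a) * Real.exp (θ * l) := by
  have h0 : 0 < θ := by linarith
  have h1 := Real.pow_div_factorial_le_exp (θ * l) (by positivity) m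
  have h2 : θ ^ (-(m:ℝ)) ≤ θ ^ (-a) := Real.rpow_le_rpow_of_exponent_le hθ (by linarith)
  have h3 : l ^ m / m.factorial = θ ^ (-(m:ℝ)) * ((θ * l) ^ m / m.factorial) := by
    rw [Real.rpow_neg h0.le, Real.rpow_natCast, mul_pow]
    field_simp
  rw [h3]
  gcongr

lemma termX (d n s m : ℕ) (c : ℝ) (hc : 1 < c) (hd : 0 < d) (hn : 0 < n) (hs : 0 < s)
    (hm : c * s ≤ m) (h : (d:ℝ) * s ≤ c * n) :
    (n.choose s : ℝ) * ((s.choose 2).choose m * (2 * d / n) ^ m) ≤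
      (1 / (3 * (c ^ c / (3 * Real.exp (1 + c) * (d : ℝ) ^ c))) * ((s:ℝ) / n) ^ (c-1)) ^ s := by
  have hn0 : (0:ℝ) < n := by exact_mod_cast hn
  have hd0 : (0:ℝ) < d := by exact_mod_cast hd
  have hs0 : (0:ℝ) < s := by exact_mod_cast hs
  have hc0 : 0 < c := by linarith
  have a1 : (n.choose s : ℝ) ≤ (Real.exp 1 * n / s) ^ s := by
    have h1 := Nat.choose_le_pow_div (α := ℝ) s n
    have h2 := Real.pow_div_factorial_le_exp (s:ℝ) (by positivity) s
    calc (n.choose s : ℝ) ≤ (n:ℝ)^s / s.factorial := h1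
      _ = ((n:ℝ)/s)^s * ((s:ℝ)^s/s.factorial) := by rw [div_pow]; field_simp
      _ ≤ ((n:ℝ)/s)^s * Real.exp s := by gcongr
      _ = _ := by 
        rw [← Real.exp_one_pow, ← mul_pow]; congr 1; ring
  have a2 : ((s.choose 2).choose m : ℝ) * (2 * d / n) ^ m ≤ (d * s ^ 2 / n : ℝ) ^ m / m.factorial := by
    have h1 := Nat.choose_le_pow_div (α := ℝ) m (s.choose 2)
    have h2 : ((s.choose 2 : ℕ) : ℝ) ≤ s^2/2 := by
      have := Nat.choose_le_pow_div (α := ℝ) 2 s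
      simpa using this
    calc _ ≤ ((s.choose 2 : ℕ) : ℝ)^m / m.factorial * (2 * d / n) ^ m := by gcongr
      _ = (((s.choose 2 : ℕ) : ℝ) * (2 * d / n)) ^ m / m.factorial := by rw [mul_pow]; ring
      _ ≤ ((s^2/2 : ℝ) * (2 * d / n)) ^ m / m.factorial := by gcongr
      _ = _ := by congr 2; field_simp
  have a3 := chernX (d * s ^ 2 / n : ℝ) (c * n / (d * s)) (c * s) m (by positivity)
    (by rw [le_div_iff₀ (by positivity)]; linarith) hm
  have e1 : c * n / (d * s) * (d * s ^ 2 / n : ℝ) = c * s := by field_simp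
  rw [e1] at a3
  have a4 : (c * n / (d * s)) ^ (-(c * s)) * Real.exp (c * s) = 
     ((d * (s / n) / c : ℝ) ^ c * Real.exp c) ^ s := by
    rw [mul_pow, ← Real.exp_nat_mul, mul_comm (s:ℝ) c]
    congr 1
    rw [← Real.rpow_natCast, ← Real.rpow_mul (by positivity), Real.rpow_neg (by positivity), ← Real.inv_rpow (by positivity)]
    congr 1
    field_simp
  calc _ ≤ (Real.exp 1 * n / s) ^ s * ((d * (s / n) / c : ℝ) ^ c * Real.exp c) ^ s := by
        gcongr
        rw [← a4]; exact a2.trans a3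
    _ = _ := by
        rw [← mul_pow]
        congr 1
        rw [Real.div_rpow (by positivity) (by positivity), Real.mul_rpow (by positivity) (by positivity),
          Real.rpow_sub_one (by positivity), Real.exp_add]
        have : (d:ℝ)^c > 0 := by positivity
        have : c^c > 0 := by positivity
        field_simp

lemma DleX (d : ℕ) (c b : ℝ) (hc : 1 < c) (hd : 2 * c < d) (hb0 : 0 < b) (hb1 : b ≤ 1)
    (hb : c / d / Real.exp 1 ≤ b) :
    (c ^ c / (3 * Real.exp (1 + c) * (d : ℝ) ^ c)) ^ (1 / (c - 1)) ≤ b := by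
  have hd0 : (0:ℝ) < d := by linarith
  have hc0 : 0 < c := by linarith
  have : c ^ c / (3 * Real.exp (1 + c) * (d : ℝ) ^ c) ≤ b ^ (c-1) := by
    calc c ^ c / (3 * Real.exp (1 + c) * (d : ℝ) ^ c) ≤ c ^ c / (Real.exp c * (d : ℝ) ^ c) := by
          gcongr
          have : Real.exp c ≤ Real.exp (1+c) := by gcongr; linarith
          have := Real.exp_pos (1+c)
          linarith
      _ = (c / d / Real.exp 1) ^ c := by
          rw [Real.div_rpow (by positivity) (by positivity), Real.div_rpow (by positivity) (by positivity), Real.exp_one_rpow]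
          have : (d:ℝ)^c > 0 := by positivity
          field_simp
      _ ≤ b ^ c := by gcongr
      _ ≤ b ^ (c-1) := Real.rpow_le_rpow_of_exponent_ge hb0 hb1 (by linarith)
  calc _ ≤ (b ^ (c-1)) ^ (1/(c-1)) := by
        apply Real.rpow_le_rpow (by positivity) this (by apply one_div_nonneg.2; linarith)
    _ = b := by
        rw [← Real.rpow_mul hb0.le, mul_one_div_cancel (by linarith), Real.rpow_one]

lemma tendX (D c : ℝ) (hD : 0 < D) (hc : 1 < c) :
    Filter.Tendsto (fun n : ℕ => ∑' s : ℕ, if 0 < s ∧ (s:ℝ) ≤ D ^ (1/(c-1)) * n then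
      (1 / (3 * D) * ((s:ℝ) / n) ^ (c-1)) ^ s else 0) Filter.atTop (nhds 0) := by
  have := tendsto_tsum_of_dominated_convergence (𝓕 := Filter.atTop) (β := ℕ) (G := ℝ)
    (f := fun (n : ℕ) (s : ℕ) => if 0 < s ∧ (s:ℝ) ≤ D ^ (1/(c-1)) * n then
      (1 / (3 * D) * ((s:ℝ) / n) ^ (c-1)) ^ s else 0) (g := fun _ => 0)
    (bound := fun s => (1/3:ℝ)^s) (summable_geometric_of_lt_one (by norm_num) (by norm_num)) ?_ ?_
  · simpa using this
  · intro s
    by_cases hs : 0 < s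
    · have t1 : Filter.Tendsto (fun n : ℕ => (1 / (3 * D) * ((s:ℝ) / n) ^ (c-1)) ^ s) Filter.atTop (nhds 0) := by
        have h1 : Filter.Tendsto (fun n : ℕ => (s:ℝ) / n) Filter.atTop (nhds 0) :=
          tendsto_const_div_atTop_nhds_zero_nat _
        have h2 := ((h1.rpow_const (p := c-1) (Or.inr (by linarith))).const_mul (1/(3*D))).pow s
        rw [Real.zero_rpow (by linarith), mul_zero, zero_pow hs.ne'] at h2
        exact h2
      apply squeeze_zero _ _ t1
      · intro n; split_ifs <;> positivity
      · intro n; split_ifs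
        · exact le_rfl
        · positivity
    · simp [hs]
  · refine Filter.Eventually.of_forall fun n s => ?_
    split_ifs with h
    · obtain ⟨h1, h2⟩ := h
      have hn : (0:ℝ) < n := by
        rcases Nat.eq_zero_or_pos n with rfl | h
        · simp at h2; omega
        · exact_mod_cast h
      rw [Real.norm_of_nonneg (by positivity)]
      gcongr
      have h3 : ((s:ℝ)/n)^(c-1) ≤ D := by
        calc ((s:ℝ)/n)^(c-1) ≤ (D ^ (1/(c-1)))^(c-1) := by
              apply Real.rpow_le_rpow (by positivity) _ (by linarith)
              rw [div_le_iff₀ hn]; exact h2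
          _ = D := by
            rw [← Real.rpow_mul hD.le, one_div_mul_cancel (by linarith), Real.rpow_one]
      calc _ ≤ 1/(3*D) * D := by gcongr
        _ = 1/3 := by field_simp
    · simp

open Classical in
lemma edges_leX {n d : ℕ} (G : SimpleGraph (Fin n)) (hG : RegX d G) (S : Finset (Fin n))
    (F : Finset (Sym2 (Fin n))) (hF : ∀ e ∈ F, e ∈ G.edgeSet ∧ ∀ x ∈ e, x ∈ S) :
    2 * F.card ≤ d * S.card := by
  let H : SimpleGraph (Fin n) := SimpleGraph.fromEdgeSet (F : Set (Sym2 (Fin n)))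
  have hH : H.edgeFinset = F := by
    ext e
    simp only [H, SimpleGraph.mem_edgeFinset, SimpleGraph.edgeSet_fromEdgeSet]
    constructor
    · rintro ⟨h, _⟩; exact h
    · intro h
      exact ⟨h, fun h' => G.not_isDiag_of_mem_edgeSet (hF e h).1 h'⟩
  have h1 : ∑ v, H.degree v = 2 * F.card := by
    rw [← congrArg Finset.card hH]
    convert H.sum_degrees_eq_twice_card_edges
  rw [← h1]
  calc ∑ v, H.degree v ≤ ∑ v, (if v ∈ S then d else 0) := by
        apply Finset.sum_le_sum
        intro v _
        split_ifs with hv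
        · rw [← hG v, ← SimpleGraph.card_neighborFinset_eq_degree]
          apply Finset.card_le_card
          intro w hw
          simp only [SimpleGraph.mem_neighborFinset, H, SimpleGraph.fromEdgeSet_adj] at hw
          simp only [Finset.mem_filter, Finset.mem_univ, true_and]
          exact (hF _ hw.1).1
        · rw [← SimpleGraph.card_neighborFinset_eq_degree, Nat.le_zero, Finset.card_eq_zero,
            Finset.eq_empty_iff_forall_notMem]
          intro w hw
          simp only [SimpleGraph.mem_neighborFinset, H, SimpleGraph.fromEdgeSet_adj] at hw
          exact hv ((hF _ hw.1).2 v (by simp))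
    _ = d * S.card := by simp [Finset.sum_ite_mem, mul_comm]

lemma reg_iffX {n d : ℕ} (G : SimpleGraph (Fin n)) :
    (∀ v : Fin n, (G.neighborSet v).ncard = d) ↔ RegX d G := by
  classical
  refine forall_congr' fun v => ?_
  have : G.neighborSet v = ((Finset.univ.filter (fun w => G.Adj v w) : Finset (Fin n)) : Set (Fin n)) := by
    ext w; simp
  rw [this, Set.ncard_coe_finset]

/-- goodness for all small sets -/
def PX {n : ℕ} (c δ : ℝ) (G : SimpleGraph (Fin n)) : Prop :=
  ∀ S : Set (Fin n), (S.ncard : ℝ) ≤ δ * n →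
    (({e : Sym2 (Fin n) | e ∈ G.edgeSet ∧ ∀ x ∈ e, x ∈ S}).ncard : ℝ) ≤ c * S.ncard

open Classical in
lemma bad_boundX (n d : ℕ) (c : ℝ) (hc : 1 < c) (hd : 0 < d) (hn : 8 * (d+1) ≤ n) (D δ : ℝ)
    (hD : D = c ^ c / (3 * Real.exp (1 + c) * (d : ℝ) ^ c)) (hδ : δ = D ^ (1/(c-1))) :
    ((Finset.univ.filter (fun G : SimpleGraph (Fin n) => RegX d G ∧ ¬ PX c δ G)).card : ℝ) ≤
      (∑' s : ℕ, if 0 < s ∧ (s:ℝ) ≤ δ * n then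
      (1 / (3 * D) * ((s:ℝ) / n) ^ (c-1)) ^ s else 0) * (RX n d ∅).card := by
  have hn0 : (0:ℝ) < n := by exact_mod_cast (by omega : 0 < n)
  have hd0 : (0:ℝ) < d := by exact_mod_cast hd
  have hc0 : 0 < c := by linarith
  have hDpos : 0 < D := by rw [hD]; positivity
  have hδpos : 0 < δ := by rw [hδ]; positivity
  let m : ℕ → ℕ := fun s => ⌊c * s⌋₊ + 1
  let cond : ℕ → Prop := fun s => 0 < s ∧ (s:ℝ) ≤ δ * n ∧ 2 * m s ≤ d * s
  let pairs : Finset (Fin n) → Finset (Sym2 (Fin n)) := fun S => S.offDiag.image Sym2.mk.uncurry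
  have hpairs : ∀ S, (pairs S).card = S.card.choose 2 := fun S => Sym2.card_image_offDiag S
  have hm : ∀ s : ℕ, c * s ≤ m s := fun s => by
    have := (Nat.lt_floor_add_one (c * s)).le
    simpa [m] using this
  have hsub : (Finset.univ.filter (fun G : SimpleGraph (Fin n) => RegX d G ∧ ¬ PX c δ G)) ⊆
      (Finset.univ.powerset.filter (fun S : Finset (Fin n) => cond S.card)).biUnion (fun S =>
        (Finset.powersetCard (m S.card) (pairs S)).biUnion (RX n d)) := by
    intro G hG
    simp only [Finset.mem_filter, Finset.mem_univ, true_and, PX, not_forall, not_le] at hG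
    obtain ⟨hreg, S', hS1, hS2⟩ := hG
    obtain ⟨S, rfl⟩ : ∃ S : Finset (Fin n), (S : Set (Fin n)) = S' := ⟨S'.toFinset, by simp⟩
    rw [Set.ncard_coe_finset] at hS1 hS2
    set E : Finset (Sym2 (Fin n)) :=
      Finset.univ.filter (fun e => e ∈ G.edgeSet ∧ ∀ x ∈ e, x ∈ S) with hE
    have hEc : ({e : Sym2 (Fin n) | e ∈ G.edgeSet ∧ ∀ x ∈ e, x ∈ (S : Set (Fin n))}) = (E : Set _) := by
      ext e; simp [hE]
    rw [hEc, Set.ncard_coe_finset] at hS2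
    have hmE : m S.card ≤ E.card := by
      have : ⌊c * S.card⌋₊ < E.card := (Nat.floor_lt (by positivity)).2 hS2
      exact this
    obtain ⟨F, hFE, hFc⟩ := Finset.exists_subset_card_eq hmE
    have hF : ∀ e ∈ F, e ∈ G.edgeSet ∧ ∀ x ∈ e, x ∈ S := by
      intro e he
      have := hFE he
      simpa [hE] using this
    have hle := edges_leX G hreg S F hF
    rw [hFc] at hle
    have hspos : 0 < S.card := by
      rcases Nat.eq_zero_or_pos S.card with h | h
      · rw [h] at hle; simp [m] at hle
      · exact h
    simp only [Finset.mem_biUnion, Finset.mem_filter, Finset.mem_powersetCard]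
    refine ⟨S, ⟨by simp, hspos, hS1, hle⟩, F, ⟨?_, hFc⟩, ?_⟩
    · intro e he
      have h1 := hF e he
      induction e with
      | h a b =>
        simp only [pairs, Finset.mem_image, Finset.mem_offDiag]
        exact ⟨(a, b), ⟨h1.2 a (by simp), h1.2 b (by simp), G.ne_of_adj h1.1⟩, rfl⟩
    · simp only [RX, Finset.mem_filter, Finset.mem_univ, true_and]
      exact ⟨hreg, fun e he => (hF e he).1⟩
  have hcond : ∀ s, cond s → (d:ℝ) * s ≤ c * n ∧ m s * 2 * 4 ≤ d * n := by
    rintro s ⟨h1, h2, h3⟩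
    have hs0 : (0:ℝ) < s := by exact_mod_cast h1
    have h3' : (2:ℝ) * m s ≤ d * s := by exact_mod_cast h3
    have hms : c * s < m s := by
      have := Nat.lt_floor_add_one (c * s)
      simpa [m] using this
    have h2c : 2 * c < d := by
      by_contra hcon
      push Not at hcon
      nlinarith
    have e2 := Real.add_one_le_exp (1:ℝ)
    have b1 : δ ≤ 1/4 := by
      rw [hδ, hD]
      apply DleX d c _ hc h2c (by norm_num) (by norm_num)
      rw [div_div, div_le_iff₀ (by positivity)]
      nlinarith
    have b2 : δ ≤ c / d := by
      rw [hδ, hD]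
      apply DleX d c _ hc h2c (by positivity) (by rw [div_le_one hd0]; linarith)
      apply div_le_self (by positivity)
      linarith
    constructor
    · have : (s:ℝ) ≤ c / d * n := h2.trans (by gcongr)
      calc (d:ℝ) * s ≤ d * (c / d * n) := by gcongr
        _ = c * n := by field_simp
    · have : (s:ℝ) ≤ 1/4 * n := h2.trans (by gcongr)
      have h4 : (m s : ℝ) * 2 * 4 ≤ d * n := by nlinarith
      exact_mod_cast h4
  set T : ℝ := ((RX n d ∅).card : ℝ) with hT
  have hT0 : 0 ≤ T := by positivity
  let f : ℕ → ℝ := fun s => if cond s then ((s.choose 2).choose (m s) : ℝ) * (2 * d / n) ^ (m s) * T else 0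
  have hb1 : ((Finset.univ.filter (fun G : SimpleGraph (Fin n) => RegX d G ∧ ¬ PX c δ G)).card : ℝ) ≤
      ∑ S ∈ Finset.univ.powerset.filter (fun S : Finset (Fin n) => cond S.card),
        ∑ F ∈ Finset.powersetCard (m S.card) (pairs S), ((RX n d F).card : ℝ) := by
    have h1 := (Finset.card_le_card hsub).trans Finset.card_biUnion_le
    have h2 := h1.trans (Finset.sum_le_sum (fun S _ => Finset.card_biUnion_le))
    exact_mod_cast h2
  have hb2 : ∑ S ∈ Finset.univ.powerset.filter (fun S : Finset (Fin n) => cond S.card),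
        ∑ F ∈ Finset.powersetCard (m S.card) (pairs S), ((RX n d F).card : ℝ) ≤
      ∑ S ∈ (Finset.univ : Finset (Fin n)).powerset, f S.card := by
    rw [Finset.sum_filter]
    apply Finset.sum_le_sum
    intro S _
    simp only [f]
    split_ifs with hS
    · calc ∑ F ∈ Finset.powersetCard (m S.card) (pairs S), ((RX n d F).card : ℝ) ≤
          ∑ F ∈ Finset.powersetCard (m S.card) (pairs S), (2 * d / n : ℝ) ^ (m S.card) * T := by
            apply Finset.sum_le_sum
            intro F hF
            have hFc := (Finset.mem_powersetCard.1 hF).2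
            have := RX_boundX hd hn F (by rw [hFc]; exact (hcond _ hS).2)
            rwa [hFc] at this
        _ = _ := by
            rw [Finset.sum_const, Finset.card_powersetCard, hpairs, nsmul_eq_mul, mul_assoc]
    · exact le_rfl
  rw [Finset.sum_powerset_apply_card] at hb2
  refine (hb1.trans hb2).trans ?_
  set g : ℕ → ℝ := fun s => if 0 < s ∧ (s:ℝ) ≤ δ * n then
      (1 / (3 * D) * ((s:ℝ) / n) ^ (c-1)) ^ s else 0 with hg
  have hg0 : ∀ s, 0 ≤ g s := by
    intro s; simp only [hg]; split_ifs <;> positivity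
  have hgs : Summable g := by
    apply summable_of_ne_finset_zero (s := Finset.range (⌊δ * n⌋₊ + 1))
    intro s hs
    simp only [hg]
    rw [if_neg]
    rintro ⟨_, h⟩
    apply hs
    rw [Finset.mem_range, Nat.lt_succ_iff]
    exact Nat.le_floor h
  calc _ ≤ ∑ s ∈ Finset.range ((Finset.univ : Finset (Fin n)).card + 1), g s * T := by
        apply Finset.sum_le_sum
        intro s _
        rw [Finset.card_univ, Fintype.card_fin, nsmul_eq_mul]
        simp only [f]
        split_ifs with hs
        · have ht := termX d n s (m s) c hc hd (by omega) hs.1 (hm s) (hcond s hs).1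
          rw [← hD] at ht
          have : g s = (1 / (3 * D) * ((s:ℝ) / n) ^ (c-1)) ^ s := if_pos ⟨hs.1, hs.2.1⟩
          rw [this, ← mul_assoc]
          gcongr
        · rw [mul_zero]; exact mul_nonneg (hg0 s) hT0
    _ = (∑ s ∈ Finset.range ((Finset.univ : Finset (Fin n)).card + 1), g s) * T := by
        rw [Finset.sum_mul]
    _ ≤ _ := by
        gcongr
        exact hgs.sum_le_tsum _ (fun s _ => hg0 s)


/-- Let `d ≥ 2` be an integer, let `1 < c < d` be real, and set
`δ = (c^c / (3 · e^(1+c) · d^c))^(1/(c-1))`.  Then with high probability as `n → ∞`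
(through `n` with `n·d` even and `d ≤ n - 1`), every subset `S` of the vertices of the random
`d`-regular graph `G(n, d)` with `|S| ≤ δ·n` satisfies `e(S) ≤ c·|S|`, where `e(S)` denotes
the number of edges with both endpoints in `S`.

The uniform model is expressed by counting `d`-regular graphs on `Fin n`: for every `p < 1`,
eventually (over admissible `n`) the number of good graphs is at least `p` times the total. -/
theorem stmt_9 (d : ℕ) (hd : 2 ≤ d) (c : ℝ) (hc : 1 < c) (hcd : c < d) :
    ∀ p : ℝ, p < 1 → ∃ N : ℕ, ∀ n : ℕ, N ≤ n → Even (n * d) → d + 1 ≤ n →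
      p * (Nat.card {G : SimpleGraph (Fin n) //
              ∀ v : Fin n, (G.neighborSet v).ncard = d} : ℝ) ≤
      (Nat.card {G : SimpleGraph (Fin n) //
          (∀ v : Fin n, (G.neighborSet v).ncard = d) ∧
          ∀ S : Set (Fin n),
            (S.ncard : ℝ) ≤ (c ^ c / (3 * Real.exp (1 + c) * (d : ℝ) ^ c)) ^ (1 / (c - 1)) * n →
            (({e : Sym2 (Fin n) | e ∈ G.edgeSet ∧ ∀ x ∈ e, x ∈ S}).ncard : ℝ)
              ≤ c * S.ncard} : ℝ) := by
  classical
  intro p hp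
  set D : ℝ := c ^ c / (3 * Real.exp (1 + c) * (d : ℝ) ^ c) with hD
  set δ : ℝ := D ^ (1 / (c - 1)) with hδ
  have hc0 : 0 < c := by linarith
  have hd0 : (0:ℝ) < d := by linarith
  have hDpos : 0 < D := by rw [hD]; positivity
  have ht := tendX D c hDpos hc
  have hev := (ht.eventually (gt_mem_nhds (show (0:ℝ) < 1 - p by linarith)))
  obtain ⟨N, hN⟩ := Filter.eventually_atTop.1 hev
  refine ⟨max N (8 * (d+1)), fun n hn _ _ => ?_⟩
  have hb := bad_boundX n d c hc (by omega) (le_trans (le_max_right _ _) hn) D δ hD hδ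
  have hN := hN n (le_trans (le_max_left _ _) hn)
  have e1 : Nat.card {G : SimpleGraph (Fin n) // ∀ v : Fin n, (G.neighborSet v).ncard = d} =
      (RX n d ∅).card := by
    rw [Nat.card_eq_fintype_card, Fintype.card_subtype]
    congr 1
    ext G
    simp [RX, reg_iffX]
  have e2 : Nat.card {G : SimpleGraph (Fin n) //
          (∀ v : Fin n, (G.neighborSet v).ncard = d) ∧ PX c δ G} =
      (Finset.univ.filter (fun G : SimpleGraph (Fin n) => RegX d G ∧ PX c δ G)).card := by
    rw [Nat.card_eq_fintype_card, Fintype.card_subtype]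
    congr 1
    ext G
    simp [reg_iffX]
  have e3 : (RX n d ∅).card = 
      (Finset.univ.filter (fun G : SimpleGraph (Fin n) => RegX d G ∧ PX c δ G)).card +
      (Finset.univ.filter (fun G : SimpleGraph (Fin n) => RegX d G ∧ ¬ PX c δ G)).card := by
    rw [← Finset.card_filter_add_card_filter_not (s := RX n d ∅) (fun G => PX c δ G)]
    simp only [RX, Finset.filter_filter]
    simp
  have e3' : ((RX n d ∅).card : ℝ) = 
      (Finset.univ.filter (fun G : SimpleGraph (Fin n) => RegX d G ∧ PX c δ G)).card +
      (Finset.univ.filter (fun G : SimpleGraph (Fin n) => RegX d G ∧ ¬ PX c δ G)).card := by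
    exact_mod_cast e3
  change p * _ ≤ ((Nat.card {G : SimpleGraph (Fin n) //
          (∀ v : Fin n, (G.neighborSet v).ncard = d) ∧ PX c δ G} : ℕ) : ℝ)
  rw [e1, e2]
  have h5 := hb.trans (mul_le_mul_of_nonneg_right hN.le (Nat.cast_nonneg _))
  linarith
end

section
/- Let d ≥ 2 be an integer, let c be a real number with 1 < c < d, and set δ = ( c^c / (3·e^{1+c}·d^c) )^{1/(c−1)}. Then with high probability as n → ∞, every subset S of the vertices of the random d-out graph G_{n,d-out} with |S| ≤ δn satisfies e(S) ≤ c|S|. -/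
lemma aux_desc (k m j : ℕ) (h : k ≤ m) :
    k.descFactorial j * (m+1)^j ≤ m.descFactorial j * (k+1)^j := by
  induction j with
  | zero => simp
  | succ j ih =>
    rw [Nat.descFactorial_succ, Nat.descFactorial_succ, pow_succ, pow_succ]
    have h1 : (k - j) * (m+1) ≤ (m - j) * (k+1) := by
      rcases le_total k j with hk | hk
      · simp [Nat.sub_eq_zero_of_le hk]
      · obtain ⟨a, rfl⟩ := Nat.exists_eq_add_of_le hk
        obtain ⟨b, rfl⟩ := Nat.exists_eq_add_of_le h
        have : j + a + b - j = a + b := by omega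
        rw [this, Nat.add_sub_cancel_left]
        nlinarith [Nat.zero_le (b*j), Nat.zero_le b]
    calc _ = ((k - j) * (m+1)) * (k.descFactorial j * (m+1)^j) := by ring
      _ ≤ ((m - j) * (k+1)) * (m.descFactorial j * (k+1)^j) := Nat.mul_le_mul h1 ih
      _ = _ := by ring

lemma aux_choose (k m j : ℕ) (h : k ≤ m) :
    (k.choose j : ℝ) ≤ m.choose j * (((k:ℝ)+1)/((m:ℝ)+1))^j := by
  have h1 := aux_desc k m j h
  rw [Nat.descFactorial_eq_factorial_mul_choose, Nat.descFactorial_eq_factorial_mul_choose,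
    mul_assoc, mul_assoc] at h1
  have h2 := Nat.le_of_mul_le_mul_left h1 (Nat.factorial_pos j)
  have h3 : (k.choose j : ℝ) * ((m:ℝ)+1)^j ≤ m.choose j * ((k:ℝ)+1)^j := by exact_mod_cast h2
  rw [div_pow, ← mul_div_assoc, le_div_iff₀ (by positivity)]
  exact h3

lemma aux_hyper {α : Type*} [DecidableEq α] (U T : Finset α) (hT : T ⊆ U) (d : ℕ) (hd : d ≤ U.card)
    (y : ℝ) (hy : 0 ≤ y) :
    ∑ N ∈ U.powersetCard d, (1 + y) ^ (N ∩ T).card ≤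
      (U.card.choose d : ℝ) * (1 + y * (((T.card:ℝ)+1)/((U.card:ℝ)+1))) ^ d := by
  have h1 : ∀ N ∈ U.powersetCard d, (1 + y) ^ (N ∩ T).card =
      ∑ j ∈ Finset.range (d+1), ∑ A ∈ T.powersetCard j, if A ⊆ N then y ^ j else 0 := by
    intro N hN
    have hc := (Finset.mem_powersetCard.1 hN).2
    have hle : (N ∩ T).card ≤ d := hc ▸ Finset.card_le_card Finset.inter_subset_left
    rw [add_comm, add_pow]
    have : ∑ j ∈ Finset.range (d+1), ∑ A ∈ T.powersetCard j, (if A ⊆ N then y ^ j else 0)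
        = ∑ j ∈ Finset.range (d+1), y ^ j * ((N ∩ T).card.choose j : ℝ) := by
      refine Finset.sum_congr rfl fun j _ => ?_
      rw [← Finset.sum_filter, Finset.sum_const, nsmul_eq_mul, mul_comm, ← Finset.card_powersetCard]
      congr 3
      ext A
      simp only [Finset.mem_filter, Finset.mem_powersetCard, Finset.subset_inter_iff]
      tauto
    rw [this]
    simp only [one_pow, mul_one]
    refine Finset.sum_subset (Finset.range_mono (by omega)) fun j _ hj => ?_
    rw [Nat.choose_eq_zero_of_lt (by simpa using hj)]
    simp
  rw [Finset.sum_congr rfl h1, Finset.sum_comm]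
  rw [add_comm (1:ℝ), add_pow, Finset.mul_sum]
  refine Finset.sum_le_sum fun j hj => ?_
  have hjd : j ≤ d := by simpa [Nat.lt_succ_iff] using hj
  rw [Finset.sum_comm]
  have h2 : ∀ A ∈ T.powersetCard j, ∑ N ∈ U.powersetCard d, (if A ⊆ N then y ^ j else 0)
      = ((U.card - j).choose (d - j) : ℝ) * y ^ j := by
    intro A hA
    obtain ⟨hA1, hA2⟩ := Finset.mem_powersetCard.1 hA
    rw [← Finset.sum_filter, Finset.sum_const, nsmul_eq_mul,
      Finset.card_filter_powersetCard_subset _ _ _ (hA1.trans hT) (by omega), hA2]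
  rw [Finset.sum_congr rfl h2, Finset.sum_const, Finset.card_powersetCard, nsmul_eq_mul]
  have h3 := aux_choose T.card U.card j (Finset.card_le_card hT)
  have h4 : (U.card.choose d : ℝ) * d.choose j = U.card.choose j * (U.card - j).choose (d - j) := by
    exact_mod_cast Nat.choose_mul hjd
  calc _ ≤ (U.card.choose j * (((T.card:ℝ)+1)/((U.card:ℝ)+1))^j) *
        (((U.card - j).choose (d - j) : ℝ) * y ^ j) := by gcongr
    _ = (U.card.choose j * (U.card - j).choose (d - j)) * (y * (((T.card:ℝ)+1)/((U.card:ℝ)+1)))^j := by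
        rw [mul_pow]; ring
    _ = _ := by rw [← h4]; simp; ring

def OmegaAux (n d : ℕ) : Finset (Fin n → Finset (Fin n)) :=
  Fintype.piFinset fun v => (Finset.univ.erase v).powersetCard d

lemma aux_chernoff (n d : ℕ) (hn : d + 1 ≤ n) (S : Finset (Fin n)) (t c : ℝ) (ht : 1 ≤ t) :
    (((OmegaAux n d).filter fun N => c * S.card < ((∑ v ∈ S, (N v ∩ S).card : ℕ) : ℝ)).card : ℝ)
      * t ^ (c * S.card) ≤
    (OmegaAux n d).card * Real.exp (d * (t - 1) * (S.card / n) * S.card) := by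
  have hM : ∀ v : Fin n, ((Finset.univ.erase v).powersetCard d).card = (n-1).choose d := by
    intro v; simp [Finset.card_powersetCard]
  have h1 : (((OmegaAux n d).filter fun N => c * S.card < ((∑ v ∈ S, (N v ∩ S).card : ℕ) : ℝ)).card : ℝ)
      * t ^ (c * S.card) ≤ ∑ N ∈ OmegaAux n d, ∏ v, (if v ∈ S then t ^ (N v ∩ S).card else 1) := by
    rw [← nsmul_eq_mul, ← Finset.sum_const]
    refine (Finset.sum_le_sum fun N hN => ?_).trans
      (Finset.sum_le_sum_of_subset_of_nonneg (Finset.filter_subset _ _) fun N _ _ => ?_)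
    · rw [Finset.prod_ite_mem, Finset.univ_inter, Finset.prod_pow_eq_pow_sum, ← Real.rpow_natCast]
      exact Real.rpow_le_rpow_of_exponent_le ht (Finset.mem_filter.1 hN).2.le
    · refine Finset.prod_nonneg fun v _ => ?_
      split_ifs <;> positivity
  refine h1.trans ?_
  unfold OmegaAux
  rw [← Finset.prod_univ_sum (fun v => (Finset.univ.erase v).powersetCard d)
    (fun v A => if v ∈ S then t ^ (A ∩ S).card else (1:ℝ)), Fintype.card_piFinset]
  push_cast
  have h2 : Real.exp (d * (t - 1) * (S.card / n) * S.card) =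
      ∏ v : Fin n, if v ∈ S then Real.exp (d * (t - 1) * (S.card / n)) else 1 := by
    rw [Finset.prod_ite_mem, Finset.univ_inter, Finset.prod_const, ← Real.exp_nat_mul]
    congr 1; ring
  rw [h2, ← Finset.prod_mul_distrib]
  refine Finset.prod_le_prod (fun v _ => Finset.sum_nonneg fun A _ => ?_) fun v _ => ?_
  · split_ifs <;> positivity
  by_cases hv : v ∈ S
  · simp only [hv, if_true]
    have h3 := aux_hyper (Finset.univ.erase v) (S.erase v)
      (Finset.erase_subset_erase _ (Finset.subset_univ _)) d (by simp; omega) (t-1) (by linarith)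
    have h4 : ∀ A ∈ (Finset.univ.erase v).powersetCard d,
        (1 + (t-1)) ^ (A ∩ S.erase v).card = t ^ (A ∩ S).card := by
      intro A hA
      have : v ∉ A := fun h => by
        have := (Finset.mem_powersetCard.1 hA).1 h
        simp at this
      rw [Finset.inter_erase, Finset.erase_eq_of_notMem (by simp [this])]
      ring
    rw [Finset.sum_congr rfl h4] at h3
    refine h3.trans ?_
    rw [Finset.card_powersetCard]
    have hs : 0 < S.card := Finset.card_pos.2 ⟨v, hv⟩
    have e1 : (((S.erase v).card : ℝ) + 1) = S.card := by
      exact_mod_cast Finset.card_erase_add_one hv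
    have e2 : (((Finset.univ.erase v).card : ℝ) + 1) = n := by
      have := Finset.card_erase_add_one (Finset.mem_univ v)
      rw [Finset.card_univ, Fintype.card_fin] at this
      exact_mod_cast this
    rw [e1, e2]
    gcongr
    have : (d * (t - 1) * (S.card / n) : ℝ) = d * ((t-1) * (S.card / n)) := by ring
    rw [this, Real.exp_nat_mul]
    have h5 : 0 ≤ (t-1) * (S.card / n) := mul_nonneg (by linarith) (by positivity)
    gcongr
    rw [add_comm]; exact Real.add_one_le_exp _
  · simp [hv]

lemma aux_edges (n : ℕ) (N : Fin n → Finset (Fin n)) (S : Set (Fin n)) (F : Finset (Fin n))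
    (hF : (F : Set (Fin n)) = S) :
    ({e : Sym2 (Fin n) | e ∈ (SimpleGraph.fromRel (fun u w => w ∈ N u)).edgeSet ∧
                ∀ x ∈ e, x ∈ S}).ncard ≤ ∑ v ∈ F, (N v ∩ F).card := by
  classical
  rw [← Finset.card_sigma]
  refine le_trans ?_ (Finset.card_image_le (f := fun p : (_ : Fin n) × Fin n => s(p.1, p.2)))
  rw [← Set.ncard_coe_finset]
  refine Set.ncard_le_ncard ?_ (Finset.finite_toSet _)
  rintro ⟨a, b⟩ ⟨h1, h2⟩
  change s(a,b) ∈ _ at h1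
  change ∀ x ∈ s(a,b), _ at h2
  rw [SimpleGraph.mem_edgeSet, SimpleGraph.fromRel_adj] at h1
  have ha : a ∈ F := by rw [← Finset.mem_coe, hF]; exact h2 a (by simp)
  have hb : b ∈ F := by rw [← Finset.mem_coe, hF]; exact h2 b (by simp)
  simp only [Finset.coe_image, Set.mem_image, Finset.mem_coe, Finset.mem_sigma, Finset.mem_inter]
  rcases h1.2 with h | h
  · exact ⟨⟨a, b⟩, ⟨ha, h, hb⟩, rfl⟩
  · exact ⟨⟨b, a⟩, ⟨hb, h, ha⟩, Sym2.eq_swap⟩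

lemma aux_delta (d : ℕ) (hd : 2 ≤ d) (c : ℝ) (hc : 1 < c) (hcd : c < d) (K : ℝ)
    (hK : K = c ^ c / (3 * Real.exp (1 + c) * (d : ℝ) ^ c)) (x : ℝ) (hx0 : 0 < x)
    (hx : x ≤ K ^ (1 / (c - 1))) :
    x ^ (c - 1) ≤ K ∧ d * x ≤ c := by
  have hd0 : (0:ℝ) < d := by linarith
  have hK0 : 0 < K := by rw [hK]; positivity
  have h1 : x ^ (c - 1) ≤ K := by
    calc x ^ (c-1) ≤ (K ^ (1 / (c - 1))) ^ (c-1) :=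
          Real.rpow_le_rpow hx0.le hx (by linarith)
      _ = K := by
          rw [← Real.rpow_mul hK0.le, one_div_mul_cancel (by linarith), Real.rpow_one]
  refine ⟨h1, ?_⟩
  have h2 : K ≤ (c / d) ^ (c - 1) := by
    have e : K = (c / d) ^ c * (1 / (3 * Real.exp (1 + c))) := by
      rw [hK, Real.div_rpow (by linarith) hd0.le]; field_simp
    have h3 : (1 / (3 * Real.exp (1 + c))) ≤ 1 := by
      rw [div_le_one (by positivity)]
      have := Real.one_le_exp (x := 1 + c) (by linarith)
      linarith
    have h4 : (c / d) ^ c ≤ (c / d) ^ (c - 1) :=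
      Real.rpow_le_rpow_of_exponent_ge (by positivity) ((div_le_one hd0).2 hcd.le) (by linarith)
    rw [e]
    have h5 : 0 ≤ (c / d) ^ c := by positivity
    nlinarith
  have h3 : x ≤ c / d := by
    by_contra h
    push Not at h
    have := Real.rpow_lt_rpow (by positivity) h (show 0 < c - 1 by linarith)
    linarith
  rw [le_div_iff₀ hd0] at h3
  linarith

lemma aux_term (d n s : ℕ) (c : ℝ) (hc : 1 < c) (hd : 2 ≤ d) (hn : 0 < n) (hs : 0 < s) (K : ℝ)
    (hK : K = c ^ c / (3 * Real.exp (1 + c) * (d : ℝ) ^ c)) :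
    (n.choose s : ℝ) * (Real.exp (c * s) / (c * n / (d * s)) ^ (c * s)) ≤
      (((s : ℝ) / n) ^ (c - 1) / (3 * K)) ^ s := by
  have hd0 : (0:ℝ) < d := by positivity
  have hn0 : (0:ℝ) < n := by positivity
  have hs0 : (0:ℝ) < s := by positivity
  have hc0 : 0 < c := by linarith
  have h1 : (n.choose s : ℝ) ≤ (n / s * Real.exp 1) ^ s := by
    refine (Nat.choose_le_pow_div s n).trans ?_
    have := Real.pow_div_factorial_le_exp (s:ℝ) hs0.le s
    have hf : (0:ℝ) < s.factorial := by positivity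
    rw [div_le_iff₀ hf] at this
    rw [mul_pow, ← Real.exp_nat_mul, mul_one, div_pow, div_mul_eq_mul_div, div_le_div_iff₀ hf (by positivity)]
    calc (n:ℝ)^s * s^s ≤ n^s * (Real.exp s * s.factorial) := by gcongr
      _ = _ := by ring
  have h2 : Real.exp (c * s) / (c * n / (d * s)) ^ (c * s) =
      (Real.exp c / (c * n / (d * s)) ^ c) ^ s := by
    rw [Real.rpow_mul_natCast (by positivity), mul_comm c, Real.exp_nat_mul, div_pow]
  rw [h2]
  have h3 : ((s : ℝ) / n) ^ (c - 1) / (3 * K) =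
      (n / s * Real.exp 1) * (Real.exp c / (c * n / (d * s)) ^ c) := by
    rw [hK, Real.exp_add, Real.rpow_sub_one (by positivity), Real.div_rpow hs0.le hn0.le,
      Real.div_rpow (by positivity) (by positivity), Real.mul_rpow hc0.le hn0.le,
      Real.mul_rpow hd0.le hs0.le]
    field_simp
  rw [h3, mul_pow]
  gcongr

noncomputable def FAux (c K : ℝ) (n s : ℕ) : ℝ :=
  if 1 ≤ s ∧ (s : ℝ) ≤ K ^ (1 / (c - 1)) * n then (((s : ℝ) / n) ^ (c - 1) / (3 * K)) ^ s else 0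

lemma FAux_nonneg (c K : ℝ) (hK : 0 < K) (n s : ℕ) : 0 ≤ FAux c K n s := by
  unfold FAux; split_ifs <;> positivity

lemma FAux_le (d : ℕ) (hd : 2 ≤ d) (c : ℝ) (hc : 1 < c) (hcd : c < d) (K : ℝ)
    (hK : K = c ^ c / (3 * Real.exp (1 + c) * (d : ℝ) ^ c)) (n s : ℕ) (hn : 0 < n) :
    FAux c K n s ≤ (1/3 : ℝ) ^ s := by
  have hK0 : 0 < K := by rw [hK]; positivity
  have hn0 : (0:ℝ) < n := by positivity
  unfold FAux
  split_ifs with h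
  · have hs : (0:ℝ) < s := by exact_mod_cast h.1
    have := (aux_delta d hd c hc hcd K hK (s / n) (by positivity)
      (by rw [div_le_iff₀ hn0]; exact h.2)).1
    refine pow_le_pow_left₀ (by positivity) ?_ s
    rw [div_le_div_iff₀ (by positivity) (by norm_num)]
    linarith
  · positivity

lemma FAux_tendsto (d : ℕ) (hd : 2 ≤ d) (c : ℝ) (hc : 1 < c) (hcd : c < d) (K : ℝ)
    (hK : K = c ^ c / (3 * Real.exp (1 + c) * (d : ℝ) ^ c)) :
    Filter.Tendsto (fun n => ∑' s, FAux c K n s) Filter.atTop (nhds 0) := by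
  have hK0 : 0 < K := by rw [hK]; positivity
  have := tendsto_tsum_of_dominated_convergence (𝓕 := Filter.atTop) (f := fun n s => FAux c K n s)
    (g := fun _ => (0:ℝ)) (bound := fun s => (1/3 : ℝ)^s)
    (summable_geometric_of_lt_one (by norm_num) (by norm_num)) ?_ ?_
  · simpa using this
  · intro s
    rcases Nat.eq_zero_or_pos s with rfl | hs
    · simp [FAux]
    have h1 : Filter.Tendsto (fun n : ℕ => (((s : ℝ) / n) ^ (c - 1) / (3 * K)) ^ s)
        Filter.atTop (nhds 0) := by
      have h2 : Filter.Tendsto (fun n : ℕ => (s : ℝ) / n) Filter.atTop (nhds 0) :=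
        tendsto_const_div_atTop_nhds_zero_nat (s:ℝ)
      have h3 := ((h2.rpow_const (p := c - 1) (Or.inr (by linarith))).div_const (3*K)).pow s
      rwa [Real.zero_rpow (by linarith), zero_div, zero_pow hs.ne'] at h3
    refine squeeze_zero (fun n => FAux_nonneg c K hK0 n s) (fun n => ?_) h1
    unfold FAux; split_ifs
    · exact le_rfl
    · positivity
  · filter_upwards [Filter.eventually_gt_atTop 0] with n hn s
    rw [Real.norm_of_nonneg (FAux_nonneg c K hK0 n s)]
    exact FAux_le d hd c hc hcd K hK n s hn

lemma aux_bad (d : ℕ) (hd : 2 ≤ d) (c : ℝ) (hc : 1 < c) (hcd : c < d) (K : ℝ)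
    (hK : K = c ^ c / (3 * Real.exp (1 + c) * (d : ℝ) ^ c)) (n : ℕ) (hn : d + 1 ≤ n) :
    (((OmegaAux n d).filter fun N => ∃ S : Finset (Fin n), (S.card : ℝ) ≤ K ^ (1 / (c - 1)) * n ∧
      c * S.card < ((∑ v ∈ S, (N v ∩ S).card : ℕ) : ℝ)).card : ℝ) ≤
    (OmegaAux n d).card * ∑' s, FAux c K n s := by
  classical
  have hK0 : 0 < K := by rw [hK]; positivity
  have hn0 : (0:ℝ) < n := by exact_mod_cast (by omega : 0 < n)
  have hd0 : (0:ℝ) < d := by positivity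
  let B : Finset (Fin n) → Finset (Fin n → Finset (Fin n)) := fun S =>
    (OmegaAux n d).filter fun N => c * S.card < ((∑ v ∈ S, (N v ∩ S).card : ℕ) : ℝ)
  let P : ℕ → Prop := fun s => 1 ≤ s ∧ (s:ℝ) ≤ K ^ (1 / (c - 1)) * n
  let g : ℕ → ℝ := fun s => if P s then
    (OmegaAux n d).card * (Real.exp (c * s) / (c * n / (d * s)) ^ (c * s)) else 0
  have h1 : ((OmegaAux n d).filter fun N => ∃ S : Finset (Fin n),
      (S.card : ℝ) ≤ K ^ (1 / (c - 1)) * n ∧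
      c * S.card < ((∑ v ∈ S, (N v ∩ S).card : ℕ) : ℝ)) ⊆
      ((Finset.univ : Finset (Fin n)).powerset.filter fun S => P S.card).biUnion B := by
    intro N hN
    obtain ⟨h1, S, h2, h3⟩ := Finset.mem_filter.1 hN
    refine Finset.mem_biUnion.2 ⟨S, Finset.mem_filter.2 ⟨by simp, ?_, h2⟩,
      Finset.mem_filter.2 ⟨h1, h3⟩⟩
    rcases S.eq_empty_or_nonempty with rfl | h
    · simp at h3
    · exact Finset.card_pos.2 h
  have h2 : ∀ S : Finset (Fin n), P S.card → ((B S).card : ℝ) ≤ g S.card := by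
    intro S hS
    have hs : (0:ℝ) < S.card := by exact_mod_cast hS.1
    have hx := (aux_delta d hd c hc hcd K hK (S.card / n) (by positivity)
      (by rw [div_le_iff₀ hn0]; exact hS.2)).2
    have ht : 1 ≤ c * n / (d * S.card) := by
      rw [one_le_div (by positivity)]
      rwa [← mul_div_assoc, div_le_iff₀ hn0] at hx
    have h3 := aux_chernoff n d hn S _ c ht
    simp only [g, hS, if_true]
    rw [← mul_div_assoc, le_div_iff₀ (by positivity)]
    refine h3.trans ?_
    gcongr
    have e : d * (c * n / (d * S.card)) * (S.card / n) = c := by field_simp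
    have : (0:ℝ) ≤ d * (S.card / n) := by positivity
    nlinarith
  have h3 : ((((Finset.univ : Finset (Fin n)).powerset.filter fun S => P S.card).biUnion B).card : ℝ)
      ≤ ∑ S ∈ (Finset.univ : Finset (Fin n)).powerset, g S.card := by
    refine (Nat.cast_le.2 Finset.card_biUnion_le).trans ?_
    push_cast
    rw [Finset.sum_filter]
    refine Finset.sum_le_sum fun S _ => ?_
    split_ifs with h
    · exact h2 S h
    · simp [g, h]
  refine (Nat.cast_le.2 (Finset.card_le_card h1)).trans (h3.trans ?_)
  rw [Finset.sum_powerset_apply_card]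
  have hsum : Summable (fun s => FAux c K n s) :=
    Summable.of_nonneg_of_le (FAux_nonneg c K hK0 n)
      (fun s => FAux_le d hd c hc hcd K hK n s (by omega))
      (summable_geometric_of_lt_one (by norm_num) (by norm_num))
  refine le_trans ?_ (mul_le_mul_of_nonneg_left
    (hsum.sum_le_tsum (Finset.range (n+1)) fun s _ => FAux_nonneg c K hK0 n s) (Nat.cast_nonneg _))
  rw [Finset.mul_sum, Finset.card_univ, Fintype.card_fin]
  refine Finset.sum_le_sum fun s _ => ?_
  rw [nsmul_eq_mul]
  by_cases h : P s
  · have e : FAux c K n s = (((s : ℝ) / n) ^ (c - 1) / (3 * K)) ^ s := if_pos h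
    simp only [g, h, if_true, e]
    have := aux_term d n s c hc hd (by omega) h.1 K hK
    calc _ = (OmegaAux n d).card * ((n.choose s : ℝ) *
          (Real.exp (c * s) / (c * n / (d * s)) ^ (c * s))) := by ring
      _ ≤ _ := by gcongr
  · have e : FAux c K n s = 0 := if_neg h
    simp [g, h, e]


/-- Let `d ≥ 2` be an integer, let `1 < c < d` be real, and set
`δ = (c^c / (3 · e^(1+c) · d^c))^(1/(c-1))`.  Then with high probability as `n → ∞`, every
subset `S` of the vertices of the random `d`-out graph `G_{n,d-out}` with `|S| ≤ δ·n`
satisfies `e(S) ≤ c·|S|`, where `e(S)` is the number of edges with both endpoints in `S`.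

The random `d`-out graph is modelled by a uniformly random choice function
`N : Fin n → Finset (Fin n)` with `v ∉ N v` and `(N v).card = d`; the associated simple graph
is `SimpleGraph.fromRel (fun u w => w ∈ N u)`.  "With high probability" is expressed by
counting: for every `p < 1`, eventually (for `n` with `d ≤ n - 1`) the number of good choice
functions is at least `p` times the total. -/
theorem stmt_10 (d : ℕ) (hd : 2 ≤ d) (c : ℝ) (hc : 1 < c) (hcd : c < d) :
    ∀ p : ℝ, p < 1 → ∃ N₀ : ℕ, ∀ n : ℕ, N₀ ≤ n → d + 1 ≤ n →
      p * (Nat.card {N : Fin n → Finset (Fin n) //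
              ∀ v : Fin n, v ∉ N v ∧ (N v).card = d} : ℝ) ≤
      (Nat.card {N : Fin n → Finset (Fin n) //
          (∀ v : Fin n, v ∉ N v ∧ (N v).card = d) ∧
          ∀ S : Set (Fin n),
            (S.ncard : ℝ) ≤ (c ^ c / (3 * Real.exp (1 + c) * (d : ℝ) ^ c)) ^ (1 / (c - 1)) * n →
            (({e : Sym2 (Fin n) |
                e ∈ (SimpleGraph.fromRel (fun u w => w ∈ N u)).edgeSet ∧
                ∀ x ∈ e, x ∈ S}).ncard : ℝ)
              ≤ c * S.ncard} : ℝ) := by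
  classical
  intro p hp
  set K : ℝ := c ^ c / (3 * Real.exp (1 + c) * (d : ℝ) ^ c) with hK
  have ht := FAux_tendsto d hd c hc hcd K hK
  obtain ⟨N₀, hN₀⟩ := Filter.eventually_atTop.1 (ht.eventually (ge_mem_nhds (sub_pos.2 hp)))
  refine ⟨N₀, fun n hn hdn => ?_⟩
  have hε := hN₀ n hn
  have hbad := aux_bad d hd c hc hcd K hK n hdn
  have hmem : ∀ N : Fin n → Finset (Fin n),
      N ∈ OmegaAux n d ↔ ∀ v : Fin n, v ∉ N v ∧ (N v).card = d := by
    intro N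
    simp only [OmegaAux, Fintype.mem_piFinset, Finset.mem_powersetCard, Finset.subset_erase,
      Finset.subset_univ, true_and]
  have e1 : Nat.card {N : Fin n → Finset (Fin n) // ∀ v : Fin n, v ∉ N v ∧ (N v).card = d}
      = (OmegaAux n d).card := by
    rw [← Nat.card_eq_finsetCard]
    exact Nat.card_congr (Equiv.subtypeEquivRight fun N => (hmem N).symm)
  rw [e1]
  set Q : (Fin n → Finset (Fin n)) → Prop := fun N => ∃ S : Finset (Fin n),
      (S.card : ℝ) ≤ K ^ (1 / (c - 1)) * n ∧
      c * S.card < ((∑ v ∈ S, (N v ∩ S).card : ℕ) : ℝ) with hQ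
  have hsplit := Finset.card_filter_add_card_filter_not (s := OmegaAux n d) Q
  have e2 : ((OmegaAux n d).filter fun N => ¬ Q N).card ≤ Nat.card {N : Fin n → Finset (Fin n) //
          (∀ v : Fin n, v ∉ N v ∧ (N v).card = d) ∧
          ∀ S : Set (Fin n),
            (S.ncard : ℝ) ≤ K ^ (1 / (c - 1)) * n →
            (({e : Sym2 (Fin n) |
                e ∈ (SimpleGraph.fromRel (fun u w => w ∈ N u)).edgeSet ∧
                ∀ x ∈ e, x ∈ S}).ncard : ℝ)
              ≤ c * S.ncard} := by
    rw [← Nat.card_eq_finsetCard]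
    refine Nat.card_le_card_of_injective (fun N => ⟨N.1, ?_⟩) ?_
    · obtain ⟨h1, h2⟩ := Finset.mem_filter.1 N.2
      refine ⟨(hmem _).1 h1, fun S hS => ?_⟩
      have hF : ((S.toFinset : Finset (Fin n)) : Set (Fin n)) = S := by simp
      have h3 := aux_edges n N.1 S S.toFinset hF
      rw [Set.ncard_eq_toFinset_card'] at hS
      rw [Set.ncard_eq_toFinset_card' S]
      by_contra hcon
      push Not at hcon
      exact h2 ⟨S.toFinset, hS, hcon.trans_le (by exact_mod_cast h3)⟩
    · intro a b hab
      exact Subtype.ext (congrArg (fun z => z.1) hab)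
  refine le_trans ?_ (Nat.cast_le.2 e2)
  have h5 : ((((OmegaAux n d).filter Q).card : ℝ) + ((OmegaAux n d).filter fun N => ¬ Q N).card)
      = (OmegaAux n d).card := by exact_mod_cast hsplit
  have h6 : (((OmegaAux n d).filter Q).card : ℝ) ≤ (OmegaAux n d).card * ∑' s, FAux c K n s := by
    convert hbad
  have h7 : (0:ℝ) ≤ (OmegaAux n d).card := by positivity
  nlinarith
end

section
/- Suppose reals c₁ > c₂ > 1 and a positive integer k satisfy (k/2 − 1)·((c₁/c₂)^{1/2} − 1) ≥ 2. Let G = (V,E) be a finite graph on at least k vertices satisfying (i) |E(G)| ≥ c₁|V| and (ii) every subset S ⊆ V of size |S| ≤ k satisfies e(S) ≤ c₂|S|. Then G contains a cycle of length at least (k/2 − 1)·((c₁/c₂)^{1/2} − 1). -/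
namespace LC
open Finset Classical

/-! counting part -/

noncomputable def eIn {V : Type*} [Fintype V] (G : SimpleGraph V) (S : Finset V) : ℕ :=
  ((Finset.univ : Finset (Sym2 V)).filter (fun e => e ∈ G.edgeSet ∧ ∀ x ∈ e, x ∈ S)).card

lemma double {V : Type*} [Fintype V] (G : SimpleGraph V) (S : Finset V) (hS : 2 ≤ S.card) :
    ∑ x ∈ S, eIn G (S.erase x) = (S.card - 2) * eIn G S := by
  unfold eIn
  have h1 : ∀ x ∈ S, ((Finset.univ : Finset (Sym2 V)).filter
      (fun e => e ∈ G.edgeSet ∧ ∀ y ∈ e, y ∈ S.erase x)) =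
      (((Finset.univ : Finset (Sym2 V)).filter
      (fun e => e ∈ G.edgeSet ∧ ∀ y ∈ e, y ∈ S)).filter (fun e => x ∉ e)) := by
    intro x hx
    ext e
    simp only [mem_filter, mem_univ, true_and, mem_erase]
    constructor
    · rintro ⟨h, h'⟩
      exact ⟨⟨h, fun y hy => (h' y hy).2⟩, fun hxe => (h' x hxe).1 rfl⟩
    · rintro ⟨⟨h, h'⟩, h2⟩
      exact ⟨h, fun y hy => ⟨fun hh => h2 (hh ▸ hy), h' y hy⟩⟩
  rw [Finset.sum_congr rfl (fun x hx => by rw [h1 x hx])]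
  have := Finset.sum_card_bipartiteAbove_eq_sum_card_bipartiteBelow (s := S)
    (t := (Finset.univ : Finset (Sym2 V)).filter (fun e => e ∈ G.edgeSet ∧ ∀ y ∈ e, y ∈ S))
    (fun x e => x ∉ e)
  unfold Finset.bipartiteAbove Finset.bipartiteBelow at this
  rw [this, mul_comm, ← smul_eq_mul, ← Finset.sum_const]
  apply Finset.sum_congr rfl
  intro e he
  simp only [mem_filter, mem_univ, true_and] at he
  obtain ⟨he, heS⟩ := he
  induction e using Sym2.ind with
  | _ a b =>
    have hab : a ≠ b := by
      have : G.Adj a b := he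
      exact this.ne
    have ha : a ∈ S := heS a (by simp)
    have hb : b ∈ S := heS b (by simp)
    have : S.filter (fun x => x ∉ s(a, b)) = (S.erase a).erase b := by
      ext x
      simp only [mem_filter, Sym2.mem_iff, mem_erase]
      tauto
    rw [this, card_erase_of_mem (by simp [hb, hab.symm]), card_erase_of_mem ha]
    omega

lemma avg {V : Type*} [Fintype V] (G : SimpleGraph V) (c : ℝ) (k : ℕ) (hk : 2 ≤ k)
    (h : ∀ S : Finset V, S.card ≤ k → (eIn G S : ℝ) ≤ c * S.card) (d : ℕ) :
    ∀ S : Finset V, S.card = k + d →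
      (eIn G S : ℝ) * (k - 1) ≤ c * (S.card * (S.card - 1)) := by
  have hk' : (2 : ℝ) ≤ k := by exact_mod_cast hk
  induction d with
  | zero =>
    intro S hS
    have := h S (by omega)
    have h2 : (S.card : ℝ) = k := by exact_mod_cast hS
    rw [h2] at this ⊢
    nlinarith
  | succ d ih =>
    intro S hS
    have hd := double G S (by omega)
    have hd' : ∑ x ∈ S, (eIn G (S.erase x) : ℝ) = ((S.card : ℝ) - 2) * eIn G S := by
      have : ((∑ x ∈ S, eIn G (S.erase x) : ℕ) : ℝ) = (((S.card - 2) * eIn G S : ℕ) : ℝ) := by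
        rw [hd]
      rw [Nat.cast_mul, Nat.cast_sub (by omega)] at this
      push_cast at this
      exact this
    have hle : ∑ x ∈ S, (eIn G (S.erase x) : ℝ) * (k - 1) ≤
        ∑ x ∈ S, c * (((S.card : ℝ) - 1) * (S.card - 2)) := by
      apply Finset.sum_le_sum
      intro x hx
      have hc : (S.erase x).card = k + d := by rw [card_erase_of_mem hx]; omega
      have := ih (S.erase x) hc
      have e1 : ((S.erase x).card : ℝ) = S.card - 1 := by
        rw [hc, hS]; push_cast; ring
      rw [e1] at this
      calc _ ≤ _ := this
        _ = _ := by ring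
    rw [← Finset.sum_mul, hd', Finset.sum_const, nsmul_eq_mul] at hle
    have hs : (2 : ℝ) < S.card := by
      have : 2 < S.card := by omega
      exact_mod_cast this
    have hpos : (0 : ℝ) < S.card - 2 := by linarith
    refine le_of_mul_le_mul_left ?_ hpos
    calc _ = _ := by ring
      _ ≤ _ := hle
      _ = _ := by ring

lemma expand {V : Type*} [Fintype V] (G : SimpleGraph V) (c₁ c₂ : ℝ) (k : ℕ) (hk : 2 ≤ k)
    (hc₂ : 1 < c₂) (hc₁ : c₂ < c₁)
    (h : ∀ S : Finset V, S.card ≤ k → (eIn G S : ℝ) ≤ c₂ * S.card)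
    (U : Finset V) (hU : c₁ * U.card ≤ eIn G U)
    (hmin : ∀ S ⊂ U, S.Nonempty → (eIn G S : ℝ) < c₁ * S.card)
    (W : Finset V) (hWU : W ⊆ U) (hW : W.Nonempty) (hWk : W.card ≤ k - 1) :
    (Real.sqrt (c₁ / c₂) - 1) * W.card ≤
      (U.filter (fun u => u ∉ W ∧ ∃ w ∈ W, G.Adj u w)).card := by
  set N := U.filter (fun u => u ∉ W ∧ ∃ w ∈ W, G.Adj u w) with hN
  have h1 : eIn G U ≤ eIn G (U \ W) + eIn G (W ∪ N) := by
    unfold eIn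
    refine le_trans (card_le_card ?_) (card_union_le _ _)
    intro e
    induction e using Sym2.ind with
    | _ a b =>
      simp only [mem_filter, mem_univ, true_and, mem_union, mem_sdiff, Sym2.mem_iff,
        SimpleGraph.mem_edgeSet, hN, forall_eq_or_imp, forall_eq]
      rintro ⟨hab, ha, hb⟩
      have hba := hab.symm
      by_cases haW : a ∈ W <;> by_cases hbW : b ∈ W
      · simp [*]
      · right; simp only [haW, hbW, hab, ha, hb, true_and, true_or, false_or, not_false_eq_true]
        exact ⟨a, haW, hba⟩
      · right; simp only [haW, hbW, hab, ha, hb, true_and, true_or, false_or, not_false_eq_true, and_true]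
        exact ⟨b, hbW, hab⟩
      · left; simp [*]
  have h2 : (eIn G (U \ W) : ℝ) ≤ c₁ * ((U.card : ℝ) - W.card) := by
    have hcard : ((U \ W).card : ℝ) = U.card - W.card := by
      rw [card_sdiff_of_subset hWU, Nat.cast_sub (card_le_card hWU)]
    rcases (U \ W).eq_empty_or_nonempty with h0 | h0
    · rw [← hcard, h0]
      have := h ∅ (by simp)
      simpa using this
    · rw [← hcard]
      refine (hmin _ ?_ h0).le
      refine ⟨sdiff_subset, fun hh => ?_⟩
      obtain ⟨w, hw⟩ := hW
      have := hh (hWU hw)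
      simp [hw] at this
  have h3 : c₁ * W.card ≤ eIn G (W ∪ N) := by
    have : (eIn G U : ℝ) ≤ eIn G (U \ W) + eIn G (W ∪ N) := by exact_mod_cast h1
    nlinarith
  have hs : ((W ∪ N).card : ℝ) = W.card + N.card := by
    rw [card_union_of_disjoint, Nat.cast_add]
    rw [Finset.disjoint_left]
    intro a ha hb
    simp [hN, ha] at hb
  have hw0 : (0 : ℝ) < W.card := by exact_mod_cast hW.card_pos
  have hwk : (W.card : ℝ) ≤ k - 1 := by
    have : W.card + 1 ≤ k := by omega
    have : (W.card : ℝ) + 1 ≤ k := by exact_mod_cast this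
    linarith
  have hc0 : 0 < c₂ := by linarith
  have hq1 : 1 < c₁ / c₂ := by rw [lt_div_iff₀ hc0]; linarith
  set q := Real.sqrt (c₁ / c₂) with hq
  have hqq : q * q = c₁ / c₂ := Real.mul_self_sqrt (by linarith)
  have hqc : c₁ = q * q * c₂ := by rw [hqq]; field_simp
  have hq1' : 1 < q := by rw [hq, Real.lt_sqrt] <;> linarith
  suffices q * W.card ≤ (W ∪ N).card by rw [hs] at this; linarith
  set s : ℝ := ((W ∪ N).card : ℝ) with hsd
  set w : ℝ := (W.card : ℝ) with hwd
  rcases le_total (W ∪ N).card k with hle | hle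
  · have h4 := h _ hle
    have h5 : c₂ * (q * q * w) ≤ c₂ * s := by
      calc _ = c₁ * w := by rw [hqc]; ring
        _ ≤ _ := h3.trans h4
    have h6 := le_of_mul_le_mul_left h5 hc0
    nlinarith [mul_pos (by linarith : 0 < q) hw0]
  · obtain ⟨d, hd⟩ := Nat.exists_eq_add_of_le hle
    have h4 := avg G c₂ k hk h d _ hd
    have hk1 : (0 : ℝ) ≤ k - 1 := by linarith
    have h5 : c₂ * (q * q * w * (k - 1)) ≤ c₂ * (s * (s - 1)) := by
      calc _ = c₁ * w * (k - 1) := by rw [hqc]; ring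
        _ ≤ _ := (mul_le_mul_of_nonneg_right h3 hk1).trans h4
    have h6 := le_of_mul_le_mul_left h5 hc0
    have hs0 : 0 ≤ s := Nat.cast_nonneg _
    have h7 : q * q * w * w ≤ q * q * w * (k - 1) :=
      mul_le_mul_of_nonneg_left hwk (mul_nonneg (mul_self_nonneg q) hw0.le)
    refine abs_le_of_sq_le_sq' ?_ hs0 |>.2
    nlinarith

/-! cycle part -/

def comp {V : Type*} (G : SimpleGraph V) (X : Set V) (x : V) : Set V :=
  {y | ∃ p : G.Walk x y, ∀ z ∈ p.support, z ∈ X}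

section
variable {V : Type*} {G : SimpleGraph V} {X : Set V}

lemma comp_self {x : V} (h : x ∈ X) : x ∈ comp G X x := ⟨.nil, by simpa using h⟩

lemma comp_symm {x y : V} (h : y ∈ comp G X x) : x ∈ comp G X y := by
  obtain ⟨p, hp⟩ := h
  exact ⟨p.reverse, by simpa using hp⟩

lemma comp_trans {x y z : V} (h : y ∈ comp G X x) (h' : z ∈ comp G X y) : z ∈ comp G X x := by
  obtain ⟨p, hp⟩ := h
  obtain ⟨p', hp'⟩ := h'
  refine ⟨p.append p', fun a ha => ?_⟩
  rw [SimpleGraph.Walk.mem_support_append_iff] at ha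
  exact ha.elim (hp a) (hp' a)

lemma comp_mem {x y : V} (h : y ∈ comp G X x) : y ∈ X := by
  obtain ⟨p, hp⟩ := h
  exact hp _ p.end_mem_support

lemma comp_adj {x y z : V} (h : y ∈ comp G X x) (hz : z ∈ X) (ha : G.Adj y z) :
    z ∈ comp G X x :=
  comp_trans h ⟨.cons ha .nil, by simp [comp_mem h, hz]⟩

lemma comp_nbr {y z : V} (h : z ∈ comp G X y) (hne : z ≠ y) :
    ∃ y', G.Adj y y' ∧ y' ∈ comp G (X \ {y}) z := by
  obtain ⟨p, hp⟩ := h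
  have hpp := p.bypass_isPath
  have hps : ∀ a ∈ p.bypass.support, a ∈ X := fun a ha => hp a (p.support_bypass_subset_support ha)
  generalize p.bypass = r at hpp hps
  cases r with
  | nil => exact absurd rfl hne
  | @cons _ y' _ hadj r =>
    refine ⟨y', hadj, comp_symm ⟨r, fun a ha => ⟨hps a (by simp [ha]), ?_⟩⟩⟩
    rw [SimpleGraph.Walk.cons_isPath_iff] at hpp
    rintro rfl
    exact hpp.2 ha

lemma pick {u y : V} (P : G.Walk u y) (hP : P.IsPath) (A : Finset V) (hA : A.Nonempty)
    (hAP : ∀ a ∈ A, a ∈ P.support) :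
    ∃ u' ∈ A, ∃ Q : G.Walk u' y, Q.IsPath ∧ (∀ z ∈ Q.support, z ∈ P.support) ∧
      A.card ≤ Q.length + 1 := by
  induction P with
  | nil =>
    simp only [SimpleGraph.Walk.support_nil, List.mem_singleton] at hAP
    obtain ⟨a, ha⟩ := hA
    obtain rfl := hAP a ha
    refine ⟨a, ha, .nil, by simp, by simp, ?_⟩
    have : A ⊆ {a} := fun b hb => by simpa using hAP b hb
    simpa using card_le_card this
  | @cons u v w hadj p ih =>
    by_cases hu : u ∈ A
    · refine ⟨u, hu, .cons hadj p, hP, fun z hz => hz, ?_⟩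
      have : A ⊆ (SimpleGraph.Walk.cons hadj p).support.toFinset := fun b hb => by
        simpa only [List.mem_toFinset] using hAP b hb
      have h2 := (card_le_card this).trans (List.toFinset_card_le _)
      rwa [SimpleGraph.Walk.length_support] at h2
    · obtain ⟨u', hu', Q, hQ, hQs, hQc⟩ := ih hP.of_cons (fun a ha => by
        have := hAP a ha
        simp only [SimpleGraph.Walk.support_cons, List.mem_cons] at this
        rcases this with rfl | h
        · exact absurd ha hu
        · exact h)
      exact ⟨u', hu', Q, hQ, fun z hz => by simp [hQs z hz], hQc⟩

lemma close {u y y' w : V} (Q : G.Walk u y) (hQ : Q.IsPath) (R : G.Walk y' w) (hR : R.IsPath)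
    (hd : ∀ z ∈ Q.support, z ∉ R.support) (hyy : G.Adj y y') (hwu : G.Adj w u)
    (hl : 1 ≤ Q.length) :
    ∃ (v : V) (c : G.Walk v v), c.IsCycle ∧ Q.length + 2 ≤ c.length := by
  have hne : u ≠ y := by
    rintro rfl
    rw [SimpleGraph.Walk.isPath_iff_eq_nil] at hQ
    subst hQ
    simp at hl
  refine ⟨w, .cons hwu (Q.append (.cons hyy R)), ?_, ?_⟩
  · rw [SimpleGraph.Walk.cons_isCycle_iff]
    constructor
    · rw [SimpleGraph.Walk.isPath_def, SimpleGraph.Walk.support_append]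
      simp only [SimpleGraph.Walk.support_cons, List.tail_cons]
      rw [List.nodup_append]
      refine ⟨hQ.support_nodup, hR.support_nodup, ?_⟩
      rintro a ha b hb rfl
      exact hd a ha hb
    · rw [SimpleGraph.Walk.edges_append, SimpleGraph.Walk.edges_cons]
      simp only [List.mem_append, List.mem_cons, not_or]
      refine ⟨fun h => ?_, fun h => ?_, fun h => ?_⟩
      · exact hd w (Q.fst_mem_support_of_mem_edges h) R.end_mem_support
      · rw [Sym2.eq_iff] at h
        rcases h with ⟨rfl, rfl⟩ | ⟨rfl, rfl⟩
        · exact hd _ Q.end_mem_support R.end_mem_support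
        · exact hne rfl
      · exact hd u Q.start_mem_support (R.snd_mem_support_of_mem_edges h)
  · simp only [SimpleGraph.Walk.length_cons, SimpleGraph.Walk.length_append]
    omega

end

lemma greedy {V : Type*} [Fintype V] (G : SimpleGraph V) (X : Set V) (m : ℕ) (hm : 1 ≤ m)
    (D : Finset V) (hD : m ≤ D.card) (hDX : ∀ z ∈ D, z ∈ X)
    (hDc : ∀ z ∈ D, ∀ a ∈ comp G X z, a ∈ D)
    (hs : ∀ z ∈ D, (univ.filter (fun a => a ∈ comp G X z)).card ≤ m) :
    ∃ W ⊆ D, W.card ≤ m ∧ m ≤ 2 * W.card ∧ ∀ z ∈ W, ∀ a ∈ comp G X z, a ∈ W := by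
  obtain ⟨W, hW, hmax⟩ := Finset.exists_max_image
    (D.powerset.filter (fun W => W.card ≤ m ∧ ∀ z ∈ W, ∀ a ∈ comp G X z, a ∈ W)) Finset.card
    ⟨∅, by simp⟩
  simp only [mem_filter, mem_powerset] at hW hmax
  obtain ⟨hWD, hWm, hWc⟩ := hW
  by_cases h2 : m ≤ 2 * W.card
  · exact ⟨W, hWD, hWm, h2, hWc⟩
  obtain ⟨z, hzD, hzW⟩ := Finset.exists_mem_notMem_of_card_lt_card (s := W) (t := D) (by omega)
  set C := univ.filter (fun a => a ∈ comp G X z) with hC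
  have hCD : C ⊆ D := fun a ha => hDc z hzD a (by simpa [hC] using ha)
  have hCc : ∀ b ∈ C, ∀ a ∈ comp G X b, a ∈ C := by
    intro b hb a ha
    simp only [hC, mem_filter, mem_univ, true_and] at hb ⊢
    exact comp_trans hb ha
  by_cases h3 : m ≤ 2 * C.card
  · exact ⟨C, hCD, hs z hzD, h3, hCc⟩
  exfalso
  have := hmax (W ∪ C) ⟨union_subset hWD hCD, (card_union_le _ _).trans (by omega), by
    intro b hb a ha
    rw [mem_union] at hb ⊢
    exact hb.imp (fun h => hWc b h a ha) (fun h => hCc b h a ha)⟩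
  have h4 : W ⊂ W ∪ C := by
    refine ⟨subset_union_left, fun hh => hzW (hh ?_)⟩
    simp [hC, comp_self (hDX z hzD)]
  have := card_lt_card h4
  omega

lemma dfs {V : Type*} [Fintype V] (G : SimpleGraph V) (U : Finset V)
    (hU : ∀ a b, G.Adj a b → a ∈ U) (m t : ℕ) (hm : 1 ≤ m) (ht : 2 ≤ t)
    (hN : ∀ W ⊆ U, W.card ≤ m → m ≤ 2 * W.card →
      t ≤ (U.filter (fun u => u ∉ W ∧ ∃ w ∈ W, G.Adj u w)).card) (n : ℕ) :
    ∀ (r y : V) (P : G.Walk r y), P.IsPath → Fintype.card V ≤ n + P.length →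
      m ≤ (univ.filter (fun z => ∃ y', G.Adj y y' ∧
        y' ∈ comp G {a | a ∉ P.support} z)).card →
      ∃ (v : V) (c : G.Walk v v), c.IsCycle ∧ t + 1 ≤ c.length := by
  induction n with
  | zero =>
    intro r y P hP hn
    have := hP.length_lt
    omega
  | succ n ih =>
    intro r y P hP hn hD
    set X : Set V := {a | a ∉ P.support} with hX
    set D := univ.filter (fun z => ∃ y', G.Adj y y' ∧ y' ∈ comp G X z) with hDdef
    by_cases hbig : ∃ z ∈ D, m + 1 ≤ (univ.filter (fun a => a ∈ comp G X z)).card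
    · obtain ⟨z, hz, hbig⟩ := hbig
      simp only [hDdef, mem_filter, mem_univ, true_and] at hz
      obtain ⟨y', hyy, hy'⟩ := hz
      have hy'X : y' ∉ P.support := comp_mem hy'
      refine ih r y' (P.concat hyy) (hP.concat hy'X hyy) (by simp; omega) ?_
      have hsub : (univ.filter (fun a => a ∈ comp G X z)).erase y' ⊆
          univ.filter (fun z => ∃ y'', G.Adj y' y'' ∧
            y'' ∈ comp G {a | a ∉ (P.concat hyy).support} z) := by
        intro a ha
        simp only [mem_erase, mem_filter, mem_univ, true_and] at ha ⊢
        have h1 : a ∈ comp G X y' := comp_trans (comp_symm hy') ha.2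
        obtain ⟨b, hb, hb'⟩ := comp_nbr h1 ha.1
        refine ⟨b, hb, ?_⟩
        convert hb' using 2
        ext c
        simp [hX, SimpleGraph.Walk.support_concat]
      have := card_le_card hsub
      have h2 := Finset.pred_card_le_card_erase (s := univ.filter (fun a => a ∈ comp G X z)) (a := y')
      omega
    · push Not at hbig
      have hDX : ∀ z ∈ D, z ∈ X := by
        intro z hz
        simp only [hDdef, mem_filter, mem_univ, true_and] at hz
        obtain ⟨y', hyy, hy'⟩ := hz
        exact comp_mem (comp_symm hy')
      obtain ⟨W, hWD, hWm, hW2, hWc⟩ := greedy G X m hm D hD hDX (by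
        intro z hz a ha
        simp only [hDdef, mem_filter, mem_univ, true_and] at hz ⊢
        obtain ⟨y', hyy, hy'⟩ := hz
        exact ⟨y', hyy, comp_trans (comp_symm ha) hy'⟩) (fun z hz => by have := hbig z hz; omega)
      have hWU : W ⊆ U := by
        intro z hz
        have hz := hWD hz
        simp only [hDdef, mem_filter, mem_univ, true_and] at hz
        obtain ⟨y', hyy, p, hp⟩ := hz
        cases p with
        | nil => exact hU _ _ hyy.symm
        | cons h _ => exact hU _ _ h
      have hA := hN W hWU hWm hW2
      set A := U.filter (fun u => u ∉ W ∧ ∃ w ∈ W, G.Adj u w) with hAdef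
      have hAP : ∀ a ∈ A, a ∈ P.support := by
        intro a ha
        simp only [hAdef, mem_filter] at ha
        obtain ⟨_, haW, w, hw, haw⟩ := ha
        by_contra hcon
        exact haW (hWc w hw a (comp_adj (comp_self (hDX w (hWD hw))) hcon haw.symm))
      obtain ⟨u, hu, Q, hQ, hQs, hQl⟩ := pick P hP A (card_pos.mp (by omega)) hAP
      simp only [hAdef, mem_filter] at hu
      obtain ⟨_, _, w, hw, huw⟩ := hu
      have hwD := hWD hw
      simp only [hDdef, mem_filter, mem_univ, true_and] at hwD
      obtain ⟨y', hyy, hy'⟩ := hwD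
      obtain ⟨p, hp⟩ := comp_symm hy'
      obtain ⟨v, c, hc, hcl⟩ := close Q hQ p.bypass p.bypass_isPath (fun z hz hz' =>
        hp z (p.support_bypass_subset_support hz') (hQs z hz)) hyy huw.symm (by omega)
      exact ⟨v, c, hc, by omega⟩

end LC

theorem stmt_11 {V : Type*} [Fintype V] (c₁ c₂ : ℝ) (k : ℕ) (hk : 0 < k)
    (hc₂ : 1 < c₂) (hc₁ : c₂ < c₁)
    (hineq : 2 ≤ ((k : ℝ) / 2 - 1) * (Real.sqrt (c₁ / c₂) - 1))
    (G : SimpleGraph V)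
    (hV : k ≤ Fintype.card V)
    (hE : c₁ * (Fintype.card V : ℝ) ≤ (G.edgeSet.ncard : ℝ))
    (hloc : ∀ S : Set V, S.ncard ≤ k →
      (({e : Sym2 V | e ∈ G.edgeSet ∧ ∀ x ∈ e, x ∈ S}).ncard : ℝ) ≤ c₂ * S.ncard) :
    ∃ (v : V) (w : G.Walk v v), w.IsCycle ∧
      ((k : ℝ) / 2 - 1) * (Real.sqrt (c₁ / c₂) - 1) ≤ (w.length : ℝ) := by
  classical
  have hc0 : 0 < c₂ := by linarith
  have hq1 : 1 < Real.sqrt (c₁ / c₂) := by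
    rw [Real.lt_sqrt (by norm_num), one_pow, lt_div_iff₀ hc0]; linarith
  have hk2 : 2 ≤ k := by
    by_contra hcon
    have : (k : ℝ) ≤ 1 := by
      have : k ≤ 1 := by omega
      exact_mod_cast this
    nlinarith
  have heIn : ∀ S : Finset V, LC.eIn G S =
      ({e : Sym2 V | e ∈ G.edgeSet ∧ ∀ x ∈ e, x ∈ (S : Set V)}).ncard := by
    intro S
    unfold LC.eIn
    rw [← Set.ncard_coe_finset]
    congr 1
    ext e
    simp
  have hl : ∀ S : Finset V, S.card ≤ k → (LC.eIn G S : ℝ) ≤ c₂ * S.card := by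
    intro S hS
    have := hloc S (by rwa [Set.ncard_coe_finset])
    rwa [Set.ncard_coe_finset, ← heIn] at this
  have huniv : c₁ * ((Finset.univ : Finset V).card : ℝ) ≤ LC.eIn G Finset.univ := by
    rw [heIn]
    simpa using hE
  obtain ⟨U, hUF, hUmin⟩ := Finset.exists_min_image
    ((Finset.univ : Finset (Finset V)).filter
      (fun S => S.Nonempty ∧ c₁ * (S.card : ℝ) ≤ LC.eIn G S)) Finset.card
    ⟨Finset.univ, by
      rw [Finset.mem_filter]
      refine ⟨Finset.mem_univ _, ?_, huniv⟩
      rw [← Finset.card_pos, Finset.card_univ]; omega⟩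
  simp only [Finset.mem_filter, Finset.mem_univ, true_and] at hUF hUmin
  obtain ⟨⟨r, hr⟩, hUc⟩ := hUF
  have hmin : ∀ S ⊂ U, S.Nonempty → (LC.eIn G S : ℝ) < c₁ * S.card := by
    intro S hS hne
    by_contra hcon
    have := hUmin S ⟨hne, not_lt.mp hcon⟩
    have := Finset.card_lt_card hS
    omega
  have hexp := LC.expand G c₁ c₂ k hk2 hc₂ hc₁ hl U hUc hmin
  set q := Real.sqrt (c₁ / c₂) with hq
  let H : SimpleGraph V :=
    { Adj := fun a b => G.Adj a b ∧ a ∈ U ∧ b ∈ U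
      symm := ⟨fun a b h => ⟨h.1.symm, h.2.2, h.2.1⟩⟩
      loopless := ⟨fun a h => h.1.ne rfl⟩ }
  have hHG : H ≤ G := fun a b h => h.1
  have hHU : ∀ a b, H.Adj a b → a ∈ U := fun a b h => h.2.1
  have hNH : ∀ W ⊆ U, U.filter (fun u => u ∉ W ∧ ∃ w ∈ W, H.Adj u w) =
      U.filter (fun u => u ∉ W ∧ ∃ w ∈ W, G.Adj u w) := by
    intro W hW
    apply Finset.filter_congr
    intro u hu
    constructor
    · rintro ⟨h, w, hw, ha⟩
      exact ⟨h, w, hw, ha.1⟩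
    · rintro ⟨h, w, hw, ha⟩
      exact ⟨h, w, hw, ha, hu, hW hw⟩
  set x := ((k : ℝ) / 2 - 1) * (q - 1) with hx
  have hk1r : ((k - 1 : ℕ) : ℝ) = k - 1 := by rw [Nat.cast_sub (by omega)]; simp
  have ht2 : 2 ≤ ⌈x⌉₊ := by
    have : (2 : ℝ) ≤ (⌈x⌉₊ : ℝ) := hineq.trans (Nat.le_ceil x)
    exact_mod_cast this
  -- component of r is large
  have hcomp : k - 1 + 1 ≤
      (Finset.univ.filter (fun a => a ∈ LC.comp H Set.univ r)).card := by
    by_contra hcon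
    set C := Finset.univ.filter (fun a => a ∈ LC.comp H Set.univ r) with hC
    have hCU : C ⊆ U := by
      intro a ha
      simp only [hC, Finset.mem_filter, Finset.mem_univ, true_and] at ha
      obtain ⟨p, _⟩ := LC.comp_symm ha
      cases p with
      | nil => exact hr
      | cons h _ => exact hHU _ _ h
    have hne : C.Nonempty := ⟨r, by simp [hC, LC.comp_self]⟩
    have h1 := hexp C hCU hne (by omega)
    rw [← hNH C hCU] at h1
    have h2 : U.filter (fun u => u ∉ C ∧ ∃ w ∈ C, H.Adj u w) = ∅ := by
      rw [Finset.filter_eq_empty_iff]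
      rintro u hu ⟨huC, w, hw, ha⟩
      apply huC
      simp only [hC, Finset.mem_filter, Finset.mem_univ, true_and] at hw ⊢
      exact LC.comp_adj hw (Set.mem_univ _) ha.symm
    rw [h2] at h1
    have h3 : (0 : ℝ) < C.card := by exact_mod_cast hne.card_pos
    have := mul_pos (sub_pos.mpr hq1) h3
    simp at h1
    linarith
  obtain ⟨v, c, hc, hcl⟩ := LC.dfs H U hHU (k - 1) ⌈x⌉₊ (by omega) ht2 (by
    intro W hW hWm hW2
    refine le_of_le_of_eq ?_ (congrArg Finset.card ((hNH W hW).symm.trans (by congr)))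
    have h1 := hexp W hW (Finset.card_pos.mp (by omega)) hWm
    rw [Nat.ceil_le]
    refine le_trans ?_ h1
    have h2 : ((k - 1 : ℕ) : ℝ) ≤ 2 * W.card := by exact_mod_cast hW2
    rw [hk1r] at h2
    rw [hx, mul_comm]
    exact mul_le_mul_of_nonneg_left (by linarith) (by linarith))
    (Fintype.card V) r r .nil (by simp) (by simp) (by
      have hsub : (Finset.univ.filter (fun a => a ∈ LC.comp H Set.univ r)).erase r ⊆
          Finset.univ.filter (fun z => ∃ y', H.Adj r y' ∧
            y' ∈ LC.comp H {a | a ∉ (SimpleGraph.Walk.nil : H.Walk r r).support} z) := by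
        intro a ha
        simp only [Finset.mem_erase, Finset.mem_filter, Finset.mem_univ, true_and] at ha ⊢
        obtain ⟨b, hb, hb'⟩ := LC.comp_nbr ha.2 ha.1
        refine ⟨b, hb, ?_⟩
        convert hb' using 2
        ext c
        simp
      have := Finset.card_le_card hsub
      have h2 := Finset.pred_card_le_card_erase
        (s := Finset.univ.filter (fun a => a ∈ LC.comp H Set.univ r)) (a := r)
      refine le_trans ?_ (le_of_le_of_eq this ?_)
      · omega
      · congr)
  refine ⟨v, c.mapLe hHG, hc.mapLe hHG, ?_⟩
  have h1 : (⌈x⌉₊ : ℝ) + 1 ≤ c.length := by exact_mod_cast hcl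
  have h2 := Nat.le_ceil x
  simp only [SimpleGraph.Walk.mapLe, SimpleGraph.Walk.length_map]
  linarith
end

section
/- Let r ≥ 2 be an integer, let reals c₁ > c₂ > 1 and a positive integer k satisfy (k/2 − 1)·((c₁/c₂)^{1/2} − 1) ≥ 2. Let G = (V,E) be a finite graph on at least k vertices such that |E(G)| ≥ r·c₁·|V| and every subset S ⊆ V of size |S| ≤ k satisfies e(S) ≤ c₂|S|. Then every r-edge-coloring of G contains a monochromatic cycle of length at least (k/2 − 1)·((c₁/c₂)^{1/2} − 1). -/
open Classical in
/-- component of `x` inside `R` -/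
noncomputable def compIn {V : Type*} (K : SimpleGraph V) (R : Finset V) (x : V) : Finset V :=
  R.filter (fun y => ∃ p : K.Walk x y, p.IsPath ∧ ∀ z ∈ p.support, z ∈ R)

lemma mem_compIn {V : Type*} {K : SimpleGraph V} {R : Finset V} {x y : V} :
    y ∈ compIn K R x ↔ ∃ p : K.Walk x y, ∀ z ∈ p.support, z ∈ R := by
  classical
  simp only [compIn, Finset.mem_filter]
  constructor
  · rintro ⟨_, p, _, h⟩; exact ⟨p, h⟩
  · rintro ⟨p, h⟩
    exact ⟨h _ p.end_mem_support, p.bypass, p.bypass_isPath,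
      fun z hz => h z (p.support_bypass_subset_support hz)⟩

lemma compIn_self {V : Type*} {K : SimpleGraph V} {R : Finset V} {x : V} (hx : x ∈ R) :
    x ∈ compIn K R x := mem_compIn.2 ⟨.nil, by simpa using hx⟩

lemma compIn_sub {V : Type*} {K : SimpleGraph V} {R : Finset V} {x : V} :
    compIn K R x ⊆ R := by
  intro y hy
  obtain ⟨p, h⟩ := mem_compIn.1 hy
  exact h _ p.end_mem_support

lemma compIn_adj {V : Type*} {K : SimpleGraph V} {R : Finset V} {x y z : V}
    (hy : y ∈ compIn K R x) (h : K.Adj y z) (hz : z ∈ R) : z ∈ compIn K R x := by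
  obtain ⟨p, hp⟩ := mem_compIn.1 hy
  refine mem_compIn.2 ⟨p.concat h, ?_⟩
  intro a ha
  rw [SimpleGraph.Walk.support_concat] at ha
  simp only [List.concat_eq_append, List.mem_append, List.mem_singleton] at ha
  rcases ha with ha | rfl
  · exact hp a ha
  · exact hz

lemma compIn_trans {V : Type*} {K : SimpleGraph V} {R : Finset V} {x y : V}
    (hy : x ∈ compIn K R y) : compIn K R x ⊆ compIn K R y := by
  intro z hz
  obtain ⟨p, hp⟩ := mem_compIn.1 hy
  obtain ⟨q, hq⟩ := mem_compIn.1 hz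
  refine mem_compIn.2 ⟨p.append q, ?_⟩
  intro a ha
  rw [SimpleGraph.Walk.mem_support_append_iff] at ha
  exact ha.elim (hp a) (hq a)

lemma compIn_path {V : Type*} {K : SimpleGraph V} {R : Finset V} {x y : V}
    (hy : y ∈ compIn K R x) :
    ∃ p : K.Walk x y, p.IsPath ∧ ∀ z ∈ p.support, z ∈ compIn K R x := by
  classical
  obtain ⟨p, hp⟩ := mem_compIn.1 hy
  refine ⟨p.bypass, p.bypass_isPath, fun z hz => ?_⟩
  have hz' := p.support_bypass_subset_support hz
  exact mem_compIn.2 ⟨p.takeUntil z hz', fun a ha => hp a (p.support_takeUntil_subset hz' ha)⟩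

lemma split_lemma {V : Type*} (K : SimpleGraph V) (R : Finset V) (A : Set V) (m : ℕ)
    (hm : 1 ≤ m) (hR : m ≤ R.card) (hcl : ∀ x ∈ R, ∀ y, K.Adj x y → y ∈ R ∨ y ∈ A) :
    (∃ W ⊆ R, m ≤ W.card ∧ W.card + 1 ≤ 2 * m ∧ ∀ x ∈ W, ∀ y, K.Adj x y → y ∈ W ∨ y ∈ A) ∨
    ∃ x ∈ R, m + 1 ≤ (compIn K R x).card := by
  classical
  obtain ⟨n, hn⟩ : ∃ n, R.card = n := ⟨_, rfl⟩
  have key : ∀ n, ∀ W : Finset V, W.card = n → W ⊆ R → m ≤ W.card →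
      (∀ x ∈ W, ∀ y, K.Adj x y → y ∈ W ∨ y ∈ A) →
      (∃ W ⊆ R, m ≤ W.card ∧ W.card + 1 ≤ 2 * m ∧ ∀ x ∈ W, ∀ y, K.Adj x y → y ∈ W ∨ y ∈ A) ∨
      ∃ x ∈ R, m + 1 ≤ (compIn K R x).card := by
    intro n
    induction n using Nat.strong_induction_on with
    | _ n ih =>
      intro W hWn hWR hmW hW
      by_cases h2 : W.card + 1 ≤ 2 * m
      · exact Or.inl ⟨W, hWR, hmW, h2, hW⟩
      obtain ⟨x, hx⟩ : W.Nonempty := Finset.card_pos.1 (by omega)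
      by_cases h3 : m + 1 ≤ (compIn K R x).card
      · exact Or.inr ⟨x, hWR hx, h3⟩
      have hle := Finset.le_card_sdiff (compIn K R x) W
      have hlt : (W \ compIn K R x).card < n := by
        rw [← hWn]
        apply Finset.card_lt_card
        refine ⟨Finset.sdiff_subset, fun h => ?_⟩
        exact (Finset.mem_sdiff.1 (h hx)).2 (compIn_self (hWR hx))
      refine ih _ hlt _ rfl (Finset.sdiff_subset.trans hWR) (by omega) ?_
      intro z hz y hzy
      rw [Finset.mem_sdiff] at hz
      rcases hW z hz.1 y hzy with h | h
      · left
        rw [Finset.mem_sdiff]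
        exact ⟨h, fun hy => hz.2 (compIn_adj hy hzy.symm (hWR hz.1))⟩
      · exact Or.inr h
  exact key _ R rfl subset_rfl hR hcl

lemma path_cut {V : Type*} [DecidableEq V] (K : SimpleGraph V) {v a : V} (A : K.Walk v a)
    (hA : A.IsPath) :
    ∀ N : Finset V, N.Nonempty → (∀ y ∈ N, y ∈ A.support) →
    ∃ u ∈ N, ∃ B : K.Walk v u, B.IsPath ∧ (∀ y ∈ B.support, y ∈ A.support) ∧
      ∀ y ∈ N, y ∈ B.support := by
  induction A with
  | nil =>
    rintro N ⟨y, hy⟩ hN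
    have := hN y hy
    simp only [SimpleGraph.Walk.support_nil, List.mem_singleton] at this
    subst this
    exact ⟨y, hy, .nil, by simp, by simp, by simpa using hN⟩
  | @cons v v' a h A' ih =>
    intro N hNe hN
    rw [SimpleGraph.Walk.cons_isPath_iff] at hA
    by_cases hE : (N.erase v).Nonempty
    · obtain ⟨u, hu, B, hB, hBA, hNB⟩ := ih hA.1 (N.erase v) hE (by
        intro y hy
        rw [Finset.mem_erase] at hy
        have := hN y hy.2
        rw [SimpleGraph.Walk.support_cons, List.mem_cons] at this
        exact this.resolve_left hy.1)
      refine ⟨u, Finset.mem_of_mem_erase hu, .cons h B, ?_, ?_, ?_⟩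
      · rw [SimpleGraph.Walk.cons_isPath_iff]
        exact ⟨hB, fun h => hA.2 (hBA _ h)⟩
      · intro y hy
        rw [SimpleGraph.Walk.support_cons, List.mem_cons] at hy ⊢
        exact hy.imp_right (hBA y)
      · intro y hy
        rw [SimpleGraph.Walk.support_cons, List.mem_cons]
        by_cases hyv : y = v
        · exact Or.inl hyv
        · exact Or.inr (hNB y (Finset.mem_erase.2 ⟨hyv, hy⟩))
    · have hall : ∀ y ∈ N, y = v := by
        intro y hy
        by_contra hne
        exact hE ⟨y, Finset.mem_erase.2 ⟨hne, hy⟩⟩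
      obtain ⟨y, hy⟩ := hNe
      have := hall y hy
      subst this
      exact ⟨y, hy, .nil, by simp, by simp, by simpa using hall⟩

lemma close_cycle {V : Type*} (K : SimpleGraph V) {v u x : V} (B : K.Walk v u) (p : K.Walk v x)
    (hB : B.IsPath) (hp : p.IsPath) (hd : ∀ y ∈ B.support, y ∈ p.support → y = v)
    (hux : K.Adj u x) (huv : u ≠ v) (hxv : x ≠ v) :
    ∃ (b : V) (w : K.Walk b b), w.IsCycle ∧ B.length + 2 ≤ w.length := by
  have hlen : 1 ≤ p.length := by
    rcases Nat.eq_zero_or_pos p.length with h | h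
    · exact absurd (SimpleGraph.Walk.eq_of_length_eq_zero h).symm hxv
    · exact h
  refine ⟨u, .cons hux (p.reverse.append B), ?_, ?_⟩
  · rw [SimpleGraph.Walk.cons_isCycle_iff]
    constructor
    · rw [SimpleGraph.Walk.isPath_def, SimpleGraph.Walk.support_append]
      rw [List.nodup_append']
      refine ⟨?_, ?_, ?_⟩
      · exact hp.reverse.support_nodup
      · exact hB.support_nodup.tail
      · intro y hy hy'
        have h1 : y ∈ p.support := by simpa using hy
        have h2 := hd y (List.mem_of_mem_tail hy') h1
        have h3 := hB.support_nodup
        rw [SimpleGraph.Walk.support_eq_cons, List.nodup_cons] at h3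
        exact h3.1 (h2 ▸ hy')
    · rw [SimpleGraph.Walk.edges_append, List.mem_append]
      rintro (h | h)
      · have := SimpleGraph.Walk.fst_mem_support_of_mem_edges _ h
        exact huv (hd u B.end_mem_support (by simpa using this))
      · have := SimpleGraph.Walk.snd_mem_support_of_mem_edges _ h
        exact hxv (hd x this p.end_mem_support)
  · simp only [SimpleGraph.Walk.length_cons, SimpleGraph.Walk.length_append,
      SimpleGraph.Walk.length_reverse]
    omega

open Classical in
/-- outer neighbourhood -/
noncomputable def nbr {V : Type*} [Fintype V] (K : SimpleGraph V) (W : Finset V) : Finset V :=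
  Finset.univ.filter (fun y => y ∉ W ∧ ∃ x ∈ W, K.Adj x y)

lemma main_rec {V : Type*} [Fintype V] (K : SimpleGraph V) (U : Finset V) (m t : ℕ) (hm : 1 ≤ m)
    (ht : 2 ≤ t)
    (hexp : ∀ W ⊆ U, m ≤ W.card → W.card + 1 ≤ 2 * m → t ≤ (nbr K W).card) :
    ∀ n : ℕ, ∀ (C : Finset V) (v a : V) (A : K.Walk v a), C.card = n → A.IsPath → v ∈ C → C ⊆ U →
      (∀ y ∈ A.support, y ∈ C → y = v) →
      (∀ x ∈ C, ∃ p : K.Walk v x, p.IsPath ∧ ∀ z ∈ p.support, z ∈ C) →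
      m + 1 ≤ C.card → (∀ x ∈ C, ∀ y, K.Adj x y → y ∈ C ∨ y ∈ A.support) →
      ∃ (b : V) (w : K.Walk b b), w.IsCycle ∧ t + 1 ≤ w.length := by
  classical
  intro n
  induction n using Nat.strong_induction_on with
  | _ n ih =>
    intro C v a A hCn hA hvC hCU hAC hpath hmC hcl
    have hRc : (C.erase v).card = C.card - 1 := Finset.card_erase_of_mem hvC
    have hclR : ∀ x ∈ C.erase v, ∀ y, K.Adj x y → y ∈ C.erase v ∨ y ∈ {y | y ∈ A.support} := by
      intro x hx y hxy
      rw [Finset.mem_erase] at hx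
      by_cases hyv : y = v
      · right; rw [hyv]; exact A.start_mem_support
      · rcases hcl x hx.2 y hxy with h | h
        · exact Or.inl (Finset.mem_erase.2 ⟨hyv, h⟩)
        · exact Or.inr h
    rcases split_lemma K (C.erase v) {y | y ∈ A.support} m hm (by omega) hclR with
      ⟨W, hWR, hmW, hWm, hW⟩ | ⟨x, hx, hxc⟩
    · have hN := hexp W (hWR.trans ((Finset.erase_subset _ _).trans hCU)) hmW hWm
      have hNA : ∀ y ∈ nbr K W, y ∈ A.support := by
        intro y hy
        simp only [nbr, Finset.mem_filter, Finset.mem_univ, true_and] at hy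
        obtain ⟨hyW, x, hxW, hxy⟩ := hy
        exact (hW x hxW y hxy).resolve_left hyW
      obtain ⟨u, hu, B, hB, hBA, hNB⟩ := path_cut K A hA (nbr K W)
        (Finset.card_pos.1 (by omega)) hNA
      have hcard : (nbr K W).card ≤ B.length + 1 := by
        rw [← SimpleGraph.Walk.length_support]
        calc (nbr K W).card ≤ B.support.toFinset.card :=
              Finset.card_le_card (fun y hy => List.mem_toFinset.2 (hNB y hy))
          _ ≤ _ := List.toFinset_card_le _
      simp only [nbr, Finset.mem_filter, Finset.mem_univ, true_and] at hu
      obtain ⟨huW, x, hxW, hxu⟩ := hu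
      have hxC := Finset.mem_erase.1 (hWR hxW)
      obtain ⟨p, hp, hpC⟩ := hpath x hxC.2
      have huv : u ≠ v := by
        rintro rfl
        have := SimpleGraph.Walk.isPath_iff_eq_nil.1 hB
        rw [this] at hcard
        simp at hcard
        omega
      obtain ⟨b, w, hw, hl⟩ := close_cycle K B p hB hp
        (fun y hy hy' => hAC y (hBA y hy) (hpC y hy')) hxu.symm huv hxC.1
      exact ⟨b, w, hw, by omega⟩
    · have hxC := Finset.mem_erase.1 hx
      obtain ⟨p, hp, hpC⟩ := hpath x hxC.2
      cases p with
      | nil => exact absurd rfl hxC.1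
      | @cons _ v' _ h p' =>
        rw [SimpleGraph.Walk.cons_isPath_iff] at hp
        have hp'R : ∀ z ∈ p'.support, z ∈ C.erase v := by
          intro z hz
          refine Finset.mem_erase.2 ⟨fun e => hp.2 (e ▸ hz), hpC z ?_⟩
          rw [SimpleGraph.Walk.support_cons]
          exact List.mem_cons_of_mem _ hz
        have hv'R : v' ∈ C.erase v := hp'R v' p'.start_mem_support
        have hxin : x ∈ compIn K (C.erase v) v' := mem_compIn.2 ⟨p', hp'R⟩
        have hsub := compIn_trans hxin
        have hcle := Finset.card_le_card hsub
        have hv'A : v' ∉ A.support := by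
          intro hh
          exact (Finset.mem_erase.1 hv'R).1 (hAC v' hh (Finset.mem_erase.1 hv'R).2)
        refine ih (compIn K (C.erase v) v').card ?_ _ v' a (.cons h.symm A) rfl ?_ ?_ ?_ ?_ ?_ ?_ ?_
        · have := Finset.card_le_card (compIn_sub (K := K) (R := C.erase v) (x := v'))
          omega
        · rw [SimpleGraph.Walk.cons_isPath_iff]; exact ⟨hA, hv'A⟩
        · exact compIn_self hv'R
        · exact compIn_sub.trans ((Finset.erase_subset _ _).trans hCU)
        · intro y hy hyC
          rw [SimpleGraph.Walk.support_cons, List.mem_cons] at hy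
          rcases hy with hy | hy
          · exact hy
          · have h1 := Finset.mem_erase.1 (compIn_sub hyC)
            exact absurd (hAC y hy h1.2) h1.1
        · intro y hy
          exact compIn_path hy
        · omega
        · intro z hz y hzy
          rw [SimpleGraph.Walk.support_cons, List.mem_cons]
          rcases hclR z (compIn_sub hz) y hzy with h1 | h1
          · exact Or.inl (compIn_adj hz hzy h1)
          · exact Or.inr (Or.inr h1)

lemma main_cycle {V : Type*} [Fintype V] (K : SimpleGraph V) (U : Finset V) (m t : ℕ) (hm : 1 ≤ m)
    (ht : 2 ≤ t) (hU : m ≤ U.card) (hKU : ∀ x y, K.Adj x y → y ∈ U)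
    (hexp : ∀ W ⊆ U, m ≤ W.card → W.card + 1 ≤ 2 * m → t ≤ (nbr K W).card) :
    ∃ (b : V) (w : K.Walk b b), w.IsCycle ∧ t + 1 ≤ w.length := by
  classical
  rcases split_lemma K U ∅ m hm hU (fun x _ y h => Or.inl (hKU x y h)) with
      ⟨W, hWR, hmW, hWm, hW⟩ | ⟨x, hx, hxc⟩
  · exfalso
    have h := hexp W hWR hmW hWm
    have : nbr K W = ∅ := by
      rw [Finset.eq_empty_iff_forall_notMem]
      intro y hy
      simp only [nbr, Finset.mem_filter, Finset.mem_univ, true_and] at hy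
      obtain ⟨hyW, x, hxW, hxy⟩ := hy
      exact hyW ((hW x hxW y hxy).resolve_right (by simp))
    rw [this] at h
    simp at h
    omega
  · refine main_rec K U m t hm ht hexp _ (compIn K U x) x x .nil rfl (by simp) (compIn_self hx)
      compIn_sub (by simp) (fun y hy => compIn_path hy) hxc ?_
    intro z hz y hzy
    exact Or.inl (compIn_adj hz hzy (hKU z y hzy))

open Classical in
/-- adjacency indicator -/
noncomputable def adjI {V : Type*} (K : SimpleGraph V) (a b : V) : ℝ :=
  if K.Adj a b then 1 else 0

lemma adjI_pos {V : Type*} {K : SimpleGraph V} {a b : V} (h : K.Adj a b) : adjI K a b = 1 := by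
  simp [adjI, h]

lemma adjI_neg {V : Type*} {K : SimpleGraph V} {a b : V} (h : ¬ K.Adj a b) : adjI K a b = 0 := by
  simp [adjI, h]

lemma adjI_comm {V : Type*} (K : SimpleGraph V) (a b : V) : adjI K a b = adjI K b a := by
  by_cases h : K.Adj a b
  · rw [adjI_pos h, adjI_pos h.symm]
  · rw [adjI_neg h, adjI_neg (fun h' => h h'.symm)]

/-- number of ordered adjacent pairs -/
noncomputable def prs {V : Type*} (K : SimpleGraph V) (A B : Finset V) : ℝ :=
  ∑ a ∈ A, ∑ b ∈ B, adjI K a b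

lemma prs_nonneg {V : Type*} (K : SimpleGraph V) (A B : Finset V) : 0 ≤ prs K A B := by
  unfold prs
  exact Finset.sum_nonneg fun a _ => Finset.sum_nonneg fun b _ => by unfold adjI; split_ifs <;> norm_num

lemma prs_comm {V : Type*} (K : SimpleGraph V) (A B : Finset V) : prs K A B = prs K B A := by
  unfold prs
  rw [Finset.sum_comm]
  exact Finset.sum_congr rfl fun a _ => Finset.sum_congr rfl fun b _ => adjI_comm _ _ _

lemma prs_mono_graph {V : Type*} {K G : SimpleGraph V} (h : K ≤ G) (A B : Finset V) :
    prs K A B ≤ prs G A B := by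
  unfold prs
  refine Finset.sum_le_sum fun a _ => Finset.sum_le_sum fun b _ => ?_
  by_cases h1 : K.Adj a b
  · rw [adjI_pos h1, adjI_pos (h h1)]
  · rw [adjI_neg h1]; unfold adjI; split_ifs <;> norm_num

lemma prs_union {V : Type*} [DecidableEq V] (K : SimpleGraph V) (W T : Finset V)
    (h : Disjoint W T) :
    prs K (W ∪ T) (W ∪ T) = prs K W W + 2 * prs K W T + prs K T T := by
  have e : prs K T W = prs K W T := prs_comm _ _ _
  have : prs K (W ∪ T) (W ∪ T) = (prs K W W + prs K W T) + (prs K T W + prs K T T) := by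
    unfold prs
    rw [Finset.sum_union h]
    simp only [Finset.sum_union h, Finset.sum_add_distrib]
  rw [this, e]; ring

lemma prs_edges {V : Type*} [Fintype V] (G : SimpleGraph V) (S : Finset V) :
    2 * (({e : Sym2 V | e ∈ G.edgeSet ∧ ∀ x ∈ e, x ∈ (S : Set V)}).ncard : ℝ) = prs G S S := by
  classical
  let GS : SimpleGraph V :=
    { Adj := fun a b => G.Adj a b ∧ a ∈ S ∧ b ∈ S
      symm := ⟨fun a b h => ⟨h.1.symm, h.2.2, h.2.1⟩⟩
      loopless := ⟨fun a h => G.loopless.irrefl a h.1⟩ }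
  have h1 : {e : Sym2 V | e ∈ G.edgeSet ∧ ∀ x ∈ e, x ∈ (S : Set V)} = (GS.edgeFinset : Set (Sym2 V)) := by
    ext e
    induction e with
    | _ a b => simp [GS]
  rw [h1, Set.ncard_coe_finset]
  have h2 := GS.two_mul_card_edgeFinset
  have h3 : (2 : ℝ) * (GS.edgeFinset.card : ℝ) = ((2 * GS.edgeFinset.card : ℕ) : ℝ) := by push_cast; ring
  rw [h3, h2]
  unfold prs
  unfold adjI
  rw [← Finset.sum_product', Finset.sum_boole]
  congr 2
  ext ⟨a, b⟩
  simp [GS]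
  tauto

lemma top_subset {V : Type*} (N : Finset V) (f : V → ℝ) (p : ℕ) (hp : p ≤ N.card) :
    ∃ T ⊆ N, T.card = p ∧ (p : ℝ) * ∑ x ∈ N, f x ≤ (N.card : ℝ) * ∑ x ∈ T, f x := by
  classical
  induction hp using Nat.decreasingInduction with
  | self => exact ⟨N, subset_rfl, rfl, le_rfl⟩
  | of_succ p hp ih =>
    obtain ⟨T, hT, hTc, hs⟩ := ih
    obtain ⟨x, hx, hmin⟩ := T.exists_min_image f (Finset.card_pos.1 (by omega))
    refine ⟨T.erase x, (Finset.erase_subset _ _).trans hT, by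
      rw [Finset.card_erase_of_mem hx]; omega, ?_⟩
    have h1 : ∑ y ∈ T.erase x, f y + f x = ∑ y ∈ T, f y := Finset.sum_erase_add _ _ hx
    have h2 : (p : ℝ) * f x ≤ ∑ y ∈ T.erase x, f y := by
      have := Finset.card_nsmul_le_sum (T.erase x) f (f x)
        (fun y hy => hmin y (Finset.mem_of_mem_erase hy))
      rw [Finset.card_erase_of_mem hx, hTc] at this
      simpa using this
    push_cast at hs
    have hNp : (0 : ℝ) ≤ (N.card : ℝ) := by positivity
    have hp0 : (0 : ℝ) ≤ (p : ℝ) := by positivity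
    have h3 : (p : ℝ) * ∑ y ∈ T, f y ≤ (p + 1) * ∑ y ∈ T.erase x, f y := by
      rw [← h1]; nlinarith
    have h4 : (p + 1 : ℝ) * ((p : ℝ) * ∑ x ∈ N, f x) ≤
        (p + 1) * ((N.card : ℝ) * ∑ x ∈ T.erase x, f x) := by
      nlinarith [mul_le_mul_of_nonneg_left hs hp0, mul_le_mul_of_nonneg_left h3 hNp]
    exact le_of_mul_le_mul_left h4 (by positivity)

lemma arith_final (k w s q c₁ c₂ : ℝ) (hc₂ : 1 < c₂) (hq : 1 ≤ q) (hc : c₁ = q ^ 2 * c₂)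
    (hk : 0 < k) (hw1 : k ≤ 4 * w) (hw2 : 4 * w ≤ 3 * k)
    (h : c₁ * w ≤ c₂ * (w + s) ∨ c₁ * w * (k - w) ≤ s * c₂ * k) :
    (k / 2 - 1) * (q - 1) ≤ s := by
  have hc0 : 0 < c₂ := by linarith
  subst hc
  suffices hh : k / 2 * (q - 1) ≤ s by nlinarith
  rcases h with h | h
  · have h1 : q ^ 2 * w ≤ w + s := by
      refine le_of_mul_le_mul_left ?_ hc0
      linarith
    nlinarith [mul_nonneg (sub_nonneg.2 hq) (sub_nonneg.2 hq), mul_nonneg (mul_nonneg (sub_nonneg.2 hq) (sub_nonneg.2 hq)) hk.le, mul_le_mul_of_nonneg_left hw1 (by nlinarith : 0 ≤ q ^ 2 - 1)]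
  · have h1 : q ^ 2 * (w * (k - w)) ≤ s * k := by
      refine le_of_mul_le_mul_left ?_ hc0
      linarith
    have h2 : 3 * k ^ 2 / 16 ≤ w * (k - w) := by nlinarith
    have h3 : q ^ 2 * (3 * k ^ 2 / 16) ≤ s * k := (mul_le_mul_of_nonneg_left h2 (by positivity)).trans h1
    have h4 : q ^ 2 * (3 * k / 16) ≤ s := by
      refine le_of_mul_le_mul_right ?_ hk
      linarith
    have h5 : (q - 1) / 2 ≤ q ^ 2 * 3 / 16 := by nlinarith [sq_nonneg (3 * q - 4)]
    nlinarith


/-- Let `r ≥ 2` be an integer, let reals `c₁ > c₂ > 1` and a positive integer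
`k` satisfy `(k/2 - 1)·((c₁/c₂)^(1/2) - 1) ≥ 2`.  Let `G` be a finite graph on at least `k`
vertices such that `|E(G)| ≥ r·c₁·|V|` and every subset `S ⊆ V` of size `|S| ≤ k` satisfies
`e(S) ≤ c₂·|S|`.  Then every `r`-edge-coloring of `G` contains a monochromatic cycle of
length at least `(k/2 - 1)·((c₁/c₂)^(1/2) - 1)`. -/
theorem stmt_12 (r : ℕ) (hr : 2 ≤ r) {V : Type*} [Fintype V] (c₁ c₂ : ℝ) (k : ℕ) (hk : 0 < k)
    (hc₂ : 1 < c₂) (hc₁ : c₂ < c₁)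
    (hineq : 2 ≤ ((k : ℝ) / 2 - 1) * (Real.sqrt (c₁ / c₂) - 1))
    (G : SimpleGraph V)
    (hV : k ≤ Fintype.card V)
    (hE : (r : ℝ) * c₁ * (Fintype.card V : ℝ) ≤ (G.edgeSet.ncard : ℝ))
    (hloc : ∀ S : Set V, S.ncard ≤ k →
      (({e : Sym2 V | e ∈ G.edgeSet ∧ ∀ x ∈ e, x ∈ S}).ncard : ℝ) ≤ c₂ * S.ncard) :
    ∀ c : Sym2 V → Fin r, ∃ (v : V) (w : G.Walk v v), w.IsCycle ∧
      ((k : ℝ) / 2 - 1) * (Real.sqrt (c₁ / c₂) - 1) ≤ (w.length : ℝ) ∧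
      ∃ j : Fin r, ∀ e ∈ w.edges, c e = j := by
  classical
  intro c
  set q := Real.sqrt (c₁ / c₂) with hqdef
  have hc0 : 0 < c₂ := by linarith
  have hq1 : 1 ≤ q := by
    rw [hqdef, Real.one_le_sqrt, le_div_iff₀ hc0]; linarith
  have hcq : c₁ = q ^ 2 * c₂ := by
    rw [hqdef, Real.sq_sqrt (div_nonneg (by linarith) hc0.le)]; field_simp
  have hk3 : 3 ≤ k := by
    by_contra hlt
    have : (k : ℝ) ≤ 2 := by exact_mod_cast (by omega : k ≤ 2)
    nlinarith
  have hkpos : (0 : ℝ) < k := by exact_mod_cast hk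
  have hVpos : 0 < Fintype.card V := by omega
  -- colour classes
  let H : Fin r → SimpleGraph V := fun j =>
    { Adj := fun a b => G.Adj a b ∧ c s(a, b) = j
      symm := ⟨fun a b h => ⟨h.1.symm, by rw [Sym2.eq_swap]; exact h.2⟩⟩
      loopless := ⟨fun a h => G.loopless.irrefl a h.1⟩ }
  have hsum : prs G Finset.univ Finset.univ = ∑ j, prs (H j) Finset.univ Finset.univ := by
    unfold prs
    rw [Finset.sum_comm (s := (Finset.univ : Finset (Fin r)))]
    refine Finset.sum_congr rfl fun a _ => ?_
    rw [Finset.sum_comm (s := (Finset.univ : Finset (Fin r)))]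
    refine Finset.sum_congr rfl fun b _ => ?_
    by_cases hab : G.Adj a b
    · rw [adjI_pos hab, Finset.sum_eq_single (c s(a, b))]
      · rw [adjI_pos]; exact ⟨hab, rfl⟩
      · intro i _ hi
        exact adjI_neg fun h => hi h.2.symm
      · simp
    · rw [adjI_neg hab, Finset.sum_eq_zero]
      intro i _
      exact adjI_neg fun h => hab h.1
  have hEG : 2 * ((r : ℝ) * c₁ * (Fintype.card V : ℝ)) ≤ prs G Finset.univ Finset.univ := by
    rw [← prs_edges]
    have : {e : Sym2 V | e ∈ G.edgeSet ∧ ∀ x ∈ e, x ∈ ((Finset.univ : Finset V) : Set V)}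
        = G.edgeSet := by ext e; simp
    rw [this]; linarith
  obtain ⟨j, hj⟩ : ∃ j, 2 * (c₁ * (Fintype.card V : ℝ)) ≤ prs (H j) Finset.univ Finset.univ := by
    by_contra! hcon
    have : ∑ j, prs (H j) Finset.univ Finset.univ <
        ∑ _j : Fin r, 2 * (c₁ * (Fintype.card V : ℝ)) := by
      refine Finset.sum_lt_sum_of_nonempty ?_ fun j _ => hcon j
      exact ⟨⟨0, by omega⟩, Finset.mem_univ _⟩
    simp only [Finset.sum_const, Finset.card_univ, Fintype.card_fin, nsmul_eq_mul] at this
    linarith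
  have hHG : H j ≤ G := fun a b h => h.1
  have hlocH : ∀ S : Finset V, S.card ≤ k → prs (H j) S S ≤ 2 * (c₂ * S.card) := by
    intro S hS
    have h1 := hloc (S : Set V) (by rwa [Set.ncard_coe_finset])
    rw [Set.ncard_coe_finset] at h1
    have h2 := prs_edges G S
    have h3 := prs_mono_graph hHG S S
    linarith
  -- minimal dense subset
  obtain ⟨U, hUmem, hUmin⟩ := (Finset.univ.filter (fun U : Finset V =>
      U.Nonempty ∧ 2 * (c₁ * (U.card : ℝ)) ≤ prs (H j) U U)).exists_min_image Finset.card
    ⟨Finset.univ, by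
      simp only [Finset.mem_filter, Finset.mem_univ, true_and]
      exact ⟨Finset.card_pos.1 (by simpa using hVpos), by simpa using hj⟩⟩
  simp only [Finset.mem_filter, Finset.mem_univ, true_and] at hUmem hUmin
  obtain ⟨hUne, hUd⟩ := hUmem
  have hUk : k < U.card := by
    by_contra! hle
    have h1 := hlocH U hle
    have h2 : (0 : ℝ) < U.card := by exact_mod_cast hUne.card_pos
    nlinarith
  let K : SimpleGraph V :=
    { Adj := fun a b => (H j).Adj a b ∧ a ∈ U ∧ b ∈ U
      symm := ⟨fun a b h => ⟨h.1.symm, h.2.2, h.2.1⟩⟩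
      loopless := ⟨fun a h => (H j).loopless.irrefl a h.1⟩ }
  set t := ⌈((k : ℝ) / 2 - 1) * (q - 1)⌉₊ with htdef
  have ht2 : 2 ≤ t := by
    have : (2 : ℝ) ≤ t := hineq.trans (Nat.le_ceil _)
    exact_mod_cast this
  obtain ⟨b, w, hw, hl⟩ := main_cycle K U ((k + 3) / 4) t (by omega) ht2 (by omega)
    (fun x y h => h.2.2) (by
      intro W hWU hW1 hW2
      rw [htdef, Nat.ceil_le]
      have hw1 : (k : ℝ) ≤ 4 * (W.card : ℝ) := by exact_mod_cast (by omega : k ≤ 4 * W.card)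
      have hw2 : 4 * (W.card : ℝ) ≤ 3 * k := by
        exact_mod_cast (by omega : 4 * W.card ≤ 3 * k)
      refine arith_final k W.card _ q c₁ c₂ hc₂ hq1 hcq hkpos hw1 hw2 ?_
      have hWk : W.card ≤ k := by omega
      set N := nbr K W with hN
      have hNW : Disjoint W N := by
        rw [Finset.disjoint_right]
        intro y hy
        simp only [hN, nbr, Finset.mem_filter, Finset.mem_univ, true_and] at hy
        exact hy.1
      have hdec := prs_union (H j) W (U \ W) Finset.disjoint_sdiff
      rw [Finset.union_sdiff_of_subset hWU] at hdec
      have hWN : prs (H j) W (U \ W) = prs (H j) W N := by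
        unfold prs
        refine Finset.sum_congr rfl fun a ha => ?_
        symm
        apply Finset.sum_subset
        · intro y hy
          simp only [hN, nbr, Finset.mem_filter, Finset.mem_univ, true_and] at hy
          obtain ⟨h2, x, hx, h3⟩ := hy
          exact Finset.mem_sdiff.2 ⟨h3.2.2, h2⟩
        · intro y hy hyN
          rw [Finset.mem_sdiff] at hy
          apply adjI_neg
          intro h3
          apply hyN
          simp only [hN, nbr, Finset.mem_filter, Finset.mem_univ, true_and]
          exact ⟨hy.2, a, ha, h3, hWU ha, hy.1⟩
      have hsd : (U \ W).card = U.card - W.card := Finset.card_sdiff_of_subset hWU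
      have hrest : prs (H j) (U \ W) (U \ W) < 2 * (c₁ * ((U \ W).card : ℝ)) := by
        by_contra! hge
        have := hUmin (U \ W) ⟨Finset.card_pos.1 (by omega), hge⟩
        omega
      have hsd' : ((U \ W).card : ℝ) = (U.card : ℝ) - W.card := by
        rw [hsd, Nat.cast_sub (by omega)]
      rw [hsd'] at hrest
      have hinc : 2 * (c₁ * (W.card : ℝ)) ≤ prs (H j) W W + 2 * prs (H j) W N := by
        rw [← hWN]; linarith
      by_cases hbig : W.card + N.card ≤ k
      · left
        have h1 := hlocH (W ∪ N) (by rwa [Finset.card_union_of_disjoint hNW])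
        rw [prs_union _ _ _ hNW, Finset.card_union_of_disjoint hNW] at h1
        have := prs_nonneg (H j) N N
        push_cast at h1
        linarith
      · right
        obtain ⟨T, hTN, hTc, hT⟩ := top_subset N
          (fun y => ∑ a ∈ W, adjI (H j) a y) (k - W.card) (by omega)
        have hTe : ∀ X : Finset V, (∑ y ∈ X, ∑ a ∈ W, adjI (H j) a y)
            = prs (H j) W X := by
          intro X; unfold prs; rw [Finset.sum_comm]
        simp only [hTe] at hT
        have hWT : Disjoint W T := Finset.disjoint_of_subset_right hTN hNW
        have hWTc : (W ∪ T).card = k := by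
          rw [Finset.card_union_of_disjoint hWT]; omega
        have h1 := hlocH (W ∪ T) hWTc.le
        rw [prs_union _ _ _ hWT, hWTc] at h1
        have h2 := prs_nonneg (H j) T T
        have h3 := prs_nonneg (H j) W W
        rw [Nat.cast_sub hWk] at hT
        have hkw : (0 : ℝ) ≤ (k : ℝ) - W.card := by
          have : (W.card : ℝ) ≤ k := by exact_mod_cast hWk
          linarith
        have hsk : (k : ℝ) - W.card ≤ N.card := by
          have : (k : ℝ) ≤ W.card + N.card := by exact_mod_cast (by omega : k ≤ W.card + N.card)
          linarith
        have hN0 : (0 : ℝ) ≤ N.card := Nat.cast_nonneg _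
        have h4 := mul_le_mul_of_nonneg_left hinc hkw
        have h5 := mul_le_mul_of_nonneg_right hsk h3
        have h6 : (N.card : ℝ) * (prs (H j) W W + 2 * prs (H j) W T) ≤
            N.card * (2 * (c₂ * k)) := mul_le_mul_of_nonneg_left (by linarith) hN0
        linarith)
  have hKG : K ≤ G := fun a b h => h.1.1
  refine ⟨b, w.mapLe hKG, hw.mapLe hKG, ?_, j, ?_⟩
  · have h1 : (t : ℝ) ≤ w.length := by exact_mod_cast (by omega : t ≤ w.length)
    have h2 : ((k : ℝ) / 2 - 1) * (q - 1) ≤ t := Nat.le_ceil _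
    rw [SimpleGraph.Walk.length_mapLe]; exact h2.trans h1
  · intro e he
    have he' : e ∈ w.edges := by rwa [SimpleGraph.Walk.edges_mapLe_eq_edges] at he
    have := w.edges_subset_edgeSet he'
    induction e with
    | _ x y => exact this.1.2
end
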